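/- Let k be a number field, let v be a nonarchimedean place of k with completion k_v, and set S_v := k^× ∩ k_v^{×2} and N_v := k^× − S_v. Then both S_v and N_v are diophantine over k. -/

import Mathlib

/-- A subset `A ⊆ k^n` is diophantine over `k` if there exist `m ∈ ℕ` and finitely many
polynomials `f₁, …, f_r ∈ k[x₁, …, x_{n+m}]` such that
`A = {a ∈ k^n : ∃ b ∈ k^m, f_i(a,b) = 0 for all i}`. -/
def IsDiophantine (k : Type*) [Field k] {n : ℕ} (A : Set (Fin n → k)) : Prop :=
  ∃ (m r : ℕ) (f : Fin r → MvPolynomial (Fin (n + m)) k),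
    A = {a : Fin n → k | ∃ b : Fin m → k,
      ∀ i : Fin r, MvPolynomial.eval (Fin.append a b) (f i) = 0}

/-- A subset of `k` is diophantine if the corresponding subset of `k¹` is. -/
def IsDiophantineSet (k : Type*) [Field k] (A : Set k) : Prop :=
  IsDiophantine k {x : Fin 1 → k | x 0 ∈ A}

open IsDedekindDomain

/-- A predicate on `σ → k` is existentially polynomial if it is the projection of the zero locus
of a finite set of polynomials. -/
def IsExistentialPoly {k : Type*} [Field k] {σ : Type} (P : (σ → k) → Prop) : Prop :=
  ∃ (τ : Type) (_ : Finite τ) (s : Set (MvPolynomial (σ ⊕ τ) k)), s.Finite ∧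
    ∀ a, P a ↔ ∃ b : τ → k, ∀ f ∈ s, MvPolynomial.eval (Sum.elim a b) f = 0

namespace IsExistentialPoly

open MvPolynomial

variable {k : Type*} [Field k] {σ σ' : Type}

lemma eval_rename_sumElim {τ τ' : Type} (g : τ → τ') (a : σ → k) (b : τ' → k)
    (f : MvPolynomial (σ ⊕ τ) k) :
    eval (Sum.elim a b) (rename (Sum.map id g) f) = eval (Sum.elim a (b ∘ g)) f := by
  rw [eval_rename]
  congr 2
  ext (x | x) <;> rfl

lemma congr' {P Q : (σ → k) → Prop} (h : IsExistentialPoly P) (e : ∀ a, Q a ↔ P a) :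
    IsExistentialPoly Q := by
  have : Q = P := by ext a; exact e a
  rwa [this]

lemma eq_zero (f : MvPolynomial σ k) : IsExistentialPoly (fun a => eval a f = 0) := by
  refine ⟨Empty, inferInstance, {rename Sum.inl f}, Set.finite_singleton _, fun a => ?_⟩
  simp [eval_rename, Function.comp_def]

lemma and {P Q : (σ → k) → Prop} (hP : IsExistentialPoly P) (hQ : IsExistentialPoly Q) :
    IsExistentialPoly (fun a => P a ∧ Q a) := by
  obtain ⟨τ, _, s, hs, h⟩ := hP
  obtain ⟨τ', _, s', hs', h'⟩ := hQ
  refine ⟨τ ⊕ τ', inferInstance, (rename (Sum.map id Sum.inl)) '' s ∪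
    (rename (Sum.map id Sum.inr)) '' s', (hs.image _).union (hs'.image _), fun a => ?_⟩
  simp only [h, h']
  constructor
  · rintro ⟨⟨b, hb⟩, b', hb'⟩
    refine ⟨Sum.elim b b', ?_⟩
    rintro f (⟨g, hg, rfl⟩ | ⟨g, hg, rfl⟩)
    · rw [eval_rename_sumElim]; exact hb g hg
    · rw [eval_rename_sumElim]; exact hb' g hg
  · rintro ⟨b, hb⟩
    refine ⟨⟨b ∘ Sum.inl, fun f hf => ?_⟩, b ∘ Sum.inr, fun f hf => ?_⟩
    · rw [← eval_rename_sumElim]; exact hb _ (Or.inl ⟨f, hf, rfl⟩)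
    · rw [← eval_rename_sumElim]; exact hb _ (Or.inr ⟨f, hf, rfl⟩)

lemma or {P Q : (σ → k) → Prop} (hP : IsExistentialPoly P) (hQ : IsExistentialPoly Q) :
    IsExistentialPoly (fun a => P a ∨ Q a) := by
  obtain ⟨τ, _, s, hs, h⟩ := hP
  obtain ⟨τ', _, s', hs', h'⟩ := hQ
  refine ⟨τ ⊕ τ', inferInstance, Set.image2 (fun f g => rename (Sum.map id Sum.inl) f *
    rename (Sum.map id Sum.inr) g) s s', hs.image2 _ hs', fun a => ?_⟩
  simp only [h, h']
  constructor
  · rintro (⟨b, hb⟩ | ⟨b, hb⟩)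
    · refine ⟨Sum.elim b 0, ?_⟩
      rintro _ ⟨f, hf, g, hg, rfl⟩
      simp only [map_mul, eval_rename_sumElim]
      exact mul_eq_zero_of_left (hb f hf) _
    · refine ⟨Sum.elim 0 b, ?_⟩
      rintro _ ⟨f, hf, g, hg, rfl⟩
      simp only [map_mul, eval_rename_sumElim]
      exact mul_eq_zero_of_right _ (hb g hg)
  · rintro ⟨b, hb⟩
    by_contra! hc
    obtain ⟨h1, h2⟩ := hc
    obtain ⟨f, hf, hf0⟩ := h1 (b ∘ Sum.inl)
    obtain ⟨g, hg, hg0⟩ := h2 (b ∘ Sum.inr)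
    have := hb _ ⟨f, hf, g, hg, rfl⟩
    simp only [map_mul, eval_rename_sumElim] at this
    exact (mul_ne_zero hf0 hg0) this

lemma exists' {τ : Type} [Finite τ] {P : (σ ⊕ τ → k) → Prop} (hP : IsExistentialPoly P) :
    IsExistentialPoly (fun a : σ → k => ∃ b : τ → k, P (Sum.elim a b)) := by
  obtain ⟨τ', _, s, hs, h⟩ := hP
  refine ⟨τ ⊕ τ', inferInstance, rename (Equiv.sumAssoc σ τ τ') '' s, hs.image _, fun a => ?_⟩
  have key : ∀ (b : τ → k) (c : τ' → k), Sum.elim a (Sum.elim b c) ∘ (Equiv.sumAssoc σ τ τ') =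
      Sum.elim (Sum.elim a b) c := by
    intro b c; ext ((x | x) | x) <;> rfl
  simp only [h]
  constructor
  · rintro ⟨b, c, hc⟩
    refine ⟨Sum.elim b c, ?_⟩
    rintro _ ⟨f, hf, rfl⟩
    rw [eval_rename, key]; exact hc f hf
  · rintro ⟨b, hb⟩
    refine ⟨b ∘ Sum.inl, b ∘ Sum.inr, fun f hf => ?_⟩
    rw [← key, ← eval_rename, Sum.elim_comp_inl_inr]
    exact hb _ ⟨f, hf, rfl⟩

lemma comap {P : (σ → k) → Prop} (hP : IsExistentialPoly P) (φ : σ → MvPolynomial σ' k) :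
    IsExistentialPoly (fun a : σ' → k => P (fun i => eval a (φ i))) := by
  obtain ⟨τ, _, s, hs, h⟩ := hP
  refine ⟨τ, inferInstance,
    (bind₁ (Sum.elim (fun i => rename Sum.inl (φ i)) (fun j => X (Sum.inr j)))) '' s,
    hs.image _, fun a => ?_⟩
  have key : ∀ (b : τ → k) (f : MvPolynomial (σ ⊕ τ) k), eval (Sum.elim a b)
      (bind₁ (Sum.elim (fun i => rename Sum.inl (φ i)) (fun j => X (Sum.inr j))) f) =
      eval (Sum.elim (fun i => eval a (φ i)) b) f := by
    intro b f
    rw [eval, eval₂Hom_bind₁]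
    congr 2
    ext (x | x)
    · simp [eval_rename, ← eval.eq_1]
    · simp
  simp only [h]
  simp [key]

lemma ne_zero (f : MvPolynomial σ k) : IsExistentialPoly (fun a => eval a f ≠ 0) := by
  refine (exists' (τ := Unit) (eq_zero (rename Sum.inl f * X (Sum.inr ()) - 1))).congr'
    fun a => ?_
  simp only [map_sub, map_mul, eval_rename, Sum.elim_comp_inl, eval_X, Sum.elim_inr, map_one,
    sub_eq_zero]
  constructor
  · intro h
    exact ⟨fun _ => (eval a f)⁻¹, mul_inv_cancel₀ h⟩
  · rintro ⟨b, hb⟩ h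
    simp [h] at hb

lemma const (p : Prop) : IsExistentialPoly (fun _ : σ → k => p) := by
  by_cases hp : p
  · exact (eq_zero (0 : MvPolynomial σ k)).congr' (by simp [hp])
  · exact (eq_zero (1 : MvPolynomial σ k)).congr' (by simp [hp])

lemma finite_or {ι : Type*} {s : Set ι} (hs : s.Finite) {P : ι → (σ → k) → Prop}
    (h : ∀ i ∈ s, IsExistentialPoly (P i)) :
    IsExistentialPoly (fun a => ∃ i ∈ s, P i a) := by
  induction s, hs using Set.Finite.induction_on with
  | empty => exact (const False).congr' (by simp)
  | insert _ _ ih =>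
    refine ((h _ (Set.mem_insert _ _)).or
      (ih fun i hi => h i (Set.mem_insert_of_mem _ hi))).congr' fun a => ?_
    simp

lemma finite_and {ι : Type*} {s : Set ι} (hs : s.Finite) {P : ι → (σ → k) → Prop}
    (h : ∀ i ∈ s, IsExistentialPoly (P i)) :
    IsExistentialPoly (fun a => ∀ i ∈ s, P i a) := by
  induction s, hs using Set.Finite.induction_on with
  | empty => exact (const True).congr' (by simp)
  | insert _ _ ih =>
    refine ((h _ (Set.mem_insert _ _)).and
      (ih fun i hi => h i (Set.mem_insert_of_mem _ hi))).congr' fun a => ?_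
    simp

lemma isDiophantineSet {A : Set k} (h : IsExistentialPoly (fun a : Fin 1 → k => a 0 ∈ A)) :
    IsDiophantineSet k A := by
  obtain ⟨τ, _, s, hs, h⟩ := h
  obtain ⟨m, ⟨e⟩⟩ := Finite.exists_equiv_fin τ
  have := hs.to_subtype
  obtain ⟨r, ⟨e'⟩⟩ := Finite.exists_equiv_fin s
  have key : ∀ (a : Fin 1 → k) (b : Fin m → k),
      Fin.append a b ∘ (finSumFinEquiv ∘ Sum.map id e) = Sum.elim a (b ∘ e) := by
    intro a b; ext (x | x) <;> simp
  refine ⟨m, r, fun i => rename (finSumFinEquiv ∘ Sum.map id e) (e'.symm i).1, ?_⟩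
  ext a
  simp only [Set.mem_ofPred_eq, h, eval_rename, key]
  constructor
  · rintro ⟨b, hb⟩
    refine ⟨b ∘ e.symm, fun i => ?_⟩
    have := hb _ (e'.symm i).2
    rwa [Function.comp_assoc, Equiv.symm_comp_self, Function.comp_id]
  · rintro ⟨b, hb⟩
    refine ⟨b ∘ e, fun f hf => ?_⟩
    have := hb (e' ⟨f, hf⟩)
    simpa using this

end IsExistentialPoly

namespace Valuation

variable {K Γ₀ : Type*} [Field K] [LinearOrderedCommGroupWithZero Γ₀] (w : Valuation K Γ₀)

/-- `x` agrees with a square up to a factor that is congruent to `1`. -/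
def NearSquare (x : K) : Prop := ∃ y, w (x - y ^ 2) < w x

/-- `x` has the same value as a square. -/
def SquareValue (x : K) : Prop := ∃ y, y ≠ 0 ∧ w x = w (y ^ 2)

/-- The tame symbol of `a` and `b` is a square in the residue field. -/
def TameSymbolSquare (a b : K) : Prop :=
  (w.SquareValue a ∧ w.SquareValue b) ∨ w.NearSquare a ∨ w.NearSquare b ∨ w.NearSquare (-(a * b))

variable {w}

lemma NearSquare.ne_zero {x : K} (h : w.NearSquare x) : x ≠ 0 := by
  rintro rfl
  obtain ⟨y, hy⟩ := h
  simp at hy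

lemma NearSquare.squareValue {x : K} (h : w.NearSquare x) : w.SquareValue x := by
  have h0 := h.ne_zero
  obtain ⟨y, hy⟩ := h
  have e : w (y ^ 2) = w x := by
    have := w.map_sub_eq_of_lt_left hy
    rwa [sub_sub_cancel] at this
  refine ⟨y, ?_, e.symm⟩
  rintro rfl
  rw [zero_pow two_ne_zero, map_zero] at e
  exact (w.ne_zero_iff.mpr h0) e.symm

lemma nearSquare_sq {y : K} (hy : y ≠ 0) : w.NearSquare (y ^ 2) :=
  ⟨y, by
    rw [sub_self, map_zero]
    exact zero_lt_iff.mpr (w.ne_zero_iff.mpr (pow_ne_zero 2 hy))⟩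

lemma NearSquare.mul {x y : K} (hx : w.NearSquare x) (hy : w.NearSquare y) :
    w.NearSquare (x * y) := by
  have hx0 := zero_lt_iff.mpr (w.ne_zero_iff.mpr hx.ne_zero)
  have hy0 := zero_lt_iff.mpr (w.ne_zero_iff.mpr hy.ne_zero)
  obtain ⟨s, hs⟩ := hx
  obtain ⟨t, ht⟩ := hy
  have e : w (t ^ 2) = w y := by
    have := w.map_sub_eq_of_lt_left ht
    rwa [sub_sub_cancel] at this
  refine ⟨s * t, ?_⟩
  rw [show x * y - (s * t) ^ 2 = x * (y - t ^ 2) + (x - s ^ 2) * t ^ 2 by ring]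
  refine w.map_add_lt ?_ ?_
  · rw [map_mul, map_mul]
    exact (mul_lt_mul_iff_right₀ hx0).mpr ht
  · rw [map_mul, map_mul, e]
    exact (mul_lt_mul_iff_left₀ hy0).mpr hs

lemma SquareValue.ne_zero {x : K} (h : w.SquareValue x) : x ≠ 0 := by
  obtain ⟨y, hy, h⟩ := h
  rintro rfl
  rw [map_zero] at h
  exact w.ne_zero_iff.mpr (pow_ne_zero 2 hy) h.symm

lemma squareValue_sq {y : K} (hy : y ≠ 0) : w.SquareValue (y ^ 2) := ⟨y, hy, rfl⟩

lemma SquareValue.mul {x y : K} (hx : w.SquareValue x) (hy : w.SquareValue y) :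
    w.SquareValue (x * y) := by
  obtain ⟨s, hs, e⟩ := hx
  obtain ⟨t, ht, e'⟩ := hy
  exact ⟨s * t, mul_ne_zero hs ht, by rw [mul_pow, map_mul, map_mul, e, e']⟩

lemma squareValue_of_mul_left {x y : K} (hx : w.SquareValue x) (h : w.SquareValue (x * y)) :
    w.SquareValue y := by
  obtain ⟨s, hs, e⟩ := hx
  obtain ⟨t, ht, e'⟩ := h
  have hs' := w.ne_zero_iff.mpr (pow_ne_zero 2 hs)
  refine ⟨t / s, div_ne_zero ht hs, ?_⟩
  rw [div_pow, map_div₀, ← e', map_mul, e, mul_div_cancel_left₀ _ hs']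

lemma NearSquare.of_mul_sq {x y : K} (hy : y ≠ 0) (h : w.NearSquare (x * y ^ 2)) :
    w.NearSquare x := by
  have := h.mul (nearSquare_sq (w := w) (inv_ne_zero hy))
  rwa [mul_assoc, ← mul_pow, mul_inv_cancel₀ hy, one_pow, mul_one] at this

lemma SquareValue.neg {x : K} (h : w.SquareValue x) : w.SquareValue (-x) := by
  obtain ⟨y, hy, e⟩ := h
  exact ⟨y, hy, by rw [map_neg, e]⟩

lemma TameSymbolSquare.symm {a b : K} (h : w.TameSymbolSquare a b) : w.TameSymbolSquare b a := by
  rcases h with ⟨h, h'⟩ | h | h | h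
  · exact Or.inl ⟨h', h⟩
  · exact Or.inr (Or.inr (Or.inl h))
  · exact Or.inr (Or.inl h)
  · exact Or.inr (Or.inr (Or.inr (by rwa [mul_comm])))

lemma TameSymbolSquare.mul_sq {a b c : K} (h : w.TameSymbolSquare a b) (hc : c ≠ 0) :
    w.TameSymbolSquare a (b * c ^ 2) := by
  have hc1 := nearSquare_sq (w := w) hc
  rcases h with ⟨h, h'⟩ | h | h | h
  · exact Or.inl ⟨h, h'.mul hc1.squareValue⟩
  · exact Or.inr (Or.inl h)
  · exact Or.inr (Or.inr (Or.inl (h.mul hc1)))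
  · refine Or.inr (Or.inr (Or.inr ?_))
    convert h.mul hc1 using 1; ring

/-- If `a` has square value at `w` but `b` has not, then the tame condition says that `a` itself
is close to a square. -/
lemma TameSymbolSquare.nearSquare {a b : K} (h : w.TameSymbolSquare a b)
    (ha : w.SquareValue a) (hb : ¬ w.SquareValue b) : w.NearSquare a := by
  rcases h with ⟨_, h'⟩ | h | h | h
  · exact absurd h' hb
  · exact h
  · exact absurd h.squareValue hb
  · refine absurd (squareValue_of_mul_left ha ?_) hb
    simpa using h.squareValue.neg

/-- The Steinberg relation for the tame symbol. -/
lemma TameSymbolSquare.mul_norm {a b s r : K} (h : w.TameSymbolSquare a b)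
    (ha : a ≠ 0) (hz : s ^ 2 - a * r ^ 2 ≠ 0) :
    w.TameSymbolSquare a ((s ^ 2 - a * r ^ 2) * b) := by
  set z := s ^ 2 - a * r ^ 2 with hzdef
  by_cases hsa : w.NearSquare a
  · exact Or.inr (Or.inl hsa)
  have dom1 : w (a * r ^ 2) < w (s ^ 2) → w.NearSquare z := by
    intro hlt
    have e : w z = w (s ^ 2) := w.map_sub_eq_of_lt_left hlt
    refine ⟨s, ?_⟩
    rw [e, hzdef, sub_sub_cancel_left, map_neg]
    exact hlt
  have dom2 : w (s ^ 2) < w (a * r ^ 2) → w.NearSquare (-(a * z)) := by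
    intro hlt
    have e : w z = w (a * r ^ 2) := w.map_sub_eq_of_lt_right hlt
    refine ⟨a * r, ?_⟩
    rw [show -(a * z) - (a * r) ^ 2 = -(a * s ^ 2) by rw [hzdef]; ring, map_neg, map_neg,
      map_mul, map_mul, e]
    exact (mul_lt_mul_iff_right₀ (zero_lt_iff.mpr (w.ne_zero_iff.mpr ha))).mpr hlt
  by_cases hea : w.SquareValue a
  · have heb : w.SquareValue b := by
      by_contra hb'
      exact hsa (h.nearSquare hea hb')
    refine Or.inl ⟨hea, SquareValue.mul ?_ heb⟩
    rcases lt_trichotomy (w (a * r ^ 2)) (w (s ^ 2)) with hlt | heq | hlt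
    · exact (dom1 hlt).squareValue
    · have hs0 : s ≠ 0 := by
        rintro rfl
        have : a * r ^ 2 = 0 := by
          rw [← w.zero_iff, heq]; simp
        exact hz (by rw [hzdef, this]; simp)
      have hr0 : r ≠ 0 := by
        rintro rfl
        have : s ^ 2 = 0 := by
          rw [← w.zero_iff, ← heq]; simp
        exact hz (by rw [hzdef, this]; simp)
      have hle : w z ≤ w (s ^ 2) := w.map_sub_le le_rfl heq.le
      rcases hle.lt_or_eq with hlt | heq'
      · refine absurd (NearSquare.of_mul_sq hr0 ⟨s, ?_⟩) hsa
        rw [heq, ← neg_sub, map_neg]; exact hlt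
      · exact ⟨s, hs0, heq'⟩
    · refine squareValue_of_mul_left hea ?_
      simpa using (dom2 hlt).squareValue.neg
  · have hne : w (a * r ^ 2) ≠ w (s ^ 2) := by
      intro heq
      have hr0 : r ≠ 0 := by
        rintro rfl
        have : s ^ 2 = 0 := by
          rw [← w.zero_iff, ← heq]; simp
        exact hz (by rw [hzdef, this]; simp)
      have hs0 : s ≠ 0 := by
        rintro rfl
        have : a * r ^ 2 = 0 := by
          rw [← w.zero_iff, heq]; simp
        exact hz (by rw [hzdef, this]; simp)
      refine hea (squareValue_of_mul_left (squareValue_sq hr0) ?_)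
      exact ⟨s, hs0, by rw [mul_comm, heq]⟩
    have hb' : w.NearSquare b ∨ w.NearSquare (-(a * b)) := by
      rcases h with ⟨h, _⟩ | h | h | h
      · exact absurd h hea
      · exact absurd h hsa
      · exact Or.inl h
      · exact Or.inr h
    rcases hne.lt_or_gt with hlt | hlt
    · rcases hb' with hb' | hb'
      · exact Or.inr (Or.inr (Or.inl ((dom1 hlt).mul hb')))
      · refine Or.inr (Or.inr (Or.inr ?_))
        convert (dom1 hlt).mul hb' using 1; ring
    · rcases hb' with hb' | hb'
      · refine Or.inr (Or.inr (Or.inr ?_))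
        convert (dom2 hlt).mul hb' using 1; ring
      · refine Or.inr (Or.inr (Or.inl (NearSquare.of_mul_sq ha ?_)))
        convert (dom2 hlt).mul hb' using 1; ring

end Valuation

/-- The values represented over `K` by the ternary form `⟨a, b, -ab⟩`. -/
def ternaryValues (K : Type*) [Field K] (a b : K) : Set K :=
  {c | ∃ x y z : K, c = a * x ^ 2 + b * y ^ 2 - a * b * z ^ 2}

section ternary

variable {K : Type*} [Field K]

lemma ternaryValues_comm (a b : K) : ternaryValues K a b = ternaryValues K b a := by
  ext c
  constructor <;> rintro ⟨x, y, z, rfl⟩ <;> exact ⟨y, x, z, by ring⟩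

lemma ternaryValues_mul_sq (a b : K) {e : K} (he : e ≠ 0) :
    ternaryValues K a (b * e ^ 2) = ternaryValues K a b := by
  ext c
  constructor
  · rintro ⟨x, y, z, rfl⟩
    exact ⟨x, e * y, e * z, by ring⟩
  · rintro ⟨x, y, z, rfl⟩
    exact ⟨x, y / e, z / e, by field_simp⟩

lemma ternaryValues_subset_of_norm {a b s r : K} (hz : s ^ 2 - a * r ^ 2 ≠ 0) :
    ternaryValues K a b ⊆ ternaryValues K a ((s ^ 2 - a * r ^ 2) * b) := by
  rintro c ⟨x, y, z, rfl⟩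
  refine ⟨x, (s * y - a * r * z) / (s ^ 2 - a * r ^ 2),
    (s * z - r * y) / (s ^ 2 - a * r ^ 2), ?_⟩
  field_simp
  ring

lemma ternaryValues_mul_norm {a b s r : K} (hz : s ^ 2 - a * r ^ 2 ≠ 0) :
    ternaryValues K a ((s ^ 2 - a * r ^ 2) * b) = ternaryValues K a b := by
  refine Set.Subset.antisymm ?_ (ternaryValues_subset_of_norm hz)
  refine (ternaryValues_subset_of_norm hz).trans ?_
  rw [show (s ^ 2 - a * r ^ 2) * ((s ^ 2 - a * r ^ 2) * b) = b * (s ^ 2 - a * r ^ 2) ^ 2 by ring,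
    ternaryValues_mul_sq _ _ hz]

lemma left_mem_ternaryValues (a b : K) : a ∈ ternaryValues K a b := ⟨1, 0, 0, by ring⟩

lemma ternaryValues_one_left [CharZero K] {b : K} (hb : b ≠ 0) :
    ternaryValues K 1 b = ternaryValues K 1 1 := by
  have e : ((b + 1) / 2) ^ 2 - 1 * ((b - 1) / 2) ^ 2 = b := by ring
  have := ternaryValues_mul_norm (a := 1) (b := (1 : K)) (s := (b + 1) / 2) (r := (b - 1) / 2)
    (by rwa [e])
  rwa [e, mul_one] at this

end ternary

section ideals

variable {R : Type*} [CommRing R] [IsDedekindDomain R]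

/-- A square root modulo each prime factor of a squarefree ideal lifts to a square root modulo the
ideal. -/
lemma Ideal.exists_sq_sub_mem_of_squarefree {I : Ideal R} (hI : Squarefree I) (a : R)
    (h : ∀ w : HeightOneSpectrum R, I ≤ w.asIdeal → ∃ α, α ^ 2 - a ∈ w.asIdeal) :
    ∃ α, α ^ 2 - a ∈ I := by
  induction I using UniqueFactorizationMonoid.induction_on_prime with
  | h₁ => exact absurd hI not_squarefree_zero
  | h₂ x hx => exact ⟨0, by rw [Ideal.isUnit_iff.mp hx]; trivial⟩
  | h₃ J p hJ hp ih =>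
    have hpp : p.IsPrime := Ideal.isPrime_of_prime hp
    have hpm : p.IsMaximal := hpp.isMaximal hp.ne_zero
    obtain ⟨α, hα⟩ := h ⟨p, hpp, hp.ne_zero⟩ Ideal.mul_le_left
    obtain ⟨β, hβ⟩ := ih (hI.squarefree_of_dvd (Dvd.intro_left p rfl))
      fun w hw => h w (Ideal.mul_le_right.trans hw)
    have hcop : p ⊔ J = ⊤ := by
      refine hpm.out.2 _ (lt_of_le_of_ne le_sup_left fun e => ?_)
      have : J ≤ p := by rw [e]; exact le_sup_right
      have hdvd : p * p ∣ p * J := mul_dvd_mul_left p (Ideal.dvd_iff_le.mpr this)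
      exact hp.not_isUnit (hI p hdvd)
    obtain ⟨i, hi, j, hj, hij⟩ := Submodule.mem_sup.mp ((Ideal.eq_top_iff_one _).mp hcop)
    refine ⟨α * j + β * i, ?_⟩
    rw [Ideal.mul_eq_inf_of_isCoprime (Ideal.isCoprime_iff_sup_eq.mpr hcop)]
    obtain rfl : j = 1 - i := by rw [← hij]; ring
    refine ⟨?_, ?_⟩
    · have : (α * (1 - i) + β * i) ^ 2 - a =
        (α ^ 2 - a) + i * ((β - α) * (2 * α + (β - α) * i)) := by ring
      rw [this]
      exact p.add_mem hα (p.mul_mem_right _ hi)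
    · have : (α * (1 - i) + β * i) ^ 2 - a =
        (β ^ 2 - a) + (1 - i) * ((α - β) * (2 * β + (α - β) * (1 - i))) := by ring
      rw [this]
      exact J.add_mem hβ (J.mul_mem_right _ hj)

end ideals

namespace NumberField

variable {K : Type*} [Field K] [NumberField K]

variable (K) in
/-- Pairs of integers in a box satisfying a congruence. -/
lemma exists_small_congruent : ∃ C : ℝ, 0 < C ∧ ∀ (I : Ideal (𝓞 K)) (α : 𝓞 K) (X Y : ℝ),
    I ≠ ⊥ → 0 < X → 0 < Y →
    (Ideal.absNorm I : ℝ) ≤ X ^ Module.finrank ℚ K * Y ^ Module.finrank ℚ K →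
    ∃ s r : 𝓞 K, (s ≠ 0 ∨ r ≠ 0) ∧ s - α * r ∈ I ∧
      (∀ w : InfinitePlace K, w (s : K) ≤ C * X) ∧ ∀ w : InfinitePlace K, w (r : K) ≤ C * Y := by
  classical
  let ι := Module.Free.ChooseBasisIndex ℤ (𝓞 K)
  let ω := RingOfIntegers.basis K
  have hcard : Fintype.card ι = Module.finrank ℚ K := by
    rw [← RingOfIntegers.rank, Module.finrank_eq_card_chooseBasisIndex]
  have hd : 0 < Module.finrank ℚ K := Module.finrank_pos
  let C₀ : ℝ := ∑ i : ι, ∑ w : InfinitePlace K, w (ω i : K)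
  have hC₀ : 0 ≤ C₀ := Finset.sum_nonneg fun i _ => Finset.sum_nonneg fun w _ => apply_nonneg _ _
  have bound : ∀ (Z : ℝ), 0 < Z → ∀ x y : ι → Fin (⌊Z⌋₊ + 1), ∀ w : InfinitePlace K,
      w ((∑ i, ((x i : ℤ) - (y i : ℤ)) • ω i : 𝓞 K) : K) ≤ (C₀ + 1) * Z := by
    intro Z hZ x y w
    have h1 : w ((∑ i, ((x i : ℤ) - (y i : ℤ)) • ω i : 𝓞 K) : K) ≤ ∑ i, Z * w (ω i : K) := by
      rw [RingOfIntegers.coe_eq_algebraMap, map_sum]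
      refine (w.1.sum_le _ _).trans (Finset.sum_le_sum fun i _ => ?_)
      change w _ ≤ _
      have h2 : (((x i : ℤ) - (y i : ℤ)) • ω i : 𝓞 K) = (((x i : ℤ) - (y i : ℤ) : ℤ) : 𝓞 K) * ω i :=
        zsmul_eq_mul _ _
      rw [h2, map_mul, map_mul, map_intCast]
      refine mul_le_mul_of_nonneg_right ?_ (apply_nonneg _ _)
      rw [← w.norm_embedding_eq, map_intCast, Complex.norm_intCast]
      have h3 : ((x i : ℕ) : ℝ) ≤ Z :=
        (Nat.cast_le.mpr (Nat.lt_succ_iff.mp (x i).2)).trans (Nat.floor_le hZ.le)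
      have h4 : ((y i : ℕ) : ℝ) ≤ Z :=
        (Nat.cast_le.mpr (Nat.lt_succ_iff.mp (y i).2)).trans (Nat.floor_le hZ.le)
      push_cast
      rw [abs_le]
      constructor <;> linarith [(Nat.cast_nonneg (x i : ℕ) : (0 : ℝ) ≤ _),
        (Nat.cast_nonneg (y i : ℕ) : (0 : ℝ) ≤ _)]
    refine h1.trans ?_
    rw [← Finset.mul_sum, mul_comm]
    refine mul_le_mul_of_nonneg_right ?_ hZ.le
    refine le_trans ?_ (le_add_of_nonneg_right zero_le_one)
    exact Finset.sum_le_sum fun i _ =>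
      Finset.single_le_sum (f := fun w : InfinitePlace K => w (ω i : K))
        (fun w _ => apply_nonneg _ _) (Finset.mem_univ w)
  refine ⟨C₀ + 1, by positivity, fun I α X Y hI hX hY hXY => ?_⟩
  have : Finite (𝓞 K ⧸ I) := Ideal.finiteQuotientOfFreeOfNeBot I hI
  have : Fintype (𝓞 K ⧸ I) := Fintype.ofFinite _
  let φ : (ι → Fin (⌊X⌋₊ + 1)) × (ι → Fin (⌊Y⌋₊ + 1)) → 𝓞 K ⧸ I := fun p =>
    Ideal.Quotient.mk I ((∑ i, (p.1 i : ℤ) • ω i) - α * ∑ i, (p.2 i : ℤ) • ω i)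
  have hlt : Fintype.card (𝓞 K ⧸ I) <
      Fintype.card ((ι → Fin (⌊X⌋₊ + 1)) × (ι → Fin (⌊Y⌋₊ + 1))) := by
    have h1 : (Fintype.card (𝓞 K ⧸ I) : ℝ) = Ideal.absNorm I := by
      rw [Ideal.absNorm_apply, Submodule.cardQuot_apply, Nat.card_eq_fintype_card]
    have h2 : (Fintype.card ((ι → Fin (⌊X⌋₊ + 1)) × (ι → Fin (⌊Y⌋₊ + 1))) : ℝ) =
        (⌊X⌋₊ + 1 : ℝ) ^ Module.finrank ℚ K * (⌊Y⌋₊ + 1 : ℝ) ^ Module.finrank ℚ K := by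
      simp [hcard]
    rw [← Nat.cast_lt (α := ℝ), h1, h2]
    refine hXY.trans_lt ?_
    have := pow_lt_pow_left₀ (Nat.lt_floor_add_one X) hX.le hd.ne'
    have := pow_lt_pow_left₀ (Nat.lt_floor_add_one Y) hY.le hd.ne'
    gcongr
  obtain ⟨p, q, hne, hpq⟩ := Fintype.exists_ne_map_eq_of_card_lt φ hlt
  have hinj : ∀ {n : ℕ} (x y : ι → Fin n),
      ∑ i, ((x i : ℤ) - (y i : ℤ)) • ω i = 0 → x = y := by
    intro n x y h
    ext i
    have := Fintype.linearIndependent_iff.mp ω.linearIndependent _ h i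
    exact_mod_cast sub_eq_zero.mp this
  refine ⟨∑ i, ((p.1 i : ℤ) - (q.1 i : ℤ)) • ω i, ∑ i, ((p.2 i : ℤ) - (q.2 i : ℤ)) • ω i,
    ?_, ?_, fun w => bound X hX _ _ w, fun w => bound Y hY _ _ w⟩
  · by_contra! h
    exact hne (Prod.ext (hinj _ _ h.1) (hinj _ _ h.2))
  · rw [Ideal.Quotient.eq] at hpq
    convert hpq using 1
    simp only [sub_smul, Finset.sum_sub_distrib]
    ring

end NumberField

namespace NumberField

variable {K : Type*} [Field K] [NumberField K]

/-- The square class of `b` contains an integer that generates `𝔟` times the square of an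
ideal. -/
def SquareClassIdeal (b : K) (I : Ideal (𝓞 K)) : Prop :=
  ∃ (e : K) (B : 𝓞 K) (J : Ideal (𝓞 K)), e ≠ 0 ∧ algebraMap (𝓞 K) K B = b * e ^ 2 ∧
    Ideal.span {B} = I * J ^ 2

/-- The least norm of an ideal in the square class of `b`. -/
noncomputable def squareClassNorm (b : K) : ℕ :=
  sInf {n | ∃ I, SquareClassIdeal b I ∧ Ideal.absNorm I = n}

lemma exists_squareClassIdeal {b : K} : ∃ I, SquareClassIdeal b I := by
  obtain ⟨n, d, hd, h⟩ := IsFractionRing.div_surjective (A := 𝓞 K) b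
  have hd0 : algebraMap (𝓞 K) K d ≠ 0 := by
    rw [Ne, FaithfulSMul.algebraMap_eq_zero_iff]
    exact nonZeroDivisors.ne_zero hd
  refine ⟨Ideal.span {n * d}, algebraMap (𝓞 K) K d, n * d, 1, hd0, ?_, by rw [one_pow, mul_one]⟩
  rw [← h, map_mul]
  field_simp

lemma exists_squareClassIdeal_eq (b : K) :
    ∃ I, SquareClassIdeal b I ∧ Ideal.absNorm I = squareClassNorm b := by
  obtain ⟨I, hI⟩ := exists_squareClassIdeal (b := b)
  exact Nat.sInf_mem (s := {n | ∃ I, SquareClassIdeal b I ∧ Ideal.absNorm I = n})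
    ⟨_, I, hI, rfl⟩

lemma SquareClassIdeal.le {b : K} {I : Ideal (𝓞 K)} (h : SquareClassIdeal b I) :
    squareClassNorm b ≤ Ideal.absNorm I :=
  Nat.sInf_le ⟨I, h, rfl⟩

omit [NumberField K] in
lemma SquareClassIdeal.ne_bot {b : K} (hb : b ≠ 0) {I : Ideal (𝓞 K)}
    (h : SquareClassIdeal b I) : I ≠ ⊥ := by
  obtain ⟨e, B, J, he, hB, h⟩ := h
  rintro rfl
  rw [← Ideal.zero_eq_bot, zero_mul, Ideal.zero_eq_bot, Ideal.span_singleton_eq_bot] at h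
  rw [h, map_zero] at hB
  exact mul_ne_zero hb (pow_ne_zero 2 he) hB.symm

lemma SquareClassIdeal.squarefree {b : K} (hb : b ≠ 0) {I : Ideal (𝓞 K)}
    (h : SquareClassIdeal b I) (hI : Ideal.absNorm I = squareClassNorm b) : Squarefree I := by
  have hI0 := h.ne_bot hb
  rintro P ⟨Q, rfl⟩
  obtain ⟨e, B, J, he, hB, h⟩ := h
  have h' : SquareClassIdeal b Q := ⟨e, B, P * J, he, hB, by rw [h]; ring⟩
  have h1 := h'.le
  rw [← hI, map_mul, map_mul] at h1
  have hQ : 0 < Ideal.absNorm Q :=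
    Nat.pos_of_ne_zero (Ideal.absNorm_eq_zero_iff.not.mpr (h'.ne_bot hb))
  have hP : 0 < Ideal.absNorm P := Nat.pos_of_ne_zero (Ideal.absNorm_eq_zero_iff.not.mpr (by
    rintro rfl; simp at hI0))
  have h2 : Ideal.absNorm P * Ideal.absNorm P ≤ 1 := Nat.le_of_mul_le_mul_right (by linarith) hQ
  have h3 : Ideal.absNorm P = 1 := by nlinarith
  exact Ideal.isUnit_iff.mpr (Ideal.absNorm_eq_one_iff.mp h3)

lemma squareClassNorm_pos {b : K} (hb : b ≠ 0) : 0 < squareClassNorm b := by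
  obtain ⟨I, h, hI⟩ := exists_squareClassIdeal_eq b
  rw [← hI]
  exact Nat.pos_of_ne_zero (Ideal.absNorm_eq_zero_iff.not.mpr (h.ne_bot hb))

open Module in
variable (K) in
/-- A fractional ideal contains an element whose absolute values are prescribed up to a constant. -/
lemma exists_ne_zero_mem_fractionalIdeal_le : ∃ C : ℝ, 0 < C ∧
    ∀ (I : (FractionalIdeal (nonZeroDivisors (𝓞 K)) K)ˣ) (g : InfinitePlace K → ℝ),
    (∀ w, 0 < g w) →
    (FractionalIdeal.absNorm (I : FractionalIdeal (nonZeroDivisors (𝓞 K)) K) : ℝ) ≤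
      ∏ w, g w ^ w.mult →
    ∃ a ∈ (I : FractionalIdeal (nonZeroDivisors (𝓞 K)) K), a ≠ 0 ∧
      ∀ w : InfinitePlace K, w a ≤ C * g w := by
  classical
  obtain ⟨M, hM⟩ : ∃ M : NNReal, (M : ENNReal) = mixedEmbedding.minkowskiBound K 1 :=
    ⟨_, ENNReal.coe_toNNReal (mixedEmbedding.minkowskiBound_lt_top K 1).ne⟩
  have hd : finrank ℚ K ≠ 0 := finrank_pos.ne'
  refine ⟨M + 1, by positivity, fun I g hg hI => ?_⟩
  have hI0 : 0 < (FractionalIdeal.absNorm (I : FractionalIdeal (nonZeroDivisors (𝓞 K)) K) : ℝ) := by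
    have h0 := FractionalIdeal.absNorm_nonneg
      (I : FractionalIdeal (nonZeroDivisors (𝓞 K)) K)
    have h1 : FractionalIdeal.absNorm
      (I : FractionalIdeal (nonZeroDivisors (𝓞 K)) K) ≠ 0 := by
      rw [Ne, FractionalIdeal.absNorm_eq_zero_iff]
      exact I.ne_zero
    exact_mod_cast lt_of_le_of_ne h0 h1.symm
  have hb : mixedEmbedding.minkowskiBound K I =
      ENNReal.ofReal (FractionalIdeal.absNorm I.1) * M := by
    rw [hM, mixedEmbedding.minkowskiBound, mixedEmbedding.minkowskiBound,
      mixedEmbedding.volume_fundamentalDomain_fractionalIdealLatticeBasis,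
      mixedEmbedding.volume_fundamentalDomain_fractionalIdealLatticeBasis]
    simp [mul_assoc]
  let f : InfinitePlace K → NNReal := fun w => (M + 1) * (g w).toNNReal
  have hf : ∏ w, f w ^ w.mult = (M + 1) ^ finrank ℚ K * ∏ w, (g w).toNNReal ^ w.mult := by
    simp only [f, mul_pow, Finset.prod_mul_distrib]
    rw [Finset.prod_pow_eq_pow_sum, InfinitePlace.sum_mult_eq]
  have hlt : mixedEmbedding.minkowskiBound K I < MeasureTheory.volume (mixedEmbedding.convexBodyLT K f) := by
    rw [hb, mixedEmbedding.convexBodyLT_volume]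
    have h1 : ENNReal.ofReal (FractionalIdeal.absNorm I.1) * M <
        ((∏ w, f w ^ w.mult : NNReal) : ENNReal) := by
      rw [hf, ENNReal.ofReal, ← ENNReal.coe_mul, ENNReal.coe_lt_coe, mul_comm]
      have h2 : (FractionalIdeal.absNorm I.1 : ℝ).toNNReal ≤
          ∏ w, (g w).toNNReal ^ w.mult := by
        rw [← NNReal.coe_le_coe, Real.coe_toNNReal _ hI0.le]
        rw [NNReal.coe_prod]
        refine hI.trans_eq (Finset.prod_congr rfl fun w _ => ?_)
        rw [NNReal.coe_pow, Real.coe_toNNReal _ (hg w).le]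
      have h3 : (M : NNReal) < (M + 1) ^ finrank ℚ K :=
        (lt_add_one M).trans_le (le_self_pow₀ (by simp) hd)
      have h4 : 0 < (FractionalIdeal.absNorm I.1 : ℝ).toNNReal := Real.toNNReal_pos.mpr hI0
      calc _ < (M + 1) ^ finrank ℚ K * (FractionalIdeal.absNorm I.1 : ℝ).toNNReal :=
            mul_lt_mul_of_pos_right h3 h4
        _ ≤ _ := by gcongr
    refine h1.trans_le ?_
    rw [ENNReal.ofNNReal_finsetProd]
    simp only [ENNReal.coe_pow]
    refine le_mul_of_one_le_left' ?_
    exact_mod_cast mixedEmbedding.one_le_convexBodyLTFactor K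
  obtain ⟨a, ha, ha0, h⟩ := mixedEmbedding.exists_ne_zero_mem_ideal_lt K I hlt
  refine ⟨a, ha, ha0, fun w => (h w).le.trans_eq ?_⟩
  simp [f, Real.coe_toNNReal _ (hg w).le]

end NumberField

namespace NumberField

variable {K : Type*} [Field K] [NumberField K]

lemma prod_infinitePlace_eq_absNorm (x : 𝓞 K) :
    ∏ w : InfinitePlace K, w (algebraMap (𝓞 K) K x) ^ w.mult = Ideal.absNorm (Ideal.span {x}) := by
  rw [InfinitePlace.prod_eq_abs_norm, Ideal.absNorm_span_singleton,
    ← Algebra.coe_norm_int, ← Int.cast_natCast, Int.natCast_natAbs]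
  simp

variable (K) in
/-- Every square class contains an integer with small conjugates. -/
lemma exists_balanced : ∃ C : ℝ, 1 ≤ C ∧ ∀ b : K, b ≠ 0 →
    ∃ (e : K) (B : 𝓞 K) (I J : Ideal (𝓞 K)), e ≠ 0 ∧ algebraMap (𝓞 K) K B = b * e ^ 2 ∧
      Ideal.span {B} = I * J ^ 2 ∧ SquareClassIdeal b I ∧ Ideal.absNorm I = squareClassNorm b ∧
      ∀ w : InfinitePlace K, w (algebraMap (𝓞 K) K B) ≤
        C * (squareClassNorm b : ℝ) ^ (1 / (Module.finrank ℚ K : ℝ)) := by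
  obtain ⟨C, hC, hmink⟩ := exists_ne_zero_mem_fractionalIdeal_le K
  have hd : (Module.finrank ℚ K : ℝ) ≠ 0 := Nat.cast_ne_zero.mpr Module.finrank_pos.ne'
  refine ⟨(C + 1) ^ 2, one_le_pow₀ (by linarith), fun b hb => ?_⟩
  obtain ⟨I, hI, hIn⟩ := exists_squareClassIdeal_eq b
  have hI' := hI
  obtain ⟨e, B, J, he, hB, hBI⟩ := hI'
  have hm : 0 < (squareClassNorm b : ℝ) := Nat.cast_pos.mpr (squareClassNorm_pos hb)
  set m : ℝ := ((squareClassNorm b : ℕ) : ℝ) with hmdef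
  have hbe : b * e ^ 2 ≠ 0 := mul_ne_zero hb (pow_ne_zero 2 he)
  have hB0 : B ≠ 0 := by
    rintro rfl
    rw [map_zero] at hB
    exact hbe hB.symm
  have hJ0 : J ≠ 0 := by
    rintro rfl
    rw [zero_pow two_ne_zero, mul_zero, Ideal.zero_eq_bot, Ideal.span_singleton_eq_bot] at hBI
    exact hB0 hBI
  have hJf : (J : FractionalIdeal (nonZeroDivisors (𝓞 K)) K) ≠ 0 :=
    FractionalIdeal.coeIdeal_ne_zero.mpr hJ0
  let U : (FractionalIdeal (nonZeroDivisors (𝓞 K)) K)ˣ := (Units.mk0 _ hJf)⁻¹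
  have hnormJ : (0 : ℝ) < Ideal.absNorm J :=
    Nat.cast_pos.mpr (Nat.pos_of_ne_zero (Ideal.absNorm_eq_zero_iff.not.mpr hJ0))
  let g : InfinitePlace K → ℝ := fun w => Real.sqrt (m ^ (1 / (Module.finrank ℚ K : ℝ)) /
    w (b * e ^ 2))
  have hwpos : ∀ w : InfinitePlace K, 0 < w (b * e ^ 2) := fun w =>
    InfinitePlace.pos_iff.mpr hbe
  have hg : ∀ w, 0 < g w := fun w => Real.sqrt_pos.mpr (div_pos (Real.rpow_pos_of_pos hm _) (hwpos w))
  have hgsq : ∀ w, g w ^ 2 = m ^ (1 / (Module.finrank ℚ K : ℝ)) / w (b * e ^ 2) := fun w =>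
    Real.sq_sqrt (div_pos (Real.rpow_pos_of_pos hm _) (hwpos w)).le
  have hnormB : ∏ w : InfinitePlace K, w (b * e ^ 2) ^ w.mult = m * (Ideal.absNorm J : ℝ) ^ 2 := by
    rw [← hB, prod_infinitePlace_eq_absNorm, hBI, map_mul, map_pow, hIn]
    push_cast
    rfl
  have hprod : (∏ w, g w ^ w.mult) ^ 2 = ((Ideal.absNorm J : ℝ)⁻¹) ^ 2 := by
    rw [← Finset.prod_pow]
    simp_rw [← pow_mul, mul_comm _ 2, pow_mul, hgsq, div_pow]
    rw [Finset.prod_div_distrib, hnormB, Finset.prod_pow_eq_pow_sum, InfinitePlace.sum_mult_eq,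
      ← Real.rpow_natCast, ← Real.rpow_mul hm.le, one_div_mul_cancel hd, Real.rpow_one]
    field_simp
  have hprod' : ∏ w, g w ^ w.mult = (Ideal.absNorm J : ℝ)⁻¹ :=
    (pow_left_inj₀ (Finset.prod_nonneg fun w _ => pow_nonneg (hg w).le _)
      (inv_nonneg.mpr hnormJ.le) two_ne_zero).mp hprod
  obtain ⟨a, haU, ha0, ha⟩ := hmink U g hg (by
    rw [hprod']
    simp only [U, Units.val_inv_eq_inv_val, Units.val_mk0, map_inv₀, FractionalIdeal.coeIdeal_absNorm]
    push_cast
    exact le_rfl)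
  have hle : FractionalIdeal.spanSingleton (nonZeroDivisors (𝓞 K)) a *
      (J : FractionalIdeal (nonZeroDivisors (𝓞 K)) K) ≤ 1 := by
    have h1 : FractionalIdeal.spanSingleton (nonZeroDivisors (𝓞 K)) a ≤ U.1 :=
      FractionalIdeal.spanSingleton_le_iff_mem.mpr haU
    calc _ ≤ U.1 * (J : FractionalIdeal (nonZeroDivisors (𝓞 K)) K) := by gcongr
      _ = 1 := by simp [U, hJf]
  obtain ⟨J', hJ'⟩ := FractionalIdeal.le_one_iff_exists_coeIdeal.mp hle
  have hid : FractionalIdeal.spanSingleton (nonZeroDivisors (𝓞 K)) (b * (e * a) ^ 2) =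
      ((I * J' ^ 2 : Ideal (𝓞 K)) : FractionalIdeal (nonZeroDivisors (𝓞 K)) K) := by
    have h1 : ((I * J' ^ 2 : Ideal (𝓞 K)) : FractionalIdeal (nonZeroDivisors (𝓞 K)) K) =
        FractionalIdeal.spanSingleton (nonZeroDivisors (𝓞 K)) a ^ 2 *
        ((I * J ^ 2 : Ideal (𝓞 K)) : FractionalIdeal (nonZeroDivisors (𝓞 K)) K) := by
      simp only [FractionalIdeal.coeIdeal_mul, FractionalIdeal.coeIdeal_pow, hJ']
      ring
    rw [h1, ← hBI, FractionalIdeal.coeIdeal_span_singleton, hB, FractionalIdeal.spanSingleton_pow,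
      FractionalIdeal.spanSingleton_mul_spanSingleton]
    congr 1; ring
  have hmem : b * (e * a) ^ 2 ∈ ((I * J' ^ 2 : Ideal (𝓞 K)) :
      FractionalIdeal (nonZeroDivisors (𝓞 K)) K) := by
    rw [← hid]; exact FractionalIdeal.mem_spanSingleton_self _ _
  obtain ⟨B', -, hB'⟩ := (FractionalIdeal.mem_coeIdeal _).mp hmem
  refine ⟨e * a, B', I, J', mul_ne_zero he ha0, hB', ?_, hI, hIn, fun w => ?_⟩
  · rw [← hB', ← FractionalIdeal.coeIdeal_span_singleton] at hid
    exact FractionalIdeal.coeIdeal_injective hid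
  · rw [hB', mul_pow, ← mul_assoc, map_mul, map_pow]
    have h1 : w a ^ 2 ≤ ((C + 1) * g w) ^ 2 := by
      refine pow_le_pow_left₀ (apply_nonneg _ _) ((ha w).trans ?_) 2
      exact mul_le_mul_of_nonneg_right (by linarith) (hg w).le
    calc w (b * e ^ 2) * w a ^ 2 ≤ w (b * e ^ 2) * ((C + 1) * g w) ^ 2 := by
          exact mul_le_mul_of_nonneg_left h1 (hwpos w).le
      _ = _ := by
          rw [mul_pow, hgsq]
          have := (hwpos w).ne'
          field_simp

end NumberField

namespace NumberField

variable {K : Type*} [Field K] [NumberField K]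

lemma SquareClassIdeal.not_squareValue {b : K} (hb : b ≠ 0) {I : Ideal (𝓞 K)}
    (h : SquareClassIdeal b I) (hI : Squarefree I) {w : HeightOneSpectrum (𝓞 K)}
    (hw : I ≤ w.asIdeal) : ¬ (w.valuation K).SquareValue b := by
  classical
  have hI0 := h.ne_bot hb
  obtain ⟨e, B, J, he, hB, h⟩ := h
  rintro ⟨y, hy, hby⟩
  have hB0 : B ≠ 0 := by
    rintro rfl
    rw [map_zero] at hB
    exact mul_ne_zero hb (pow_ne_zero 2 he) hB.symm
  have hJ0 : J ≠ 0 := by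
    rintro rfl
    rw [zero_pow two_ne_zero, mul_zero, Ideal.zero_eq_bot, Ideal.span_singleton_eq_bot] at h
    exact hB0 h
  have h1 : w.valuation K (algebraMap (𝓞 K) K B) = w.valuation K (y * e) ^ 2 := by
    rw [hB, map_mul, hby, ← map_mul, ← map_pow, mul_pow]
  rw [HeightOneSpectrum.valuation_of_algebraMap, HeightOneSpectrum.intValuation_if_neg _ hB0] at h1
  obtain ⟨n, hn⟩ : ∃ n : ℤ, w.valuation K (y * e) = WithZero.exp n :=
    ⟨_, (WithZero.exp_log ((Valuation.ne_zero_iff _).mpr (mul_ne_zero hy he))).symm⟩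
  rw [hn, ← WithZero.exp_nsmul, WithZero.exp_inj] at h1
  have hIc : (Associates.mk w.asIdeal).count (Associates.mk I).factors = 1 := by
    have hdvd : w.asIdeal ∣ I := Ideal.dvd_iff_le.mpr hw
    have h2 : (Associates.mk w.asIdeal).count (Associates.mk I).factors ≠ 0 :=
      (Associates.count_ne_zero_iff_dvd hI0 w.irreducible).mpr hdvd
    have h3 : ¬ 2 ≤ (Associates.mk w.asIdeal).count (Associates.mk I).factors := by
      intro h4
      rw [← Associates.prime_pow_dvd_iff_le (Associates.mk_ne_zero.mpr hI0)
        w.associates_irreducible, ← Associates.mk_pow, Associates.mk_le_mk_iff_dvd, pow_two] at h4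
      exact w.prime.not_isUnit (hI _ h4)
    omega
  rw [h, ← Associates.mk_mul_mk, Associates.count_mul (Associates.mk_ne_zero.mpr hI0)
    (Associates.mk_ne_zero.mpr (pow_ne_zero 2 hJ0)) w.associates_irreducible, hIc,
    Associates.mk_pow, Associates.count_pow (Associates.mk_ne_zero.mpr hJ0)
    w.associates_irreducible] at h1
  push_cast at h1
  rw [nsmul_eq_mul] at h1
  push_cast at h1
  omega

lemma exists_sq_sub_mem_of_nearSquare {w : HeightOneSpectrum (𝓞 K)} {A : 𝓞 K}
    (hA : A ∉ w.asIdeal) (h : (w.valuation K).NearSquare (algebraMap (𝓞 K) K A)) :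
    ∃ α : 𝓞 K, α ^ 2 - A ∈ w.asIdeal := by
  have hA1 : w.valuation K (algebraMap (𝓞 K) K A) = 1 := by
    refine le_antisymm (w.valuation_le_one A) (not_lt.mp fun h' => hA ?_)
    exact (w.valuation_lt_one_iff_mem A).mp h'
  obtain ⟨y, hy⟩ := h
  rw [hA1] at hy
  have hy1 : w.valuation K y ≤ 1 := by
    by_contra! h1
    have h2 : 1 < w.valuation K (y ^ 2) := by
      rw [map_pow]; exact one_lt_pow₀ h1 two_ne_zero
    rw [Valuation.map_sub_swap, Valuation.map_sub_eq_of_lt_left _ (by rwa [hA1])] at hy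
    exact (hy.trans h2).false
  obtain ⟨α, hα⟩ := HeightOneSpectrum.exists_valuation_sub_lt_of_integer (K := K) (v := w) hy1 1
  rw [Units.val_one] at hα
  refine ⟨α, (w.valuation_lt_one_iff_mem (K := K) _).mp ?_⟩
  have h1 : algebraMap (𝓞 K) K (α ^ 2 - A) = (algebraMap (𝓞 K) K α - y) *
      (algebraMap (𝓞 K) K α + y) - (algebraMap (𝓞 K) K A - y ^ 2) := by
    rw [map_sub, map_pow]; ring
  change w.valuation K (algebraMap (𝓞 K) K (α ^ 2 - A)) < 1
  rw [h1]
  refine Valuation.map_sub_lt _ ?_ hy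
  rw [map_mul]
  refine mul_lt_one_of_lt_of_le hα ((Valuation.map_add _ _ _).trans (max_le ?_ hy1))
  exact w.valuation_le_one α

variable (K) in
/-- Descent: a pair with trivial tame symbols outside `S` can be replaced by a smaller one. -/
lemma exists_descent (S : Set (HeightOneSpectrum (𝓞 K))) (hS : S.Finite) :
    ∃ C : ℝ, ∀ a b : K, a ≠ 0 → b ≠ 0 →
      (∀ w : HeightOneSpectrum (𝓞 K), w ∉ S → (w.valuation K).TameSymbolSquare a b) →
      IsSquare a ∨ ∃ s r : K, s ^ 2 - a * r ^ 2 ≠ 0 ∧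
        (squareClassNorm ((s ^ 2 - a * r ^ 2) * b) : ℝ) ^ 2 ≤ C * squareClassNorm a := by
  classical
  obtain ⟨C₁, hC₁, hbal⟩ := exists_balanced K
  obtain ⟨C₂, hC₂, hcong⟩ := exists_small_congruent K
  set d := Module.finrank ℚ K with hd
  have hd0 : d ≠ 0 := Module.finrank_pos.ne'
  let P : Ideal (𝓞 K) := ∏ w ∈ hS.toFinset, w.asIdeal
  have hP0 : P ≠ 0 := Finset.prod_ne_zero_iff.mpr fun w _ => w.ne_bot
  refine ⟨(2 * C₂ ^ 2) ^ (2 * d) * C₁ ^ d * (Ideal.absNorm P : ℝ) ^ 2,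
    fun a b ha hb htame => or_iff_not_imp_left.mpr fun hsq => ?_⟩
  obtain ⟨ea, A, -, -, hea, hA, -, -, -, hAw⟩ := hbal a ha
  obtain ⟨I, hI, hIn⟩ := exists_squareClassIdeal_eq b
  have hIsf := hI.squarefree hb hIn
  have hI0 : I ≠ 0 := hI.ne_bot hb
  obtain ⟨I', hI'⟩ : gcd I P ∣ I := gcd_dvd_left I P
  have hI'0 : I' ≠ 0 := by rintro rfl; rw [mul_zero] at hI'; exact hI0 hI'
  have hI'sf : Squarefree I' := hIsf.squarefree_of_dvd ⟨_, hI'.trans (mul_comm _ _)⟩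
  have hmem : ∀ w : HeightOneSpectrum (𝓞 K), I' ≤ w.asIdeal →
      ∃ α, α ^ 2 - A ∈ w.asIdeal := by
    intro w hw
    have hwI' : w.asIdeal ∣ I' := Ideal.dvd_iff_le.mpr hw
    have hwI : w.asIdeal ∣ I := hwI'.trans ⟨_, hI'.trans (mul_comm _ _)⟩
    have hwS : w ∉ S := by
      intro h
      have h1 : w.asIdeal ∣ P := Finset.dvd_prod_of_mem _ (hS.mem_toFinset.mpr h)
      have h2 : w.asIdeal * w.asIdeal ∣ I := by
        rw [hI']; exact mul_dvd_mul (dvd_gcd hwI h1) hwI'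
      exact w.prime.not_isUnit (hIsf _ h2)
    by_cases hAw : A ∈ w.asIdeal
    · exact ⟨0, by rwa [zero_pow two_ne_zero, zero_sub, neg_mem_iff]⟩
    refine exists_sq_sub_mem_of_nearSquare hAw ?_
    have h1 : (w.valuation K).TameSymbolSquare (algebraMap (𝓞 K) K A) b := by
      rw [hA]
      exact ((htame w hwS).symm.mul_sq hea).symm
    refine h1.nearSquare ⟨1, one_ne_zero, ?_⟩
      (hI.not_squareValue hb hIsf (Ideal.dvd_iff_le.mp hwI))
    rw [one_pow, map_one]
    refine le_antisymm (w.valuation_le_one A) (not_lt.mp fun h' => hAw ?_)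
    exact (w.valuation_lt_one_iff_mem A).mp h'
  obtain ⟨α, hα⟩ := Ideal.exists_sq_sub_mem_of_squarefree hI'sf A hmem
  set m : ℝ := ((squareClassNorm a : ℕ) : ℝ) with hm
  have hm0 : 0 < m := Nat.cast_pos.mpr (squareClassNorm_pos ha)
  set N : ℝ := ((Ideal.absNorm I' : ℕ) : ℝ) with hN
  have hN0 : 0 < N := Nat.cast_pos.mpr (Nat.pos_of_ne_zero (Ideal.absNorm_eq_zero_iff.not.mpr hI'0))
  set β : ℝ := Real.sqrt (C₁ * m ^ (1 / (d : ℝ))) with hβ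
  have hβ0 : 0 < β := Real.sqrt_pos.mpr (by positivity)
  have hβ2 : β ^ 2 = C₁ * m ^ (1 / (d : ℝ)) := Real.sq_sqrt (by positivity)
  have hβd : (β ^ d) ^ 2 = C₁ ^ d * m := by
    rw [← pow_mul, mul_comm, pow_mul, hβ2, mul_pow, ← Real.rpow_natCast (m ^ _), ← Real.rpow_mul
      hm0.le, one_div_mul_cancel (Nat.cast_ne_zero.mpr hd0), Real.rpow_one]
  obtain ⟨Y, hY0, hY⟩ : ∃ Y : ℝ, 0 < Y ∧ Y ^ (2 * d) = N / β ^ d := by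
    refine ⟨(N / β ^ d) ^ ((2 * d : ℕ) : ℝ)⁻¹, by positivity, ?_⟩
    exact Real.rpow_inv_natCast_pow (by positivity) (by positivity)
  have hXY : (β * Y) ^ d * Y ^ d = N := by
    rw [mul_pow, mul_assoc, ← pow_add, ← two_mul, hY]
    field_simp
  obtain ⟨s, r, hsr, hmemI', hs, hr⟩ := hcong I' α (β * Y) Y hI'0 (by positivity) hY0 hXY.ge
  have hz : s ^ 2 - A * r ^ 2 ∈ I' := by
    have : s ^ 2 - A * r ^ 2 = (s - α * r) * (s + α * r) + (α ^ 2 - A) * r ^ 2 := by ring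
    rw [this]
    exact I'.add_mem (I'.mul_mem_right _ hmemI') (I'.mul_mem_right _ hα)
  have hz0 : s ^ 2 - A * r ^ 2 ≠ 0 := by
    intro h0
    have h0' := congrArg (algebraMap (𝓞 K) K) h0
    rw [map_sub, map_mul, map_pow, map_pow, map_zero, sub_eq_zero, hA] at h0'
    have hr0 : algebraMap (𝓞 K) K r ≠ 0 := by
      intro hr0
      rw [hr0, zero_pow two_ne_zero, mul_zero] at h0'
      have hs0 := pow_eq_zero_iff two_ne_zero |>.mp h0'
      rw [FaithfulSMul.algebraMap_eq_zero_iff] at hr0 hs0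
      exact hsr.elim (· hs0) (· hr0)
    refine hsq ⟨algebraMap (𝓞 K) K s / (ea * algebraMap (𝓞 K) K r), ?_⟩
    field_simp
    linear_combination -h0'
  obtain ⟨D, hD⟩ : I' ∣ Ideal.span {s ^ 2 - A * r ^ 2} :=
    Ideal.dvd_span_singleton.mpr hz
  have hzn : (Ideal.absNorm (Ideal.span {s ^ 2 - A * r ^ 2}) : ℝ) ≤ (2 * C₂ ^ 2) ^ d * (β ^ d * N) := by
    rw [← prod_infinitePlace_eq_absNorm]
    have h1 : ∀ w : InfinitePlace K, w (algebraMap (𝓞 K) K (s ^ 2 - A * r ^ 2)) ≤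
        2 * C₂ ^ 2 * (β ^ 2 * Y ^ 2) := by
      intro w
      rw [map_sub, map_mul, map_pow, map_pow]
      refine (map_sub_le_add w.1 _ _).trans ?_
      change w _ + w _ ≤ _
      rw [map_mul, map_pow, map_pow]
      have h2 := pow_le_pow_left₀ (apply_nonneg _ _) (hs w) 2
      have h3 := pow_le_pow_left₀ (apply_nonneg _ _) (hr w) 2
      have h4 : w (algebraMap (𝓞 K) K A) ≤ β ^ 2 := hβ2 ▸ hAw w
      have h5 := mul_le_mul h4 h3 (by positivity) (by positivity)
      nlinarith
    calc _ ≤ ∏ w : InfinitePlace K, (2 * C₂ ^ 2 * (β ^ 2 * Y ^ 2)) ^ w.mult :=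
          Finset.prod_le_prod (fun w _ => by positivity)
            fun w _ => pow_le_pow_left₀ (apply_nonneg _ _) (h1 w) _
      _ = (2 * C₂ ^ 2) ^ d * (β ^ d * ((β * Y) ^ d * Y ^ d)) := by
          rw [Finset.prod_pow_eq_pow_sum, InfinitePlace.sum_mult_eq]
          ring
      _ = _ := by rw [hXY]
  have hDn : (Ideal.absNorm D : ℝ) ≤ (2 * C₂ ^ 2) ^ d * β ^ d := by
    rw [hD, map_mul, Nat.cast_mul] at hzn
    refine le_of_mul_le_mul_left ?_ hN0
    linarith
  refine ⟨algebraMap (𝓞 K) K s, ea * algebraMap (𝓞 K) K r, ?_, ?_⟩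
  · intro h0
    refine hz0 ((FaithfulSMul.algebraMap_eq_zero_iff (𝓞 K) K).mp ?_)
    rw [map_sub, map_mul, map_pow, map_pow, hA, ← h0]
    ring
  have hI2 := hI
  obtain ⟨e, B, J, he, hB, hBI⟩ := hI2
  have hclass : SquareClassIdeal ((algebraMap (𝓞 K) K s ^ 2 -
      a * (ea * algebraMap (𝓞 K) K r) ^ 2) * b) (D * gcd I P) := by
    refine ⟨e, (s ^ 2 - A * r ^ 2) * B, I' * J, he, ?_, ?_⟩
    · rw [map_mul, map_sub, map_mul, map_pow, map_pow, hA, hB]; ring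
    · rw [← Ideal.span_singleton_mul_span_singleton, hD, hBI]
      conv_lhs => rw [hI']
      ring
  have h1 : (squareClassNorm ((algebraMap (𝓞 K) K s ^ 2 -
      a * (ea * algebraMap (𝓞 K) K r) ^ 2) * b) : ℝ) ≤
      (2 * C₂ ^ 2) ^ d * β ^ d * Ideal.absNorm P := by
    have h2 : (squareClassNorm ((algebraMap (𝓞 K) K s ^ 2 -
      a * (ea * algebraMap (𝓞 K) K r) ^ 2) * b) : ℝ) ≤
      Ideal.absNorm D * Ideal.absNorm (gcd I P) := by
      have := hclass.le
      rw [map_mul] at this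
      exact_mod_cast this
    refine h2.trans (mul_le_mul hDn ?_ (Nat.cast_nonneg _) (by positivity))
    refine Nat.cast_le.mpr (Nat.le_of_dvd (Nat.pos_of_ne_zero
      (Ideal.absNorm_eq_zero_iff.not.mpr hP0)) ?_)
    exact map_dvd _ (gcd_dvd_right I P)
  calc _ ≤ ((2 * C₂ ^ 2) ^ d * β ^ d * Ideal.absNorm P) ^ 2 :=
        pow_le_pow_left₀ (Nat.cast_nonneg _) h1 2
    _ = (2 * C₂ ^ 2) ^ (2 * d) * (β ^ d) ^ 2 * (Ideal.absNorm P : ℝ) ^ 2 := by ring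
    _ = _ := by rw [hβd]; ring

end NumberField

namespace NumberField

universe u
variable (K : Type u) [Field K] [NumberField K]

/-- Up to equality of the ternary values over all extensions, there are only finitely many pairs
with trivial tame symbols outside a finite set of places. -/
theorem exists_finite_ternaryValues (S : Set (HeightOneSpectrum (𝓞 K))) (hS : S.Finite) :
    ∃ F : Set (K × K), F.Finite ∧ ∀ a b : K, a ≠ 0 → b ≠ 0 →
      (∀ w : HeightOneSpectrum (𝓞 K), w ∉ S → (w.valuation K).TameSymbolSquare a b) →
      ∃ p ∈ F, ∀ (L : Type u) [Field L] [Algebra K L],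
        ternaryValues L (algebraMap K L a) (algebraMap K L b) =
          ternaryValues L (algebraMap K L p.1) (algebraMap K L p.2) := by
  obtain ⟨C₁, hC₁, hbal⟩ := exists_balanced K
  obtain ⟨C, hdesc⟩ := exists_descent K S hS
  set d := Module.finrank ℚ K with hd
  let F₀ : Set K := {x : K | IsIntegral ℤ x ∧ ∀ φ : K →+* ℂ, ‖φ x‖ ≤ C₁ * C ^ (1 / (d : ℝ))}
  have hF₀ : F₀.Finite := Embeddings.finite_of_norm_le K ℂ _
  refine ⟨F₀ ×ˢ F₀ ∪ {(1, 1)}, (hF₀.prod hF₀).union (Set.finite_singleton _), ?_⟩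
  have hmem : ∀ b : K, b ≠ 0 → (squareClassNorm b : ℝ) ≤ C → ∃ e : K, e ≠ 0 ∧ b * e ^ 2 ∈ F₀ := by
    intro b hb hbC
    obtain ⟨e, B, -, -, he, hB, -, -, -, hw⟩ := hbal b hb
    refine ⟨e, he, ?_, fun φ => ?_⟩
    · rw [← hB]; exact B.2
    · rw [← hB]
      refine (hw (InfinitePlace.mk φ)).trans ?_
      have h0 : 0 ≤ C₁ := zero_le_one.trans hC₁
      gcongr
  intro a b
  induction hn : squareClassNorm a + squareClassNorm b using Nat.strong_induction_on
    generalizing a b with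
  | _ n ih =>
  intro ha hb htame
  wlog hab : squareClassNorm a ≤ squareClassNorm b generalizing a b
  · obtain ⟨p, hp, h⟩ := this b a (by omega) hb ha (fun w hw => (htame w hw).symm) (by omega)
    refine ⟨p, hp, fun L _ _ => ?_⟩
    rw [ternaryValues_comm, h L]
  by_cases hbC : (squareClassNorm b : ℝ) ≤ C
  · obtain ⟨e, he, heF⟩ := hmem a ha ((Nat.cast_le.mpr hab).trans hbC)
    obtain ⟨f, hf, hfF⟩ := hmem b hb hbC
    refine ⟨(a * e ^ 2, b * f ^ 2), Or.inl ⟨heF, hfF⟩, fun L _ _ => ?_⟩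
    rw [map_mul, map_mul, map_pow, map_pow, ternaryValues_mul_sq _ _ ((map_ne_zero _).mpr hf),
      ternaryValues_comm (_ * _), ternaryValues_mul_sq _ _ ((map_ne_zero _).mpr he),
      ternaryValues_comm]
  rcases hdesc a b ha hb htame with ⟨x, rfl⟩ | ⟨s, r, hz, hle⟩
  · refine ⟨(1, 1), Or.inr rfl, fun L _ _ => ?_⟩
    have := charZero_of_injective_algebraMap (algebraMap K L).injective
    have hx : algebraMap K L x ≠ 0 := (map_ne_zero _).mpr fun h => ha (by rw [h, mul_zero])
    have hb' : algebraMap K L b ≠ 0 := (map_ne_zero _).mpr hb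
    have h1 := ternaryValues_mul_sq (algebraMap K L b) 1 hx
    rw [one_mul, ternaryValues_comm, pow_two, ← map_mul, ternaryValues_comm _ 1,
      ternaryValues_one_left hb'] at h1
    simpa using h1
  · have hb0 : 0 < (squareClassNorm b : ℝ) := Nat.cast_pos.mpr (squareClassNorm_pos hb)
    have hlt : squareClassNorm ((s ^ 2 - a * r ^ 2) * b) < squareClassNorm b := by
      rw [← Nat.cast_lt (α := ℝ)]
      refine lt_of_pow_lt_pow_left₀ 2 hb0.le (hle.trans_lt ?_)
      rw [not_le] at hbC
      have ha0 : 0 < (squareClassNorm a : ℝ) := Nat.cast_pos.mpr (squareClassNorm_pos ha)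
      have hab' : (squareClassNorm a : ℝ) ≤ squareClassNorm b := Nat.cast_le.mpr hab
      nlinarith
    obtain ⟨p, hp, h⟩ := ih _ (by omega) a ((s ^ 2 - a * r ^ 2) * b) rfl ha (mul_ne_zero hz hb)
      fun w hw => (htame w hw).mul_norm ha hz
    refine ⟨p, hp, fun L _ _ => ?_⟩
    rw [← h L]
    simp only [map_mul, map_sub, map_pow]
    refine (ternaryValues_mul_norm ?_).symm
    rw [← map_pow, ← map_pow, ← map_mul, ← map_sub]
    exact (map_ne_zero _).mpr hz

end NumberField

namespace NumberField

variable (K : Type*) [Field K] [NumberField K]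

open Filter Topology in
lemma hasSum_absNorm_rpow {s : ℝ} (hs : 1 < s) :
    HasSum (fun I : Ideal (𝓞 K) => (Ideal.absNorm I : ℝ) ^ (-s)) (dedekindZeta K s).re := by
  have hbig : (fun n : ℕ => ∑ k ∈ Finset.Icc 1 n,
      (Nat.card {I : Ideal (𝓞 K) // Ideal.absNorm I = k} : ℝ)) =O[atTop]
      fun n => (n : ℝ) ^ (1 : ℝ) := by
    have h1 : Tendsto (fun n : ℕ => (∑ k ∈ Finset.Icc 1 n,
        (Nat.card {I : Ideal (𝓞 K) // Ideal.absNorm I = k} : ℝ)) / n) atTop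
        (𝓝 (dedekindZeta_residue K)) := by
      refine ((Ideal.tendsto_norm_le_div_atTop₀ K).comp tendsto_natCast_atTop_atTop).congr
        fun n => ?_
      simp only [Function.comp_apply, Nat.cast_le, ← Nat.cast_sum]
      congr
      rw [← add_left_inj 1, ← Ideal.card_norm_le_eq_card_norm_le_add_one,
        show Finset.Icc 1 n = Finset.Ioc 0 n from Finset.Icc_succ_left_eq_Ioc _ _,
        show 1 = Nat.card {I : Ideal (𝓞 K) // Ideal.absNorm I = 0} by
          simp [Ideal.absNorm_eq_zero_iff],
        Finset.sum_Ioc_add_eq_sum_Icc (n.zero_le),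
        ← Finset.card_preimage_eq_sum_card_image_eq
          (fun k _ => Ideal.finite_setOfPred_absNorm_eq k)]
      simp [Set.coe_eq_subtype]
    simp_rw [Real.rpow_one]
    refine Asymptotics.isBigO_of_div_tendsto_nhds ?_ _ h1
    filter_upwards [eventually_ne_atTop 0] with n hn h0
    exact absurd (Nat.cast_eq_zero.mp h0) hn
  have hsum := LSeriesSummable_of_sum_norm_bigO_and_nonneg (s := s) hbig (fun _ => Nat.cast_nonneg _)
    zero_le_one (by simpa using hs)
  have hterm : ∀ n : ℕ, LSeries.term (fun n => ((Nat.card {I : Ideal (𝓞 K) // Ideal.absNorm I = n} : ℝ) : ℂ)) s n =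
      (((Nat.card {I : Ideal (𝓞 K) // Ideal.absNorm I = n} : ℝ) * (n : ℝ) ^ (-s) : ℝ) : ℂ) := by
    intro n
    rcases eq_or_ne n 0 with rfl | hn
    · simp [Real.zero_rpow (neg_ne_zero.mpr (zero_lt_one.trans hs).ne')]
    · rw [LSeries.term_of_ne_zero hn, div_eq_mul_inv, Complex.ofReal_mul, Real.rpow_neg (Nat.cast_nonneg _),
        Complex.ofReal_inv, Complex.ofReal_cpow (Nat.cast_nonneg _)]
      simp
  have hz : HasSum (fun n : ℕ => (Nat.card {I : Ideal (𝓞 K) // Ideal.absNorm I = n} : ℝ) * (n : ℝ) ^ (-s))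
      (dedekindZeta K s).re := by
    have h1 := hsum.hasSum
    convert Complex.hasSum_re h1 using 1
    · ext n; rw [hterm, Complex.ofReal_re]
    · simp only [dedekindZeta, LSeries, Complex.ofReal_natCast]
  have hfin : ∀ n : ℕ, Finite {I : Ideal (𝓞 K) // Ideal.absNorm I = n} := fun n =>
    (Ideal.finite_setOfPred_absNorm_eq n).to_subtype
  rw [← (Equiv.sigmaFiberEquiv (fun I : Ideal (𝓞 K) => Ideal.absNorm I)).hasSum_iff]
  have hfib : ∀ n : ℕ, HasSum (fun I : {I : Ideal (𝓞 K) // Ideal.absNorm I = n} =>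
      (Ideal.absNorm I.1 : ℝ) ^ (-s))
      ((Nat.card {I : Ideal (𝓞 K) // Ideal.absNorm I = n} : ℝ) * (n : ℝ) ^ (-s)) := by
    intro n
    have := Fintype.ofFinite {I : Ideal (𝓞 K) // Ideal.absNorm I = n}
    convert hasSum_fintype (fun I : {I : Ideal (𝓞 K) // Ideal.absNorm I = n} =>
      (Ideal.absNorm I.1 : ℝ) ^ (-s)) using 1
    rw [Finset.sum_congr rfl (g := fun _ => (n : ℝ) ^ (-s)) (fun I _ => by rw [I.2])]
    simp
  have hsm : Summable ((fun I : Ideal (𝓞 K) => (Ideal.absNorm I : ℝ) ^ (-s)) ∘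
      (Equiv.sigmaFiberEquiv (fun I : Ideal (𝓞 K) => Ideal.absNorm I))) := by
    refine (summable_sigma_of_nonneg fun x => ?_).mpr ⟨fun n => (hfib n).summable, ?_⟩
    · exact Real.rpow_nonneg (Nat.cast_nonneg _) _
    convert hz.summable using 2 with n
    exact (hfib n).tsum_eq
  have := hsm.hasSum.sigma hfib
  rw [← this.unique hz]
  exact hsm.hasSum

end NumberField

namespace NumberField

variable {K : Type*} [Field K] [NumberField K]

lemma two_le_absNorm (p : HeightOneSpectrum (𝓞 K)) : 2 ≤ Ideal.absNorm p.asIdeal := by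
  have h0 : Ideal.absNorm p.asIdeal ≠ 0 := Ideal.absNorm_eq_zero_iff.not.mpr p.ne_bot
  have h1 : Ideal.absNorm p.asIdeal ≠ 1 := Ideal.absNorm_eq_one_iff.not.mpr p.isPrime.ne_top
  omega

variable (K) in
lemma summable_prime_absNorm_rpow {s : ℝ} (hs : 1 < s) :
    Summable fun p : HeightOneSpectrum (𝓞 K) => (Ideal.absNorm p.asIdeal : ℝ) ^ (-s) :=
  (hasSum_absNorm_rpow K hs).summable.comp_injective
    (i := fun p : HeightOneSpectrum (𝓞 K) => p.asIdeal) fun _ _ h => HeightOneSpectrum.ext h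

lemma absNorm_rpow_nonneg (I : Ideal (𝓞 K)) (s : ℝ) : 0 ≤ (Ideal.absNorm I : ℝ) ^ (-s) :=
  Real.rpow_nonneg (Nat.cast_nonneg _) _

lemma absNorm_rpow_le_half (p : HeightOneSpectrum (𝓞 K)) {s : ℝ} (hs : 1 ≤ s) :
    (Ideal.absNorm p.asIdeal : ℝ) ^ (-s) ≤ 1 / 2 := by
  have h2 : (2 : ℝ) ≤ Ideal.absNorm p.asIdeal := by exact_mod_cast two_le_absNorm p
  calc (Ideal.absNorm p.asIdeal : ℝ) ^ (-s) ≤ (Ideal.absNorm p.asIdeal : ℝ) ^ (-1 : ℝ) :=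
        Real.rpow_le_rpow_of_exponent_le (by linarith) (by linarith)
    _ = (Ideal.absNorm p.asIdeal : ℝ)⁻¹ := Real.rpow_neg_one _
    _ ≤ 1 / 2 := by rw [one_div]; exact inv_anti₀ two_pos h2

lemma absNorm_rpow_sq_le (p : HeightOneSpectrum (𝓞 K)) {s : ℝ} (hs : 1 ≤ s) :
    ((Ideal.absNorm p.asIdeal : ℝ) ^ (-s)) ^ 2 ≤ (Ideal.absNorm p.asIdeal : ℝ) ^ (-2 : ℝ) := by
  have h2 : (2 : ℝ) ≤ Ideal.absNorm p.asIdeal := by exact_mod_cast two_le_absNorm p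
  rw [← Real.rpow_mul_natCast (by linarith)]
  refine Real.rpow_le_rpow_of_exponent_le (by linarith) ?_
  push_cast
  linarith

lemma absNorm_mul_rpow (I J : Ideal (𝓞 K)) (s : ℝ) : (Ideal.absNorm (I * J) : ℝ) ^ (-s) =
    (Ideal.absNorm I : ℝ) ^ (-s) * (Ideal.absNorm J : ℝ) ^ (-s) := by
  rw [map_mul, Nat.cast_mul, Real.mul_rpow (Nat.cast_nonneg _) (Nat.cast_nonneg _)]

variable (K) in
/-- The completely multiplicative function `I ↦ N(I)⁻ˢ` on ideals. -/
noncomputable def absNormRpow (s : ℝ) : Ideal (𝓞 K) →* ℝ where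
  toFun I := (Ideal.absNorm I : ℝ) ^ (-s)
  map_one' := by simp
  map_mul' I J := absNorm_mul_rpow I J s

lemma prod_one_add_absNorm_rpow_le {s : ℝ} (hs : 1 < s) (P : Finset (HeightOneSpectrum (𝓞 K))) :
    ∏ p ∈ P, (1 + (Ideal.absNorm p.asIdeal : ℝ) ^ (-s)) ≤ (dedekindZeta K s).re := by
  classical
  have hinj : Function.Injective
      (fun A : Finset (HeightOneSpectrum (𝓞 K)) => ∏ p ∈ A, p.asIdeal) := by
    have hsub : ∀ A B : Finset (HeightOneSpectrum (𝓞 K)),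
        ∏ p ∈ A, p.asIdeal = ∏ p ∈ B, p.asIdeal → A ⊆ B := by
      intro A B h q hq
      have h1 : q.asIdeal ∣ ∏ p ∈ B, p.asIdeal := by
        rw [← h]; exact Finset.dvd_prod_of_mem _ hq
      obtain ⟨p, hp, hqp⟩ := (q.prime.dvd_finsetProd_iff _).mp h1
      have : q = p := HeightOneSpectrum.ext
        ((p.isMaximal.eq_of_le q.isPrime.ne_top (Ideal.dvd_iff_le.mp hqp)).symm)
      rwa [this]
    exact fun A B h => (hsub A B h).antisymm (hsub B A h.symm)
  calc ∏ p ∈ P, (1 + (Ideal.absNorm p.asIdeal : ℝ) ^ (-s))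
      = ∑ A ∈ P.powerset, absNormRpow K s (∏ p ∈ A, p.asIdeal) := by
        rw [Finset.prod_one_add]
        exact Finset.sum_congr rfl fun A _ => by rw [map_prod]; rfl
    _ = ∑ I ∈ P.powerset.image (fun A => ∏ p ∈ A, p.asIdeal), (Ideal.absNorm I : ℝ) ^ (-s) := by
        rw [Finset.sum_image fun A _ B _ h => hinj h]; rfl
    _ ≤ _ := sum_le_hasSum _ (fun I _ => absNorm_rpow_nonneg I s) (hasSum_absNorm_rpow K hs)

lemma dedekindZeta_le_exp {s : ℝ} (hs : 1 < s) :
    (dedekindZeta K s).re ≤ Real.exp (∑' p : HeightOneSpectrum (𝓞 K),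
      ((Ideal.absNorm p.asIdeal : ℝ) ^ (-s) + 2 * (Ideal.absNorm p.asIdeal : ℝ) ^ (-2 : ℝ))) := by
  classical
  have hsummable : Summable fun p : HeightOneSpectrum (𝓞 K) =>
      ((Ideal.absNorm p.asIdeal : ℝ) ^ (-s) + 2 * (Ideal.absNorm p.asIdeal : ℝ) ^ (-2 : ℝ)) :=
    (summable_prime_absNorm_rpow K hs).add ((summable_prime_absNorm_rpow K one_lt_two).mul_left 2)
  refine hasSum_le_of_sum_le (hasSum_absNorm_rpow K hs) fun T => ?_
  let T' := T.filter (· ≠ ⊥)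
  have hT' : ∑ I ∈ T, (Ideal.absNorm I : ℝ) ^ (-s) = ∑ I ∈ T', (Ideal.absNorm I : ℝ) ^ (-s) := by
    refine (Finset.sum_filter_of_ne fun I _ h => ?_).symm
    rintro rfl
    simp [Real.zero_rpow (neg_ne_zero.mpr (zero_lt_one.trans hs).ne')] at h
  have hne : ∀ I ∈ T', I ≠ 0 := fun I hI => (Finset.mem_filter.mp hI).2
  have hfin : (⋃ I ∈ T', {p : HeightOneSpectrum (𝓞 K) | p.asIdeal ∣ I}).Finite :=
    T'.finite_toSet.biUnion fun I hI => Ideal.finite_factors (hne I hI)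
  let P := hfin.toFinset
  let c : Ideal (𝓞 K) → P → ℕ := fun I p => (Associates.mk p.1.asIdeal).count (Associates.mk I).factors
  have hprod : ∀ I ∈ T', ∏ p : P, p.1.asIdeal ^ c I p = I := by
    intro I hI
    conv_rhs => rw [← Ideal.finprod_heightOneSpectrum_factorization (hne I hI)]
    rw [finprod_eq_prod_of_mulSupport_subset (s := P)]
    · exact Finset.prod_coe_sort P (fun p : HeightOneSpectrum (𝓞 K) => p.maxPowDividing I)
    · intro p hp
      rw [Function.mem_mulSupport, HeightOneSpectrum.maxPowDividing] at hp
      rw [hfin.coe_toFinset]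
      refine Set.mem_biUnion hI ?_
      refine (Associates.count_ne_zero_iff_dvd (hne I hI) p.irreducible).mp fun h => hp ?_
      rw [h, pow_zero]
  let n := ∑ I ∈ T', ∑ p : P, c I p
  have hcn : ∀ I ∈ T', ∀ p, c I p < n + 1 := fun I hI p => Nat.lt_succ_of_le <|
    (Finset.single_le_sum (f := c I) (fun _ _ => Nat.zero_le _) (Finset.mem_univ p)).trans
      (Finset.single_le_sum (f := fun I => ∑ p : P, c I p) (fun _ _ => Nat.zero_le _) hI)
  have hinj : Set.InjOn c T' := fun I hI J hJ h => by
    rw [← hprod I hI, ← hprod J hJ, h]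
  rw [hT']
  calc ∑ I ∈ T', (Ideal.absNorm I : ℝ) ^ (-s)
      = ∑ I ∈ T', ∏ p : P, ((Ideal.absNorm p.1.asIdeal : ℝ) ^ (-s)) ^ c I p := by
        refine Finset.sum_congr rfl fun I hI => ?_
        conv_lhs => rw [← hprod I hI]
        change absNormRpow K s _ = _
        rw [map_prod]
        exact Finset.prod_congr rfl fun p _ => map_pow _ _ _
    _ = ∑ g ∈ T'.image c, ∏ p : P, ((Ideal.absNorm p.1.asIdeal : ℝ) ^ (-s)) ^ g p :=
        (Finset.sum_image (f := fun g : P → ℕ => ∏ p : P,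
          ((Ideal.absNorm p.1.asIdeal : ℝ) ^ (-s)) ^ g p) hinj).symm
    _ ≤ ∑ g ∈ Fintype.piFinset fun _ : P => Finset.range (n + 1),
          ∏ p : P, ((Ideal.absNorm p.1.asIdeal : ℝ) ^ (-s)) ^ g p := by
        refine Finset.sum_le_sum_of_subset_of_nonneg ?_ fun g _ _ =>
          Finset.prod_nonneg fun p _ => pow_nonneg (absNorm_rpow_nonneg _ s) _
        intro g hg
        obtain ⟨I, hI, rfl⟩ := Finset.mem_image.mp hg
        exact Fintype.mem_piFinset.mpr fun p => Finset.mem_range.mpr (hcn I hI p)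
    _ = ∏ p : P, ∑ i ∈ Finset.range (n + 1), ((Ideal.absNorm p.1.asIdeal : ℝ) ^ (-s)) ^ i :=
        (Finset.prod_univ_sum _ _).symm
    _ ≤ ∏ p : P, Real.exp ((Ideal.absNorm p.1.asIdeal : ℝ) ^ (-s) +
          2 * (Ideal.absNorm p.1.asIdeal : ℝ) ^ (-2 : ℝ)) := by
        refine Finset.prod_le_prod (fun p _ => Finset.sum_nonneg fun i _ =>
          pow_nonneg (absNorm_rpow_nonneg _ s) _) fun p _ => ?_
        have hx0 := absNorm_rpow_nonneg p.1.asIdeal s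
        have hx1 := absNorm_rpow_le_half p.1 hs.le
        have hx2 := absNorm_rpow_sq_le p.1 hs.le
        set x := (Ideal.absNorm p.1.asIdeal : ℝ) ^ (-s)
        have hgeom : ∑ i ∈ Finset.range (n + 1), x ^ i ≤ (1 - x)⁻¹ := by
          rw [inv_eq_one_div, le_div_iff₀ (by linarith), geom_sum_mul_neg]
          linarith [pow_nonneg hx0 (n + 1)]
        refine hgeom.trans ?_
        refine le_trans ?_ (Real.add_one_le_exp _)
        rw [inv_le_iff_one_le_mul₀ (by linarith)]
        nlinarith [mul_nonneg hx0 hx0, mul_nonneg (mul_nonneg hx0 hx0) (sub_nonneg.mpr hx1)]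
    _ = Real.exp (∑ p : P, ((Ideal.absNorm p.1.asIdeal : ℝ) ^ (-s) +
          2 * (Ideal.absNorm p.1.asIdeal : ℝ) ^ (-2 : ℝ))) := (Real.exp_sum _ _).symm
    _ ≤ _ := by
        refine Real.exp_le_exp.mpr ?_
        rw [Finset.sum_coe_sort P fun p : HeightOneSpectrum (𝓞 K) =>
          ((Ideal.absNorm p.asIdeal : ℝ) ^ (-s) + 2 * (Ideal.absNorm p.asIdeal : ℝ) ^ (-2 : ℝ))]
        refine hsummable.sum_le_tsum _ fun p _ => add_nonneg (absNorm_rpow_nonneg _ _)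
          (mul_nonneg two_pos.le (absNorm_rpow_nonneg _ _))

end NumberField

namespace NumberField

open Filter Topology Asymptotics

/-- The sum of `N(p)⁻ˢ` over the finite primes of a number field. -/
noncomputable def primeZeta (K : Type*) [Field K] [NumberField K] (s : ℝ) : ℝ :=
  ∑' p : HeightOneSpectrum (𝓞 K), (Ideal.absNorm p.asIdeal : ℝ) ^ (-s)

variable {K : Type*} [Field K] [NumberField K]

lemma sub_sq_le_log_one_add {x : ℝ} (hx : 0 ≤ x) : x - x ^ 2 ≤ Real.log (1 + x) := by
  refine le_trans ?_ (Real.le_log_one_add_of_nonneg hx)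
  rw [le_div_iff₀ (by linarith)]
  nlinarith [mul_nonneg hx hx, mul_nonneg (mul_nonneg hx hx) hx]

lemma one_le_dedekindZeta {s : ℝ} (hs : 1 < s) : 1 ≤ (dedekindZeta K s).re := by
  simpa using prod_one_add_absNorm_rpow_le (K := K) hs ∅

lemma primeZeta_le {s : ℝ} (hs : 1 < s) :
    primeZeta K s ≤ Real.log (dedekindZeta K s).re + primeZeta K 2 := by
  refine Real.tsum_le_of_sum_le (fun p => absNorm_rpow_nonneg _ _) fun P => ?_
  have h1 : ∑ p ∈ P, Real.log (1 + (Ideal.absNorm p.asIdeal : ℝ) ^ (-s)) ≤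
      Real.log (dedekindZeta K s).re := by
    rw [← Real.log_prod fun p _ => by have := absNorm_rpow_nonneg p.asIdeal s; positivity]
    exact Real.log_le_log (Finset.prod_pos fun p _ => by
      have := absNorm_rpow_nonneg p.asIdeal s; positivity) (prod_one_add_absNorm_rpow_le hs P)
  have h2 : ∑ p ∈ P, (Ideal.absNorm p.asIdeal : ℝ) ^ (-2 : ℝ) ≤ primeZeta K 2 :=
    (summable_prime_absNorm_rpow K one_lt_two).sum_le_tsum _ fun p _ => absNorm_rpow_nonneg _ _
  have h3 : ∑ p ∈ P, (Ideal.absNorm p.asIdeal : ℝ) ^ (-s) ≤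
      ∑ p ∈ P, (Real.log (1 + (Ideal.absNorm p.asIdeal : ℝ) ^ (-s)) +
        (Ideal.absNorm p.asIdeal : ℝ) ^ (-2 : ℝ)) := by
    refine Finset.sum_le_sum fun p _ => ?_
    have := sub_sq_le_log_one_add (absNorm_rpow_nonneg p.asIdeal s)
    have := absNorm_rpow_sq_le p hs.le
    linarith
  rw [Finset.sum_add_distrib] at h3
  linarith

lemma log_dedekindZeta_le {s : ℝ} (hs : 1 < s) :
    Real.log (dedekindZeta K s).re ≤ primeZeta K s + 2 * primeZeta K 2 := by
  rw [Real.log_le_iff_le_exp (zero_lt_one.trans_le (one_le_dedekindZeta hs))]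
  refine (dedekindZeta_le_exp hs).trans_eq ?_
  rw [(summable_prime_absNorm_rpow K hs).tsum_add
    ((summable_prime_absNorm_rpow K one_lt_two).mul_left 2), tsum_mul_left]
  rfl

variable (K) in
lemma primeZeta_add_log_isBigO :
    (fun s => primeZeta K s + Real.log (s - 1)) =O[𝓝[>] 1] (fun _ => (1 : ℝ)) := by
  have h1 : Tendsto (fun s : ℝ => Real.log ((s - 1) * (dedekindZeta K s).re)) (𝓝[>] 1)
      (𝓝 (Real.log (dedekindZeta_residue K))) := by
    have := (Complex.continuous_re.tendsto _).comp (tendsto_sub_one_mul_dedekindZeta_nhdsGT K)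
    refine (Tendsto.congr (fun s => ?_) this).log (dedekindZeta_residue_ne_zero K)
    simp
  have h2 := h1.isBigO_one ℝ
  have h3 : (fun s => primeZeta K s + Real.log (s - 1) -
      Real.log ((s - 1) * (dedekindZeta K s).re)) =O[𝓝[>] 1] (fun _ => (1 : ℝ)) := by
    refine IsBigO.of_bound (2 * primeZeta K 2) ?_
    filter_upwards [self_mem_nhdsWithin] with s hs
    rw [Set.mem_Ioi] at hs
    have h0 : 0 ≤ primeZeta K 2 := tsum_nonneg fun p => absNorm_rpow_nonneg _ _
    rw [Real.log_mul (by linarith) (zero_lt_one.trans_le (one_le_dedekindZeta hs)).ne',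
      norm_one, mul_one, Real.norm_eq_abs, abs_le]
    constructor <;> linarith [primeZeta_le (K := K) hs, log_dedekindZeta_le (K := K) hs]
  simpa using h3.add h2

end NumberField

namespace NumberField

variable {K : Type*} [Field K] [NumberField K] {F : Type*} [Field F] [NumberField F] [Algebra K F]

lemma finite_under_eq (p : HeightOneSpectrum (𝓞 K)) :
    {P : HeightOneSpectrum (𝓞 F) | P.under (𝓞 K) = p}.Finite := by
  have := p.isMaximal
  refine Set.Finite.of_finite_image (f := HeightOneSpectrum.asIdeal)
    ((IsDedekindDomain.primesOver_finite p.asIdeal (𝓞 F)).subset ?_) fun _ _ _ _ h => HeightOneSpectrum.ext h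
  rintro _ ⟨P, hP, rfl⟩
  rw [Set.mem_ofPred_eq] at hP
  exact ⟨P.isPrime, ⟨by rw [← hP]; rfl⟩⟩

variable (F) in
/-- The finite set of primes of `F` above a prime of `K`. -/
noncomputable def primesAbove (p : HeightOneSpectrum (𝓞 K)) :
    Finset (HeightOneSpectrum (𝓞 F)) := (finite_under_eq p).toFinset

lemma mem_primesAbove {p : HeightOneSpectrum (𝓞 K)} {P : HeightOneSpectrum (𝓞 F)} :
    P ∈ primesAbove F p ↔ P.under (𝓞 K) = p := by
  simp [primesAbove]

lemma liesOver_of_mem_primesAbove {p : HeightOneSpectrum (𝓞 K)} {P : HeightOneSpectrum (𝓞 F)}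
    (h : P ∈ primesAbove F p) : P.asIdeal.LiesOver p.asIdeal :=
  ⟨by rw [← mem_primesAbove.mp h]; rfl⟩

variable (F) in
set_option linter.deprecated false in
lemma sum_primesAbove (p : HeightOneSpectrum (𝓞 K)) :
    ∑ P ∈ primesAbove F p, p.asIdeal.ramificationIdx' P.asIdeal * p.asIdeal.inertiaDeg' P.asIdeal =
      Module.finrank K F := by
  have := p.isMaximal
  rw [← Ideal.sum_ramification_inertia (𝓞 F) K F p.ne_bot]
  refine Finset.sum_bij (fun P _ => P.asIdeal) (fun P hP => ?_)
    (fun _ _ _ _ h => HeightOneSpectrum.ext h) (fun I hI => ?_) fun _ _ => rfl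
  · exact (IsDedekindDomain.mem_primesOverFinset_iff p.ne_bot _).mpr ⟨P.isPrime, liesOver_of_mem_primesAbove hP⟩
  · have hI := (IsDedekindDomain.mem_primesOverFinset_iff p.ne_bot _).mp hI
    have := hI.2
    exact ⟨⟨I, hI.1, Ideal.ne_bot_of_mem_primesOver p.ne_bot hI⟩,
      mem_primesAbove.mpr (HeightOneSpectrum.ext hI.2.over.symm), rfl⟩

set_option linter.deprecated false in
lemma one_le_ramificationIdx_mul_inertiaDeg {p : HeightOneSpectrum (𝓞 K)}
    {P : HeightOneSpectrum (𝓞 F)} (h : P ∈ primesAbove F p) :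
    1 ≤ p.asIdeal.ramificationIdx' P.asIdeal * p.asIdeal.inertiaDeg' P.asIdeal := by
  have := p.isMaximal
  have := P.isPrime
  have := liesOver_of_mem_primesAbove h
  exact Right.one_le_mul (Nat.pos_iff_ne_zero.mpr
    (Ideal.IsDedekindDomain.ramificationIdx'_ne_zero_of_liesOver _ p.ne_bot))
    (Nat.pos_iff_ne_zero.mpr (Ideal.inertiaDeg'_ne_zero p.asIdeal P.asIdeal))

variable (F) in
lemma card_primesAbove_le (p : HeightOneSpectrum (𝓞 K)) :
    (primesAbove F p).card ≤ Module.finrank K F := by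
  rw [← sum_primesAbove F p, Finset.card_eq_sum_ones]
  exact Finset.sum_le_sum fun P hP => one_le_ramificationIdx_mul_inertiaDeg hP

lemma absNorm_of_mem_primesAbove {p : HeightOneSpectrum (𝓞 K)} {P : HeightOneSpectrum (𝓞 F)}
    (h : P ∈ primesAbove F p) : Ideal.absNorm P.asIdeal =
      Ideal.absNorm p.asIdeal ^ p.asIdeal.inertiaDeg' P.asIdeal := by
  have := liesOver_of_mem_primesAbove h
  exact Ideal.absNorm_eq_pow_inertiaDeg'_of_liesOver P.asIdeal p.asIdeal p.isPrime p.ne_bot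

lemma inertiaDeg_ne_zero_of_mem_primesAbove {p : HeightOneSpectrum (𝓞 K)}
    {P : HeightOneSpectrum (𝓞 F)} (h : P ∈ primesAbove F p) :
    p.asIdeal.inertiaDeg' P.asIdeal ≠ 0 := fun h0 => by
  simpa [h0] using one_le_ramificationIdx_mul_inertiaDeg h

variable (K F) in
lemma hasSum_primesAbove {s : ℝ} (hs : 1 < s) : HasSum (fun p : HeightOneSpectrum (𝓞 K) =>
    ∑ P ∈ primesAbove F p, (Ideal.absNorm P.asIdeal : ℝ) ^ (-s)) (primeZeta F s) := by
  have h := (summable_prime_absNorm_rpow F hs).hasSum.tsum_fiberwise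
    (HeightOneSpectrum.under (𝓞 K))
  refine Eq.mp (congrArg (HasSum · (primeZeta F s)) (funext fun p => ?_)) h
  symm
  have : (HeightOneSpectrum.under (𝓞 K) ⁻¹' {p} : Set (HeightOneSpectrum (𝓞 F))) =
    ↑(primesAbove F p) := by
    ext P
    simp [mem_primesAbove]
  rw [this, Finset.tsum_subtype' (primesAbove F p)
    fun P : HeightOneSpectrum (𝓞 F) => (Ideal.absNorm P.asIdeal : ℝ) ^ (-s)]

end NumberField

namespace NumberField

section residueSymbol

variable {K : Type*} [Field K] [NumberField K]

open Classical

/-- The residue field of a finite prime is a field. -/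
@[reducible] noncomputable def quotientField (p : HeightOneSpectrum (𝓞 K)) :
    Field (𝓞 K ⧸ p.asIdeal) :=
  have := p.isMaximal
  Ideal.Quotient.field p.asIdeal

/-- The residue field of a finite prime is finite. -/
@[reducible] noncomputable def quotientFintype (p : HeightOneSpectrum (𝓞 K)) :
    Fintype (𝓞 K ⧸ p.asIdeal) :=
  have := Ideal.finiteQuotientOfFreeOfNeBot p.asIdeal p.ne_bot
  Fintype.ofFinite _

attribute [local instance] quotientField quotientFintype

/-- The quadratic residue symbol modulo a finite prime. -/
noncomputable def residueSymbol (p : HeightOneSpectrum (𝓞 K)) (x : 𝓞 K) : ℤ :=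
  quadraticChar (𝓞 K ⧸ p.asIdeal) (Ideal.Quotient.mk p.asIdeal x)

lemma residueSymbol_mul (p : HeightOneSpectrum (𝓞 K)) (x y : 𝓞 K) :
    residueSymbol p (x * y) = residueSymbol p x * residueSymbol p y := by
  rw [residueSymbol, map_mul]
  exact map_mul (quadraticChar (𝓞 K ⧸ p.asIdeal)) _ _

lemma residueSymbol_one (p : HeightOneSpectrum (𝓞 K)) : residueSymbol p 1 = 1 := by
  rw [residueSymbol, map_one]
  exact map_one (quadraticChar (𝓞 K ⧸ p.asIdeal))

lemma residueSymbol_prod {ι : Type*} (p : HeightOneSpectrum (𝓞 K)) (x : ι → 𝓞 K)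
    (A : Finset ι) : residueSymbol p (∏ i ∈ A, x i) = ∏ i ∈ A, residueSymbol p (x i) :=
  map_prod (⟨⟨residueSymbol p, residueSymbol_one p⟩, residueSymbol_mul p⟩ : 𝓞 K →* ℤ) x A

lemma residueSymbol_eq_zero_iff {p : HeightOneSpectrum (𝓞 K)} {x : 𝓞 K} :
    residueSymbol p x = 0 ↔ x ∈ p.asIdeal := by
  rw [residueSymbol, quadraticChar_eq_zero_iff, Ideal.Quotient.eq_zero_iff_mem]

lemma residueSymbol_eq_one_iff {p : HeightOneSpectrum (𝓞 K)} {x : 𝓞 K} (hx : x ∉ p.asIdeal) :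
    residueSymbol p x = 1 ↔ ∃ a, x - a ^ 2 ∈ p.asIdeal := by
  rw [residueSymbol, quadraticChar_one_iff_isSquare
    (by rwa [Ne, Ideal.Quotient.eq_zero_iff_mem]), isSquare_iff_exists_sq,
    Ideal.Quotient.mk_surjective.exists]
  simp_rw [← map_pow, Ideal.Quotient.mk_eq_mk_iff_sub_mem]

lemma residueSymbol_eq_one_or_neg_one {p : HeightOneSpectrum (𝓞 K)} {x : 𝓞 K}
    (hx : x ∉ p.asIdeal) : residueSymbol p x = 1 ∨ residueSymbol p x = -1 := by
  rw [residueSymbol]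
  exact quadraticChar_dichotomy (by rwa [Ne, Ideal.Quotient.eq_zero_iff_mem])

lemma abs_residueSymbol_le (p : HeightOneSpectrum (𝓞 K)) (x : 𝓞 K) :
    |(residueSymbol p x : ℝ)| ≤ 1 := by
  by_cases h : x ∈ p.asIdeal
  · simp [residueSymbol_eq_zero_iff.mpr h]
  · rcases residueSymbol_eq_one_or_neg_one h with h | h <;> simp [h]

end residueSymbol

section quadratic

variable {K : Type*} [Field K] [NumberField K] {F : Type*} [Field F] [NumberField F] [Algebra K F]

lemma mem_iff_of_mem_primesAbove {p : HeightOneSpectrum (𝓞 K)} {P : HeightOneSpectrum (𝓞 F)}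
    (h : P ∈ primesAbove F p) {a : 𝓞 K} :
    algebraMap (𝓞 K) (𝓞 F) a ∈ P.asIdeal ↔ a ∈ p.asIdeal := by
  rw [← mem_primesAbove.mp h]
  rfl

lemma inertiaDeg_ne_one_of_residueSymbol_eq_neg_one {p : HeightOneSpectrum (𝓞 K)}
    {P : HeightOneSpectrum (𝓞 F)} (h : P ∈ primesAbove F p) {x : 𝓞 K} {θ : 𝓞 F}
    (hθ : θ ^ 2 = algebraMap (𝓞 K) (𝓞 F) x) (hx : residueSymbol p x = -1) :
    p.asIdeal.inertiaDeg' P.asIdeal ≠ 1 := by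
  intro h1
  have hxp : x ∉ p.asIdeal := fun hxp => by
    rw [residueSymbol_eq_zero_iff.mpr hxp] at hx; norm_num at hx
  have hN := absNorm_of_mem_primesAbove h
  rw [h1, pow_one, Ideal.absNorm_apply, Ideal.absNorm_apply, Submodule.cardQuot_apply,
    Submodule.cardQuot_apply] at hN
  have hle : p.asIdeal ≤ P.asIdeal.comap (algebraMap (𝓞 K) (𝓞 F)) := fun a ha =>
    (mem_iff_of_mem_primesAbove h).mpr ha
  have hinj : Function.Injective (Ideal.quotientMap P.asIdeal (algebraMap (𝓞 K) (𝓞 F)) hle) :=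
    Ideal.quotientMap_injective' fun a ha => (mem_iff_of_mem_primesAbove h).mp ha
  have := Ideal.finiteQuotientOfFreeOfNeBot P.asIdeal P.ne_bot
  obtain ⟨y, hy⟩ := (hinj.bijective_of_nat_card_le hN.le).2 (Ideal.Quotient.mk _ θ)
  obtain ⟨a, rfl⟩ := Ideal.Quotient.mk_surjective y
  rw [Ideal.quotientMap_mk, Ideal.Quotient.mk_eq_mk_iff_sub_mem] at hy
  have : residueSymbol p x = 1 := by
    refine (residueSymbol_eq_one_iff hxp).mpr ⟨a, (mem_iff_of_mem_primesAbove h).mp ?_⟩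
    rw [map_sub, map_pow, ← hθ]
    have := P.asIdeal.mul_mem_left (-(θ + algebraMap (𝓞 K) (𝓞 F) a)) hy
    convert this using 1
    ring
  rw [this] at hx
  norm_num at hx

lemma exists_primesAbove_iff {p : HeightOneSpectrum (𝓞 K)} (hF : Module.finrank K F = 2)
    (σ : F ≃ₐ[K] F) {x : 𝓞 K} {θ : 𝓞 F} (hθ : θ ^ 2 = algebraMap (𝓞 K) (𝓞 F) x)
    (hσ : σ θ = -θ) (h2 : (2 : 𝓞 K) ∉ p.asIdeal) (hx : residueSymbol p x = 1) :
    ∃ P₁ P₂ : HeightOneSpectrum (𝓞 F), P₁ ≠ P₂ ∧ (∀ P, P ∈ primesAbove F p ↔ P = P₁ ∨ P = P₂) ∧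
      Ideal.absNorm P₁.asIdeal = Ideal.absNorm p.asIdeal ∧
      Ideal.absNorm P₂.asIdeal = Ideal.absNorm p.asIdeal := by
  classical
  have hxp : x ∉ p.asIdeal := fun hxp => by
    rw [residueSymbol_eq_zero_iff.mpr hxp] at hx; norm_num at hx
  obtain ⟨a, ha⟩ := (residueSymbol_eq_one_iff hxp).mp hx
  have hap : a ∉ p.asIdeal := fun h => hxp <| by
    have := p.asIdeal.add_mem ha (p.asIdeal.mul_mem_left a h)
    rwa [← pow_two, sub_add_cancel] at this
  have h2a : 2 * a ∉ p.asIdeal := p.isPrime.mul_notMem h2 hap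
  have hsum := sum_primesAbove F p
  rw [hF] at hsum
  obtain ⟨P, hP⟩ : (primesAbove F p).Nonempty := by
    rw [Finset.nonempty_iff_ne_empty]
    intro h
    simp [h] at hsum
  let τ : 𝓞 F ≃ₐ[𝓞 K] 𝓞 F := RingOfIntegers.mapAlgEquiv σ
  have hτ : τ θ = -θ := RingOfIntegers.ext hσ
  let P' := P.comap (τ : 𝓞 F →+* 𝓞 F) τ.surjective
  have hmem : ∀ z, z ∈ P'.asIdeal ↔ τ z ∈ P.asIdeal := fun z => Iff.rfl
  have hP' : P' ∈ primesAbove F p := by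
    rw [mem_primesAbove]
    ext z
    rw [← mem_iff_of_mem_primesAbove hP]
    change algebraMap (𝓞 K) (𝓞 F) z ∈ P'.asIdeal ↔ _
    rw [hmem, AlgEquiv.commutes]
  have hne : P ≠ P' := by
    intro heq
    have hkey : (θ - algebraMap (𝓞 K) (𝓞 F) a) * (θ + algebraMap (𝓞 K) (𝓞 F) a) ∈ P.asIdeal := by
      have := (mem_iff_of_mem_primesAbove hP).mpr ha
      rw [map_sub, map_pow, ← hθ] at this
      convert this using 1
      ring
    refine h2a ((mem_iff_of_mem_primesAbove hP).mp ?_)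
    rw [map_mul, map_ofNat]
    rcases P.isPrime.mem_or_mem hkey with h | h
    · have h' := h
      rw [heq, hmem, map_sub, hτ, AlgEquiv.commutes] at h'
      have := P.asIdeal.neg_mem (P.asIdeal.add_mem h h')
      convert this using 1
      ring
    · have h' := h
      rw [heq, hmem, map_add, hτ, AlgEquiv.commutes] at h'
      have := P.asIdeal.add_mem h h'
      convert this using 1
      ring
  have heq : ({P, P'} : Finset _) = primesAbove F p := by
    refine Finset.eq_of_subset_of_card_le (by simp [Finset.insert_subset_iff, hP, hP']) ?_
    rw [Finset.card_pair hne, ← hF]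
    exact card_primesAbove_le F p
  rw [← heq, Finset.sum_pair hne] at hsum
  have h1 := one_le_ramificationIdx_mul_inertiaDeg hP
  have h1' := one_le_ramificationIdx_mul_inertiaDeg hP'
  refine ⟨P, P', hne, fun Q => by simp [← heq], ?_, ?_⟩
  · rw [absNorm_of_mem_primesAbove hP, Nat.eq_one_of_mul_eq_one_left (n :=
      p.asIdeal.inertiaDeg' P.asIdeal) (m := p.asIdeal.ramificationIdx' P.asIdeal) (by omega),
      pow_one]
  · rw [absNorm_of_mem_primesAbove hP', Nat.eq_one_of_mul_eq_one_left (n :=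
      p.asIdeal.inertiaDeg' P'.asIdeal) (m := p.asIdeal.ramificationIdx' P'.asIdeal) (by omega),
      pow_one]

end quadratic

end NumberField

namespace NumberField

section quadratic

open Filter Topology Asymptotics

variable {K : Type*} [Field K] [NumberField K]

variable (K) in
lemma summable_residueSymbol (x : 𝓞 K) {s : ℝ} (hs : 1 < s) :
    Summable fun p : HeightOneSpectrum (𝓞 K) =>
      (residueSymbol p x : ℝ) * (Ideal.absNorm p.asIdeal : ℝ) ^ (-s) := by
  refine Summable.of_norm_bounded (summable_prime_absNorm_rpow K hs) fun p => ?_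
  rw [norm_mul, Real.norm_eq_abs, Real.norm_of_nonneg (absNorm_rpow_nonneg _ _)]
  exact mul_le_of_le_one_left (absNorm_rpow_nonneg _ _) (abs_residueSymbol_le p x)

lemma finite_setOf_mem {x : 𝓞 K} (hx : x ≠ 0) :
    {p : HeightOneSpectrum (𝓞 K) | x ∈ p.asIdeal}.Finite := by
  refine (Ideal.finite_factors (I := Ideal.span {x}) (by simpa using hx)).subset fun p hp => ?_
  simpa [Ideal.dvd_span_singleton] using hp

variable {F : Type*} [Field F] [NumberField F] [Algebra K F]

lemma abs_sum_primesAbove_sub_le (hF : Module.finrank K F = 2)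
    (σ : F ≃ₐ[K] F) {x : 𝓞 K} {θ : 𝓞 F} (hθ : θ ^ 2 = algebraMap (𝓞 K) (𝓞 F) x)
    (hσ : σ θ = -θ) (p : HeightOneSpectrum (𝓞 K)) (h2 : (2 : 𝓞 K) ∉ p.asIdeal)
    (hxp : x ∉ p.asIdeal) {s : ℝ} (hs : 1 < s) :
    |∑ P ∈ primesAbove F p, (Ideal.absNorm P.asIdeal : ℝ) ^ (-s) -
      (1 + residueSymbol p x) * (Ideal.absNorm p.asIdeal : ℝ) ^ (-s)| ≤
      2 * (Ideal.absNorm p.asIdeal : ℝ) ^ (-2 : ℝ) := by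
  classical
  rcases residueSymbol_eq_one_or_neg_one hxp with hx | hx
  · obtain ⟨P₁, P₂, hne, hP, h₁, h₂⟩ := exists_primesAbove_iff hF σ hθ hσ h2 hx
    have : primesAbove F p = {P₁, P₂} := by ext P; simp [hP]
    rw [this, Finset.sum_pair hne, h₁, h₂, hx]
    have := absNorm_rpow_nonneg p.asIdeal 2
    refine le_of_eq_of_le (abs_eq_zero.mpr ?_) (mul_nonneg two_pos.le this)
    push_cast
    ring
  · rw [hx]
    push_cast
    rw [add_neg_cancel, zero_mul, sub_zero,
      abs_of_nonneg (Finset.sum_nonneg fun P _ => absNorm_rpow_nonneg _ _)]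
    have hle : ∀ P ∈ primesAbove F p, (Ideal.absNorm P.asIdeal : ℝ) ^ (-s) ≤
        (Ideal.absNorm p.asIdeal : ℝ) ^ (-2 : ℝ) := by
      intro P hP
      have h1 := inertiaDeg_ne_one_of_residueSymbol_eq_neg_one hP hθ hx
      have h0 := inertiaDeg_ne_zero_of_mem_primesAbove hP
      rw [absNorm_of_mem_primesAbove hP, Nat.cast_pow, ← Real.rpow_pow_comm (Nat.cast_nonneg _)]
      refine le_trans ?_ (absNorm_rpow_sq_le p hs.le)
      exact pow_le_pow_of_le_one (absNorm_rpow_nonneg _ _)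
        ((absNorm_rpow_le_half p hs.le).trans (by norm_num)) (by omega)
    refine (Finset.sum_le_card_nsmul _ _ _ hle).trans ?_
    rw [nsmul_eq_mul]
    refine mul_le_mul_of_nonneg_right ?_ (absNorm_rpow_nonneg _ _)
    have := card_primesAbove_le F p
    rw [hF] at this
    exact_mod_cast this

lemma abs_sum_primesAbove_sub_le_four (hF : Module.finrank K F = 2) (x : 𝓞 K)
    (p : HeightOneSpectrum (𝓞 K)) {s : ℝ} (hs : 1 < s) :
    |∑ P ∈ primesAbove F p, (Ideal.absNorm P.asIdeal : ℝ) ^ (-s) -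
      (1 + residueSymbol p x) * (Ideal.absNorm p.asIdeal : ℝ) ^ (-s)| ≤ 4 := by
  have h1 : ∑ P ∈ primesAbove F p, (Ideal.absNorm P.asIdeal : ℝ) ^ (-s) ≤ 2 := by
    refine (Finset.sum_le_card_nsmul _ _ 1 fun P _ =>
      (absNorm_rpow_le_half P hs.le).trans (by norm_num)).trans ?_
    have := card_primesAbove_le F p
    rw [hF] at this
    rw [nsmul_eq_mul, mul_one]
    exact_mod_cast this
  have h0 : 0 ≤ ∑ P ∈ primesAbove F p, (Ideal.absNorm P.asIdeal : ℝ) ^ (-s) :=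
    Finset.sum_nonneg fun P _ => absNorm_rpow_nonneg _ _
  have h2 := absNorm_rpow_le_half p hs.le
  have h3 := absNorm_rpow_nonneg p.asIdeal s
  obtain ⟨h4, h5⟩ := abs_le.mp (abs_residueSymbol_le p x)
  rw [abs_le]
  constructor <;> nlinarith

lemma residueSymbol_isBigO_of_quadratic (hF : Module.finrank K F = 2)
    (σ : F ≃ₐ[K] F) {x : 𝓞 K} (hx : x ≠ 0) {θ : 𝓞 F}
    (hθ : θ ^ 2 = algebraMap (𝓞 K) (𝓞 F) x) (hσ : σ θ = -θ) :
    (fun s : ℝ => ∑' p : HeightOneSpectrum (𝓞 K),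
      (residueSymbol p x : ℝ) * (Ideal.absNorm p.asIdeal : ℝ) ^ (-s)) =O[𝓝[>] 1]
      (fun _ => (1 : ℝ)) := by
  classical
  have h1 := (primeZeta_add_log_isBigO F).sub (primeZeta_add_log_isBigO K)
  let B := (finite_setOf_mem (x := 2 * x) (mul_ne_zero two_ne_zero hx)).toFinset
  let D : HeightOneSpectrum (𝓞 K) → ℝ → ℝ := fun p s =>
    ∑ P ∈ primesAbove F p, (Ideal.absNorm P.asIdeal : ℝ) ^ (-s) -
      (1 + residueSymbol p x) * (Ideal.absNorm p.asIdeal : ℝ) ^ (-s)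
  have hD : ∀ s, 1 < s → HasSum (fun p => D p s) (primeZeta F s - (primeZeta K s +
      ∑' p : HeightOneSpectrum (𝓞 K),
        (residueSymbol p x : ℝ) * (Ideal.absNorm p.asIdeal : ℝ) ^ (-s))) := by
    intro s hs
    refine (hasSum_primesAbove K F hs).sub ?_
    simp_rw [add_mul, one_mul]
    exact (summable_prime_absNorm_rpow K hs).hasSum.add (summable_residueSymbol K x hs).hasSum
  let c : HeightOneSpectrum (𝓞 K) → ℝ := fun p =>
    2 * (Ideal.absNorm p.asIdeal : ℝ) ^ (-2 : ℝ) + if p ∈ B then 4 else 0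
  have hc : Summable c := ((summable_prime_absNorm_rpow K one_lt_two).mul_left 2).add
    (summable_of_ne_finset_zero (s := B) fun p hp => if_neg hp)
  have hDc : ∀ s, 1 < s → ∀ p, ‖D p s‖ ≤ c p := by
    intro s hs p
    rw [Real.norm_eq_abs]
    by_cases hp : p ∈ B
    · refine (abs_sum_primesAbove_sub_le_four hF x p hs).trans ?_
      simp only [c, if_pos hp]
      linarith [absNorm_rpow_nonneg p.asIdeal 2]
    · have hp' : 2 * x ∉ p.asIdeal := fun h => hp ((Set.Finite.mem_toFinset _).mpr h)
      simp only [c, if_neg hp, add_zero]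
      exact abs_sum_primesAbove_sub_le hF σ hθ hσ p
        (fun h => hp' (p.asIdeal.mul_mem_right _ h)) (fun h => hp' (p.asIdeal.mul_mem_left _ h)) hs
  have h2 : (fun s => primeZeta F s - (primeZeta K s + ∑' p : HeightOneSpectrum (𝓞 K),
      (residueSymbol p x : ℝ) * (Ideal.absNorm p.asIdeal : ℝ) ^ (-s))) =O[𝓝[>] 1]
      (fun _ => (1 : ℝ)) := by
    refine IsBigO.of_bound (∑' p, c p) ?_
    filter_upwards [self_mem_nhdsWithin] with s hs
    rw [← (hD s hs).tsum_eq, norm_one, mul_one]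
    exact tsum_of_norm_bounded hc.hasSum (hDc s hs)
  refine (h1.sub h2).congr_left fun s => ?_
  ring

end quadratic

open Filter Topology Asymptotics in
lemma residueSymbol_isBigO {K : Type*} [Field K] [NumberField K] {x : 𝓞 K}
    (hx : ¬ IsSquare (x : K)) :
    (fun s : ℝ => ∑' p : HeightOneSpectrum (𝓞 K),
      (residueSymbol p x : ℝ) * (Ideal.absNorm p.asIdeal : ℝ) ^ (-s)) =O[𝓝[>] 1]
      (fun _ => (1 : ℝ)) := by
  have hx0 : x ≠ 0 := by
    rintro rfl
    exact hx (by simp)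
  let f : Polynomial K := Polynomial.X ^ 2 - Polynomial.C (x : K)
  have hf : Irreducible f := by
    refine X_pow_sub_C_irreducible_of_prime Nat.prime_two fun b hb => hx ⟨b, ?_⟩
    rw [← hb, pow_two]
  have hf0 : f.Monic := Polynomial.monic_X_pow_sub_C _ two_ne_zero
  have := Fact.mk hf
  have := hf0.finite_adjoinRoot
  have : NumberField (AdjoinRoot f) := NumberField.of_module_finite K (AdjoinRoot f)
  have hroot : AdjoinRoot.root f ^ 2 = algebraMap K (AdjoinRoot f) x := by
    have := AdjoinRoot.eval₂_root f
    simpa [f, sub_eq_zero] using this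
  have hF : Module.finrank K (AdjoinRoot f) = 2 := by
    rw [(AdjoinRoot.powerBasis' hf0).finrank, AdjoinRoot.powerBasis'_dim]
    exact Polynomial.natDegree_X_pow_sub_C
  have hroot' : f.eval₂ (Algebra.ofId K (AdjoinRoot f)) (-AdjoinRoot.root f) = 0 := by
    simp [f, hroot]
  let φ : AdjoinRoot f →ₐ[K] AdjoinRoot f :=
    AdjoinRoot.liftAlgHom f (Algebra.ofId _ _) (-AdjoinRoot.root f) hroot'
  let σ : AdjoinRoot f ≃ₐ[K] AdjoinRoot f :=
    AlgEquiv.ofBijective φ (Algebra.IsAlgebraic.algHom_bijective φ)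
  have hintegral : IsIntegral ℤ (AdjoinRoot.root f) := by
    refine IsIntegral.of_pow two_pos ?_
    rw [hroot]
    exact (RingOfIntegers.isIntegral_coe x).algebraMap
  let θ : 𝓞 (AdjoinRoot f) := ⟨AdjoinRoot.root f, hintegral⟩
  refine residueSymbol_isBigO_of_quadratic hF σ hx0 (θ := θ) (RingOfIntegers.ext ?_) ?_
  · exact hroot
  · exact AdjoinRoot.liftAlgHom_root f _ _ hroot'

end NumberField

namespace NumberField

lemma prime_absNorm_of_rat (q : HeightOneSpectrum (𝓞 ℚ)) : (Ideal.absNorm q.asIdeal).Prime := by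
  have : IsPrincipalIdealRing (𝓞 ℚ) :=
    IsPrincipalIdealRing.of_surjective Rat.ringOfIntegersEquiv.symm.toRingHom
      Rat.ringOfIntegersEquiv.symm.surjective
  obtain ⟨x, hx⟩ := (IsPrincipalIdealRing.principal q.asIdeal).principal
  change q.asIdeal = Ideal.span {x} at hx
  have hx0 : x ≠ 0 := by
    rintro rfl
    exact q.ne_bot (by simpa using hx)
  have hprime : Prime x := (Ideal.span_singleton_prime hx0).mp (hx ▸ q.isPrime)
  obtain ⟨n, rfl⟩ := Rat.ringOfIntegersEquiv.symm.surjective x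
  have hn : Prime n := (MulEquiv.prime_iff Rat.ringOfIntegersEquiv.symm.toMulEquiv).mp hprime
  have hnorm : Algebra.norm ℤ (Rat.ringOfIntegersEquiv.symm n) = n := by
    have : Rat.ringOfIntegersEquiv.symm n = algebraMap ℤ (𝓞 ℚ) n := by simp
    rw [this, Algebra.norm_algebraMap, RingOfIntegers.rank, Module.finrank_self, pow_one]
  rw [hx, Ideal.absNorm_span_singleton, hnorm]
  exact Int.prime_iff_natAbs_prime.mp hn

variable {K : Type*} [Field K] [NumberField K]

open Classical in
variable (K) in
lemma summable_absNorm_not_prime : Summable fun p : HeightOneSpectrum (𝓞 K) =>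
    if (Ideal.absNorm p.asIdeal).Prime then 0 else (Ideal.absNorm p.asIdeal : ℝ)⁻¹ := by
  have hg := (summable_prime_absNorm_rpow ℚ one_lt_two).mul_left (Module.finrank ℚ K : ℝ)
  have hle : ∀ p : HeightOneSpectrum (𝓞 K),
      (if (Ideal.absNorm p.asIdeal).Prime then 0 else (Ideal.absNorm p.asIdeal : ℝ)⁻¹) ≤
        (Ideal.absNorm (p.under (𝓞 ℚ)).asIdeal : ℝ) ^ (-2 : ℝ) := by
    intro p
    have hp : p ∈ primesAbove K (p.under (𝓞 ℚ)) := mem_primesAbove.mpr rfl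
    split_ifs with h
    · exact absNorm_rpow_nonneg _ _
    · have hq := prime_absNorm_of_rat (p.under (𝓞 ℚ))
      have h0 := inertiaDeg_ne_zero_of_mem_primesAbove hp
      rw [absNorm_of_mem_primesAbove hp] at h ⊢
      set f := Ideal.inertiaDeg' (p.under (𝓞 ℚ)).asIdeal p.asIdeal
      have h1 : f ≠ 1 := fun h1 => h (by rwa [h1, pow_one])
      rw [Real.rpow_neg (Nat.cast_nonneg _), Nat.cast_pow, Real.rpow_two]
      have h1' : (1 : ℝ) ≤ Ideal.absNorm (p.under (𝓞 ℚ)).asIdeal := by exact_mod_cast hq.one_le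
      exact inv_anti₀ (by positivity) (pow_le_pow_right₀ h1' (by omega))
  refine summable_of_sum_le (c := ∑' q : HeightOneSpectrum (𝓞 ℚ),
    (Module.finrank ℚ K : ℝ) * (Ideal.absNorm q.asIdeal : ℝ) ^ (-2 : ℝ))
    (fun p => by positivity) fun P => ?_
  calc _ ≤ ∑ p ∈ P, (Ideal.absNorm (p.under (𝓞 ℚ)).asIdeal : ℝ) ^ (-2 : ℝ) :=
        Finset.sum_le_sum fun p _ => hle p
    _ = ∑ q ∈ P.image (HeightOneSpectrum.under (𝓞 ℚ)),
        ∑ p ∈ P with p.under (𝓞 ℚ) = q, (Ideal.absNorm (p.under (𝓞 ℚ)).asIdeal : ℝ) ^ (-2 : ℝ) :=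
        (Finset.sum_fiberwise_of_maps_to (fun p hp => Finset.mem_image_of_mem _ hp) _).symm
    _ ≤ ∑ q ∈ P.image (HeightOneSpectrum.under (𝓞 ℚ)),
        (Module.finrank ℚ K : ℝ) * (Ideal.absNorm q.asIdeal : ℝ) ^ (-2 : ℝ) := by
        refine Finset.sum_le_sum fun q _ => ?_
        refine (Finset.sum_le_card_nsmul _ _ ((Ideal.absNorm q.asIdeal : ℝ) ^ (-2 : ℝ))
          fun p hp => ?_).trans ?_
        · rw [(Finset.mem_filter.mp hp).2]
        · rw [nsmul_eq_mul]
          refine mul_le_mul_of_nonneg_right ?_ (absNorm_rpow_nonneg _ _)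
          have := (Finset.card_le_card (s := P.filter fun p => p.under (𝓞 ℚ) = q)
            (t := primesAbove K q) fun p hp => mem_primesAbove.mpr
              (Finset.mem_filter.mp hp).2).trans (card_primesAbove_le K q)
          exact_mod_cast this
    _ ≤ _ := hg.sum_le_tsum _ fun q _ => mul_nonneg (Nat.cast_nonneg _) (absNorm_rpow_nonneg _ _)

lemma finite_setOf_absNorm_le (B : ℕ) :
    {p : HeightOneSpectrum (𝓞 K) | Ideal.absNorm p.asIdeal ≤ B}.Finite := by
  refine Set.Finite.of_finite_image (f := HeightOneSpectrum.asIdeal)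
    ((Ideal.finite_setOfPred_absNorm_le B).subset ?_) fun _ _ _ _ h => HeightOneSpectrum.ext h
  rintro _ ⟨p, hp, rfl⟩
  exact hp

open Filter Topology Asymptotics in
/-- There are arbitrarily large primes of prime norm with prescribed compatible residue symbols. -/
theorem exists_prime_absNorm_residueSymbol_eq {ι : Type*} [Fintype ι] (x : ι → 𝓞 K)
    (hx : ∀ i, x i ≠ 0) (ε : ι → ℤ) (hε : ∀ i, ε i = 1 ∨ ε i = -1)
    (hA : ∀ A : Finset ι, IsSquare (algebraMap (𝓞 K) K (∏ i ∈ A, x i)) → ∏ i ∈ A, ε i = 1)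
    (B : ℕ) : ∃ p : HeightOneSpectrum (𝓞 K), (Ideal.absNorm p.asIdeal).Prime ∧
      B < Ideal.absNorm p.asIdeal ∧ ∀ i, residueSymbol p (x i) = ε i := by
  classical
  by_contra! hcon
  let bad : Finset (HeightOneSpectrum (𝓞 K)) := (finite_setOf_absNorm_le B).toFinset ∪
    Finset.univ.biUnion fun i => (finite_setOf_mem (hx i)).toFinset
  let g : HeightOneSpectrum (𝓞 K) → ℝ := fun p =>
    2 ^ Fintype.card ι * ((if (Ideal.absNorm p.asIdeal).Prime then 0 else
      (Ideal.absNorm p.asIdeal : ℝ)⁻¹) + if p ∈ bad then 1 else 0)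
  have hg : Summable g := ((summable_absNorm_not_prime K).add
    (summable_of_ne_finset_zero (s := bad) fun p hp => if_neg hp)).mul_left _
  let c : HeightOneSpectrum (𝓞 K) → ℝ := fun p => ∏ i, (1 + (ε i : ℝ) * residueSymbol p (x i))
  have hfac : ∀ p i, 0 ≤ 1 + (ε i : ℝ) * residueSymbol p (x i) ∧
      1 + (ε i : ℝ) * residueSymbol p (x i) ≤ 2 := by
    intro p i
    have := abs_le.mp (abs_residueSymbol_le p (x i))
    rcases hε i with h | h <;> rw [h] <;> push_cast <;> constructor <;> linarith
  have hc0 : ∀ p, 0 ≤ c p := fun p => Finset.prod_nonneg fun i _ => (hfac p i).1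
  have hc2 : ∀ p, c p ≤ 2 ^ Fintype.card ι := fun p =>
    (Finset.prod_le_prod (fun i _ => (hfac p i).1) fun i _ => (hfac p i).2).trans_eq (by simp)
  have hcg : ∀ s : ℝ, 1 < s → ∀ p, c p * (Ideal.absNorm p.asIdeal : ℝ) ^ (-s) ≤ g p := by
    intro s hs p
    have hN1 := (absNorm_rpow_le_half p hs.le).trans (by norm_num : (1 / 2 : ℝ) ≤ 1)
    have hN0 := absNorm_rpow_nonneg p.asIdeal s
    by_cases hp : p ∈ bad
    · refine mul_le_mul (hc2 p) ?_ hN0 (by positivity)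
      rw [if_pos hp]
      have : (0 : ℝ) ≤ if (Ideal.absNorm p.asIdeal).Prime then 0 else
        (Ideal.absNorm p.asIdeal : ℝ)⁻¹ := by positivity
      linarith
    · by_cases hprime : (Ideal.absNorm p.asIdeal).Prime
      · have hB : B < Ideal.absNorm p.asIdeal := by
          by_contra! h
          exact hp (Finset.mem_union_left _ ((Set.Finite.mem_toFinset _).mpr h))
        obtain ⟨i, hi⟩ := hcon p hprime hB
        have hmem : x i ∉ p.asIdeal := fun h => hp (Finset.mem_union_right _
          (Finset.mem_biUnion.mpr ⟨i, Finset.mem_univ i, (Set.Finite.mem_toFinset _).mpr h⟩))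
        have : c p = 0 := by
          refine Finset.prod_eq_zero (Finset.mem_univ i) ?_
          rcases hε i with h | h <;> rcases residueSymbol_eq_one_or_neg_one hmem with h' | h' <;>
            rw [h, h'] at hi ⊢ <;> simp at hi ⊢
        rw [this, zero_mul]
        positivity
      · refine mul_le_mul (hc2 p) ?_ hN0 (by positivity)
        rw [if_neg hprime, if_neg hp, add_zero, ← Real.rpow_neg_one]
        exact Real.rpow_le_rpow_of_exponent_le (by exact_mod_cast (two_le_absNorm p).trans' one_le_two)
          (by linarith)
  let L : Finset ι → ℝ → ℝ := fun A s => ∑' p : HeightOneSpectrum (𝓞 K),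
    (residueSymbol p (∏ i ∈ A, x i) : ℝ) * (Ideal.absNorm p.asIdeal : ℝ) ^ (-s)
  have hexpand : ∀ s : ℝ, 1 < s → HasSum (fun p => c p * (Ideal.absNorm p.asIdeal : ℝ) ^ (-s))
      (∑ A : Finset ι, (∏ i ∈ A, (ε i : ℝ)) * L A s) := by
    intro s hs
    refine Eq.mp (congrArg (HasSum · _) (funext fun p => ?_)) (hasSum_sum (s := Finset.univ)
      fun (A : Finset ι) _ => (summable_residueSymbol K (∏ i ∈ A, x i) hs).hasSum.mul_left
        (∏ i ∈ A, (ε i : ℝ)))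
    simp only [c]
    rw [Finset.prod_one_add, Finset.powerset_univ, Finset.sum_mul]
    refine Finset.sum_congr rfl fun A _ => ?_
    rw [residueSymbol_prod, Finset.prod_mul_distrib]
    push_cast
    ring
  let Sq : Finset ι → Prop := fun A => IsSquare (algebraMap (𝓞 K) K (∏ i ∈ A, x i))
  have hnonsq : (fun s => ∑ A : Finset ι with ¬ Sq A, (∏ i ∈ A, (ε i : ℝ)) * L A s) =O[𝓝[>] 1]
      (fun _ => (1 : ℝ)) := IsBigO.fun_sum fun A hA' =>
    (residueSymbol_isBigO (Finset.mem_filter.mp hA').2).const_mul_left _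
  have hsq : ∀ s : ℝ, 1 < s → primeZeta K s ≤
      ∑ A : Finset ι with Sq A, (∏ i ∈ A, (ε i : ℝ)) * L A s := by
    intro s hs
    have hnn : ∀ A ∈ Finset.univ.filter Sq, 0 ≤ (∏ i ∈ A, (ε i : ℝ)) * L A s := by
      intro A hA'
      have h1 : ∏ i ∈ A, (ε i : ℝ) = 1 := by exact_mod_cast hA A (Finset.mem_filter.mp hA').2
      rw [h1, one_mul]
      refine tsum_nonneg fun p => mul_nonneg ?_ (absNorm_rpow_nonneg _ _)
      obtain ⟨y, hy⟩ := (Finset.mem_filter.mp hA').2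
      have hintegral : IsIntegral ℤ y := by
        refine IsIntegral.of_pow two_pos ?_
        rw [pow_two, ← hy]
        exact RingOfIntegers.isIntegral_coe _
      obtain ⟨z, rfl⟩ : ∃ z : 𝓞 K, algebraMap (𝓞 K) K z = y := ⟨⟨y, hintegral⟩, rfl⟩
      have : ∏ i ∈ A, x i = z * z := by
        refine FaithfulSMul.algebraMap_injective (𝓞 K) K ?_
        rw [hy, map_mul]
      rw [this, residueSymbol_mul]
      exact_mod_cast mul_self_nonneg _
    refine le_trans ?_ (Finset.single_le_sum hnn (a := ∅) (by simp [Sq]))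
    simp [L, residueSymbol_one, primeZeta]
  have hbdd : (fun s => primeZeta K s) =O[𝓝[>] 1] (fun _ => (1 : ℝ)) := by
    have h1 := (isBigO_const_const (∑' p, g p) (one_ne_zero (α := ℝ)) (𝓝[>] (1 : ℝ))).add
      hnonsq.norm_left
    refine IsBigO.trans (IsBigO.of_bound 1 ?_) h1
    filter_upwards [self_mem_nhdsWithin] with s hs
    have h2 := hsq s hs
    have h3 := hasSum_le (hcg s hs) (hexpand s hs) hg.hasSum
    have h4 := Finset.sum_filter_add_sum_filter_not Finset.univ Sq
      fun A => (∏ i ∈ A, (ε i : ℝ)) * L A s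
    have h5 := neg_abs_le (∑ A : Finset ι with ¬ Sq A, (∏ i ∈ A, (ε i : ℝ)) * L A s)
    have h6 : 0 ≤ primeZeta K s := tsum_nonneg fun p => absNorm_rpow_nonneg _ _
    rw [one_mul, Real.norm_of_nonneg h6]
    refine le_trans ?_ (Real.le_norm_self _)
    rw [Real.norm_eq_abs]
    linarith
  have hlog : (fun s => Real.log (s - 1)) =O[𝓝[>] 1] (fun _ => (1 : ℝ)) :=
    ((primeZeta_add_log_isBigO K).sub hbdd).congr_left fun s => by ring
  have hlim : Tendsto (fun s : ℝ => Real.log (s - 1)) (𝓝[>] 1) atBot := by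
    refine Real.tendsto_log_nhdsGT_zero.comp (tendsto_nhdsWithin_iff.mpr ⟨?_, ?_⟩)
    · exact ((continuous_id.sub continuous_const).tendsto' 1 0 (by simp)).mono_left
        nhdsWithin_le_nhds
    · filter_upwards [self_mem_nhdsWithin] with s hs
      exact sub_pos.mpr (Set.mem_Ioi.mp hs)
  obtain ⟨C, hC⟩ := hlog.bound
  obtain ⟨s, hs1, hs2⟩ : ∃ s : ℝ, ‖Real.log (s - 1)‖ ≤ C * ‖(1 : ℝ)‖ ∧ Real.log (s - 1) < -C := (hC.and (hlim.eventually_lt_atBot (-C))).exists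
  rw [norm_one, mul_one, Real.norm_eq_abs] at hs1
  linarith [neg_abs_le (Real.log (s - 1))]

end NumberField

namespace NumberField

section LocalSquares

open HeightOneSpectrum Filter Topology WithZero

variable {k : Type*} [Field k] [NumberField k] (v : HeightOneSpectrum (𝓞 k))

lemma exists_add_sq_eq {F : Type*} [Field F] [Valued F ℤᵐ⁰] [CompleteSpace F] [T2Space F]
    {w : F} (hw : Valued.v w < 1) : ∃ y : F, y + y ^ 2 = w := by
  set u : ℕ → F := fun n => Nat.rec 0 (fun _ y => w - y ^ 2) n with hu
  have u0 : u 0 = 0 := rfl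
  have us : ∀ n, u (n + 1) = w - u n ^ 2 := fun n => rfl
  have hle : ∀ n, Valued.v (u n) ≤ Valued.v w := by
    intro n
    induction n with
    | zero => rw [u0, map_zero]; exact zero_le
    | succ n ih =>
      rw [us]
      refine (Valued.v.map_sub _ _).trans (max_le le_rfl ?_)
      rw [map_pow, pow_two]
      exact (mul_le_of_le_one_left' (ih.trans hw.le)).trans ih
  have hstep : ∀ n, Valued.v (u (n + 1) - u n) ≤ Valued.v w ^ (n + 1) := by
    intro n
    induction n with
    | zero => rw [us, u0]; simp
    | succ n ih =>
      rw [us (n + 1), us n, show w - (w - u n ^ 2) ^ 2 - (w - u n ^ 2) =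
        -((u (n + 1) - u n) * (u (n + 1) + u n)) by rw [us]; ring, Valuation.map_neg, map_mul,
        pow_succ]
      exact mul_le_mul' ih ((Valued.v.map_add _ _).trans (max_le (hle (n + 1)) (hle n)))
  have hdist : ∀ n m, n ≤ m → Valued.v (u m - u n) ≤ Valued.v w ^ (n + 1) := by
    intro n m hnm
    induction m, hnm using Nat.le_induction with
    | base => simp
    | succ m hm ih =>
      rw [show u (m + 1) - u n = (u (m + 1) - u m) + (u m - u n) by ring]
      refine (Valued.v.map_add _ _).trans (max_le ((hstep m).trans ?_) ih)
      exact pow_le_pow_right_of_le_one' hw.le (by omega)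
  have hc : CauchySeq u := by
    rw [CauchySeq, Valued.cauchy_iff]
    refine ⟨inferInstance, fun γ => ?_⟩
    obtain ⟨n, hn⟩ : ∃ n, Valued.v w ^ (n + 1) <
        MonoidWithZeroHom.ValueGroup₀.embedding γ.1 := by
      have hγ : (0 : ℤᵐ⁰) < MonoidWithZeroHom.ValueGroup₀.embedding γ.1 := by
        rw [zero_lt_iff, ne_eq, map_eq_zero]
        exact γ.ne_zero
      obtain ⟨n, hn⟩ := exists_pow_lt₀ hw (Units.mk0 _ hγ.ne')
      rw [Units.val_mk0] at hn
      exact ⟨n, (pow_le_pow_right_of_le_one' hw.le (Nat.le_succ n)).trans_lt hn⟩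
    refine ⟨u '' Set.Ici n, image_mem_map (mem_atTop n), ?_⟩
    rintro _ ⟨m, hm, rfl⟩ _ ⟨m', hm', rfl⟩
    rw [Valuation.restrict_lt_iff_lt_embedding]
    refine lt_of_le_of_lt ?_ hn
    rw [show u m' - u m = (u m' - u n) - (u m - u n) by ring]
    exact (Valued.v.map_sub _ _).trans (max_le (hdist _ _ hm') (hdist _ _ hm))
  obtain ⟨y, hy⟩ := cauchySeq_tendsto_of_complete hc
  refine ⟨y, ?_⟩
  have h1 : Tendsto (fun n => u (n + 1)) atTop (𝓝 y) := hy.comp (tendsto_add_atTop_nat 1)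
  have h2 : Tendsto (fun n => u (n + 1)) atTop (𝓝 (w - y ^ 2)) := by
    simp only [us]
    exact tendsto_const_nhds.sub (hy.pow 2)
  rw [tendsto_nhds_unique h1 h2]
  have := tendsto_nhds_unique h1 h2
  rw [← this]
  nth_rewrite 1 [this]
  ring

lemma exists_sq_eq_of_valued_sub_one_lt {z : v.adicCompletion k}
    (hz : Valued.v (z - 1) < Valued.v (4 : v.adicCompletion k)) :
    ∃ y : v.adicCompletion k, y ^ 2 = z := by
  have h4 : (4 : v.adicCompletion k) ≠ 0 := by
    intro h
    rw [h, map_zero] at hz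
    exact not_lt_zero hz
  obtain ⟨y, hy⟩ := exists_add_sq_eq (w := (z - 1) / 4) (by
    rw [map_div₀, div_lt_one₀]
    · exact hz
    · exact zero_lt_iff.mpr ((Valuation.ne_zero_iff _).mpr h4))
  refine ⟨1 + 2 * y, ?_⟩
  rw [eq_div_iff h4] at hy
  linear_combination hy

/-- The nonzero elements of `k` that become squares in the completion at `v`. -/
def localSquares : Set k :=
  {t | t ≠ 0 ∧ ∃ a : v.adicCompletion k, a ≠ 0 ∧ a ^ 2 = algebraMap k (v.adicCompletion k) t}

variable {v}

lemma mem_localSquares_of_valuation_lt {t : k}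
    (ht : v.valuation k (t - 1) < v.valuation k 4) : t ∈ localSquares v := by
  have ht0 : t ≠ 0 := by
    rintro rfl
    rw [zero_sub, Valuation.map_neg, map_one] at ht
    have : v.valuation k (algebraMap (𝓞 k) k 4) ≤ 1 := v.valuation_le_one _
    rw [map_ofNat] at this
    exact absurd ht this.not_gt
  obtain ⟨y, hy⟩ := exists_sq_eq_of_valued_sub_one_lt v
    (z := algebraMap k (v.adicCompletion k) t) (by
      rw [← valuedAdicCompletion_eq_valuation', ← valuedAdicCompletion_eq_valuation'] at ht
      rw [← map_one (algebraMap k (v.adicCompletion k)), ← map_sub,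
        ← map_ofNat (algebraMap k (v.adicCompletion k)) 4]
      exact ht)
  refine ⟨ht0, y, ?_, hy⟩
  rintro rfl
  rw [zero_pow two_ne_zero, eq_comm, map_eq_zero] at hy
  exact ht0 hy

lemma sq_mem_localSquares {y : k} (hy : y ≠ 0) : y ^ 2 ∈ localSquares v :=
  ⟨pow_ne_zero 2 hy, algebraMap k _ y, (map_ne_zero _).mpr hy, by rw [map_pow]⟩

lemma mul_mem_localSquares {s t : k} (hs : s ∈ localSquares v) (ht : t ∈ localSquares v) :
    s * t ∈ localSquares v := by
  obtain ⟨hs, a, ha, ea⟩ := hs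
  obtain ⟨ht, b, hb, eb⟩ := ht
  exact ⟨mul_ne_zero hs ht, a * b, mul_ne_zero ha hb, by rw [mul_pow, map_mul, ea, eb]⟩

lemma inv_mem_localSquares {s : k} (hs : s ∈ localSquares v) : s⁻¹ ∈ localSquares v := by
  obtain ⟨hs, a, ha, ea⟩ := hs
  exact ⟨inv_ne_zero hs, a⁻¹, inv_ne_zero ha, by rw [inv_pow, map_inv₀, ea]⟩

lemma exists_valuation_div_sq_sub_one_lt {t κ : k} (ht : t ∈ localSquares v) (hκ : κ ≠ 0) :
    ∃ y, y ≠ 0 ∧ v.valuation k (t / y ^ 2 - 1) < v.valuation k κ := by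
  obtain ⟨ht, a, ha, ea⟩ := ht
  set f := algebraMap k (v.adicCompletion k) with hf
  have hvf : ∀ x : k, Valued.v (f x) = v.valuation k x := valuedAdicCompletion_eq_valuation' v
  have hcont : ContinuousAt (fun y : v.adicCompletion k => f t / y ^ 2 - 1) a :=
    (continuousAt_const.div (continuousAt_id.pow 2) (pow_ne_zero 2 ha)).sub continuousAt_const
  have h0 : f t / a ^ 2 - 1 = 0 := by
    rw [← ea, div_self (pow_ne_zero 2 ha), sub_self]
  have hnhd : {x : v.adicCompletion k | Valued.v x < v.valuation k κ} ∈ 𝓝 (f t / a ^ 2 - 1) := by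
    rw [h0, Valued.mem_nhds_zero]
    have hk : (Valued.v : Valuation (v.adicCompletion k) ℤᵐ⁰).restrict (f κ) ≠ 0 :=
      (Valuation.ne_zero_iff _).mpr ((map_ne_zero f).mpr hκ)
    refine ⟨Units.mk0 _ hk, fun x hx => ?_⟩
    rw [Set.mem_ofPred_eq, Units.val_mk0, Valuation.restrict_lt_iff, hvf] at hx
    exact hx
  have hU : {y : v.adicCompletion k | Valued.v (f t / y ^ 2 - 1) < v.valuation k κ ∧ y ≠ 0} ∈
      𝓝 a := inter_mem (hcont hnhd) (isOpen_ne.mem_nhds ha)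
  obtain ⟨_, ⟨y, rfl⟩, hy, hy0⟩ := (denseRange_algebraMap (v := v) (K := k)).inter_nhds_nonempty hU
  refine ⟨y, fun h => hy0 (by simp [h]), ?_⟩
  rw [← hvf]
  simpa using hy

end LocalSquares

section Reduction

open HeightOneSpectrum WithZero

variable {k : Type*} [Field k] [NumberField k] {v : HeightOneSpectrum (𝓞 k)}

lemma exists_fin_generators (I : Ideal (𝓞 k)) :
    ∃ (n : ℕ) (f : Fin n → 𝓞 k), ∀ x, x ∈ I ↔ ∃ m : Fin n → ℤ, ∑ i, (m i : 𝓞 k) * f i = x := by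
  have hfg : (I.restrictScalars ℤ).FG := IsNoetherian.noetherian _
  obtain ⟨n, f, hf⟩ := Submodule.fg_iff_exists_fin_generating_family.mp hfg
  refine ⟨n, f, fun x => ?_⟩
  rw [← Submodule.restrictScalars_mem ℤ, ← hf, Submodule.mem_span_range_iff_exists_fun]
  simp [zsmul_eq_mul]

lemma exists_valuation_le_exp (c : k) (κ : k) (hκ : κ ≠ 0) :
    ∃ J : ℕ, (exp (-(J : ℤ)) : ℤᵐ⁰) * v.valuation k c < v.valuation k κ := by
  by_cases hc : c = 0
  · exact ⟨0, by simpa [hc] using zero_lt_iff.mpr ((Valuation.ne_zero_iff _).mpr hκ)⟩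
  have hc' := (Valuation.ne_zero_iff (v.valuation k)).mpr hc
  have hκ' := (Valuation.ne_zero_iff (v.valuation k)).mpr hκ
  refine ⟨(log (v.valuation k c) - log (v.valuation k κ) + 1).toNat, ?_⟩
  rw [← exp_log hc', ← exp_log hκ', ← exp_add, exp_lt_exp]
  simp only [log_exp]
  have := Int.self_le_toNat (log (v.valuation k c) - log (v.valuation k κ) + 1)
  omega

lemma exists_mem_pow_mul_eq {x : k} (hx : v.valuation k x ≤ 1) (J : ℕ) :
    ∃ a b : 𝓞 k, b ∈ v.asIdeal ^ J ∧ x * (1 + algebraMap (𝓞 k) k b) = algebraMap (𝓞 k) k a := by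
  obtain ⟨a, d, e⟩ := exists_primeCompl_mul_eq_of_integer v x hx
  have hsup : Ideal.span {d.1} ⊔ v.asIdeal = ⊤ := by
    refine v.isMaximal.1.2 _ (lt_of_le_of_ne le_sup_right fun h => d.2 ?_)
    refine h.ge ?_
    exact Ideal.mem_sup_left (Ideal.mem_span_singleton_self _)
  have h1 : (1 : 𝓞 k) ∈ Ideal.span {d.1} ⊔ v.asIdeal ^ J := by
    rw [Ideal.sup_pow_eq_top hsup]
    trivial
  obtain ⟨_, hd', b, hb, hs⟩ := Submodule.mem_sup.mp h1
  obtain ⟨d', rfl⟩ := Ideal.mem_span_singleton'.mp hd'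
  refine ⟨a * d', -b, neg_mem hb, ?_⟩
  rw [map_neg, ← sub_eq_add_neg, ← map_one (algebraMap (𝓞 k) k), ← hs, map_add, add_sub_cancel_right,
    map_mul, map_mul, ← e]
  ring

lemma isExistentialPoly_localSquares {D : Set k}
    (hD : IsExistentialPoly (fun a : Fin 1 → k => a 0 ∈ D)) (hZ : ∀ n : ℤ, (n : k) ∈ D)
    {c : k} (hbd : ∀ j ∈ D, v.valuation k j ≤ v.valuation k c) :
    IsExistentialPoly (fun a : Fin 1 → k => a 0 ∈ localSquares v) := by
  classical
  set f := algebraMap (𝓞 k) k with hf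
  obtain ⟨J, hJ⟩ := exists_valuation_le_exp (v := v) c 1 one_ne_zero
  obtain ⟨L, hL⟩ := exists_valuation_le_exp (v := v) c 4 (by norm_num)
  rw [map_one] at hJ
  obtain ⟨r, ω, hω⟩ := exists_fin_generators (⊤ : Ideal (𝓞 k))
  obtain ⟨s, ϖ, hϖ⟩ := exists_fin_generators (v.asIdeal ^ J)
  have hϖv : ∀ i, v.valuation k (f (ϖ i)) ≤ exp (-(J : ℤ)) := by
    intro i
    rw [hf, valuation_of_algebraMap, intValuation_le_pow_iff_mem, hϖ]
    exact ⟨Pi.single i 1, by simp [Pi.single_apply]⟩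
  obtain ⟨κ, hκv, hκ⟩ : ∃ κ : k, v.valuation k κ = exp (-(L : ℤ)) ∧ κ ≠ 0 := by
    obtain ⟨π, hπ⟩ := v.valuation_exists_uniformizer k
    refine ⟨π ^ L, ?_, ?_⟩
    · rw [map_pow, hπ, ← exp_nsmul]; simp
    · refine pow_ne_zero _ ?_
      rintro rfl
      rw [map_zero] at hπ
      exact exp_ne_zero hπ.symm
  let Q : k → k → (Fin r → k) → (Fin s → k) → k → Prop := fun y x m n t =>
    y ≠ 0 ∧ (∀ i, m i ∈ D) ∧ (∀ i, n i ∈ D) ∧ t = y ^ 2 * (1 + κ * x) ∧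
      x * (1 + ∑ i, n i * f (ϖ i)) = ∑ i, m i * f (ω i)
  have hQ : ∀ t, t ∈ localSquares v ↔ ∃ y x m n, Q y x m n t := by
    intro t
    constructor
    · intro ht
      obtain ⟨y, hy, hlt⟩ := exists_valuation_div_sq_sub_one_lt ht hκ
      obtain ⟨a, b, hb, e⟩ := exists_mem_pow_mul_eq (v := v) (x := (t / y ^ 2 - 1) / κ) (by
        rw [map_div₀, div_le_one₀]
        · exact hlt.le
        · exact zero_lt_iff.mpr ((Valuation.ne_zero_iff _).mpr hκ)) J
      obtain ⟨n, hn⟩ := (hϖ b).mp hb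
      obtain ⟨m, hm⟩ := (hω a).mp trivial
      refine ⟨y, (t / y ^ 2 - 1) / κ, fun i => m i, fun i => n i, hy, fun i => hZ _, fun i => hZ _, ?_, ?_⟩
      rotate_left
      · rw [← hm, ← hn] at e
        simpa using e
      · field_simp
        ring
    · rintro ⟨y, x, m, n, hy, hm, hn, rfl, e⟩
      refine mul_mem_localSquares (sq_mem_localSquares hy) (mem_localSquares_of_valuation_lt ?_)
      have h1 : v.valuation k (∑ i, n i * f (ϖ i)) < 1 := by
        refine Valuation.map_sum_lt _ one_ne_zero fun i _ => ?_
        rw [map_mul, mul_comm]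
        exact (mul_le_mul' (hϖv i) (hbd _ (hn i))).trans_lt hJ
      have h2 : v.valuation k (∑ i, m i * f (ω i)) ≤ v.valuation k c := by
        refine Valuation.map_sum_le _ fun i _ => ?_
        rw [map_mul]
        exact (mul_le_of_le_one_right' (v.valuation_le_one _)).trans (hbd _ (hm i))
      rw [← e, map_mul, Valuation.map_one_add_of_lt _ h1, mul_one] at h2
      rw [add_sub_cancel_left, map_mul, hκv]
      exact (mul_le_mul_right h2 _).trans_lt hL
  let τ := (Unit ⊕ Unit) ⊕ (Fin r ⊕ Fin s)
  let X' : Fin 1 ⊕ τ → MvPolynomial (Fin 1 ⊕ τ) k := MvPolynomial.X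
  let py := X' (Sum.inr (Sum.inl (Sum.inl ())))
  let px := X' (Sum.inr (Sum.inl (Sum.inr ())))
  let pm := fun i => X' (Sum.inr (Sum.inr (Sum.inl i)))
  let pn := fun i => X' (Sum.inr (Sum.inr (Sum.inr i)))
  have hE := (IsExistentialPoly.ne_zero py).and
    ((IsExistentialPoly.finite_and (Set.finite_univ (α := Fin r))
      (fun i _ => hD.comap (fun _ => pm i))).and
    ((IsExistentialPoly.finite_and (Set.finite_univ (α := Fin s))
      (fun i _ => hD.comap (fun _ => pn i))).and
    ((IsExistentialPoly.eq_zero (X' (Sum.inl 0) - py ^ 2 * (1 + MvPolynomial.C κ * px))).and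
    (IsExistentialPoly.eq_zero (px * (1 + ∑ i, pn i * MvPolynomial.C (f (ϖ i))) -
      ∑ i, pm i * MvPolynomial.C (f (ω i)))))))
  refine hE.exists'.congr' fun a => ?_
  rw [hQ]
  simp only [py, px, pm, pn, X', map_sub, map_mul, map_add, map_sum, map_pow, map_one,
    MvPolynomial.eval_X, MvPolynomial.eval_C, Sum.elim_inl, Sum.elim_inr, sub_eq_zero,
    Set.mem_univ, true_imp_iff, Q]
  constructor
  · rintro ⟨y, x, m, n, h⟩
    exact ⟨Sum.elim (Sum.elim (fun _ => y) (fun _ => x)) (Sum.elim m n), h⟩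
  · rintro ⟨b, h⟩
    exact ⟨_, _, _, _, h⟩

variable (v) in
/-- The subgroup `localSquares v` has finite index. -/
lemma exists_finite_localSquares_reps :
    ∃ G : Set k, G.Finite ∧ (∀ g ∈ G, g ≠ 0) ∧ ∀ t, t ≠ 0 → ∃ g ∈ G, t * g⁻¹ ∈ localSquares v := by
  classical
  set f := algebraMap (𝓞 k) k with hf
  obtain ⟨L, hL⟩ := exists_valuation_le_exp (v := v) ((4 : k)⁻¹) 1 one_ne_zero
  have h4 : (0 : ℤᵐ⁰) < v.valuation k 4 := zero_lt_iff.mpr ((Valuation.ne_zero_iff _).mpr (by norm_num))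
  rw [map_one, map_inv₀, mul_inv_lt_iff₀ h4, one_mul] at hL
  let A : Set (𝓞 k) := {a | exp (-1 : ℤ) ≤ v.valuation k (f a)}
  let I := v.asIdeal ^ (L + 1)
  have : Finite (𝓞 k ⧸ I) := Ideal.finiteQuotientOfFreeOfNeBot I (pow_ne_zero _ v.ne_bot)
  let q : A → 𝓞 k ⧸ I := fun a => Ideal.Quotient.mk I a.1
  have hne : ∀ a ∈ A, f a ≠ 0 := by
    intro a ha h0
    simp only [A, Set.mem_ofPred_eq, h0, map_zero] at ha
    exact absurd ha (by simp)
  refine ⟨Set.range (fun z : Set.range q => f z.2.choose.1), Set.finite_range _, ?_, ?_⟩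
  · rintro _ ⟨z, rfl⟩
    exact hne _ z.2.choose.2
  · intro t ht
    obtain ⟨y, hy, a, ha, e⟩ : ∃ y, y ≠ 0 ∧ ∃ a ∈ A, f a = t * y ^ 2 := by
      obtain ⟨y, hy⟩ := v.valuation_surjective k (exp (-((log (v.valuation k t) + 1) / 2)))
      have hvt := (Valuation.ne_zero_iff (v.valuation k)).mpr ht
      have hy0 : y ≠ 0 := by rintro rfl; rw [map_zero] at hy; exact exp_ne_zero hy.symm
      have hval : v.valuation k (t * y ^ 2) = exp (log (v.valuation k t) -
          2 * ((log (v.valuation k t) + 1) / 2)) := by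
        rw [map_mul, map_pow, hy, ← exp_nsmul]
        nth_rewrite 1 [← exp_log hvt]
        rw [← exp_add]
        congr 1
        simp
        ring
      obtain ⟨a, s, e⟩ := exists_primeCompl_mul_eq_of_integer v (t * y ^ 2) (by
        rw [hval, ← exp_zero, exp_le_exp]
        omega)
      have hs1 : v.valuation k (f s) = 1 := v.valuation_eq_one_iff_notMem.mpr s.2
      have hs0 : f s ≠ 0 := by
        intro h; simp [h] at hs1
      have e' : f (s * a) = t * (f s * y) ^ 2 := by
        rw [map_mul, ← e]
        ring
      refine ⟨f s * y, mul_ne_zero hs0 hy0, s * a, ?_, e'⟩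
      rw [Set.mem_ofPred_eq, e', mul_pow, mul_left_comm, map_mul, map_pow, hs1, one_pow, one_mul,
        hval, exp_le_exp]
      omega
    have hz := (⟨q ⟨a, ha⟩, ⟨a, ha⟩, rfl⟩ : Set.range q).2.choose_spec
    set g := (⟨q ⟨a, ha⟩, ⟨a, ha⟩, rfl⟩ : Set.range q).2.choose with hg
    refine ⟨f g, ⟨_, rfl⟩, ?_⟩
    have hgv : exp (-1 : ℤ) ≤ v.valuation k (f g) := g.2
    have hg0 := hne _ g.2
    have hmem : a - g.1 ∈ I := Ideal.Quotient.eq.mp hz.symm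
    rw [← intValuation_le_pow_iff_mem, ← valuation_of_algebraMap (K := k)] at hmem
    have hS : f a / f g ∈ localSquares v := by
      refine mem_localSquares_of_valuation_lt ?_
      rw [div_sub_one hg0, ← map_sub, map_div₀]
      refine lt_of_le_of_lt ?_ hL
      rw [div_le_iff₀ (zero_lt_iff.mpr ((Valuation.ne_zero_iff _).mpr hg0))]
      refine hmem.trans (le_trans ?_ (mul_le_mul_right hgv _))
      rw [← exp_add, exp_le_exp]
      push_cast
      omega
    have := mul_mem_localSquares hS (inv_mem_localSquares (sq_mem_localSquares (v := v) hy))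
    rwa [e, div_eq_mul_inv, mul_right_comm, mul_inv_cancel_right₀ (pow_ne_zero 2 hy)] at this

/-- It suffices to find a diophantine set which contains the rational integers and is bounded
at `v`. -/
theorem isDiophantineSet_of_bounded {D : Set k}
    (hD : IsExistentialPoly (fun a : Fin 1 → k => a 0 ∈ D)) (hZ : ∀ n : ℤ, (n : k) ∈ D)
    {c : k} (hbd : ∀ j ∈ D, v.valuation k j ≤ v.valuation k c) :
    IsDiophantineSet k (localSquares v) ∧
      IsDiophantineSet k {t : k | t ≠ 0 ∧ t ∉ localSquares v} := by
  have h := isExistentialPoly_localSquares hD hZ hbd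
  refine ⟨h.isDiophantineSet, IsExistentialPoly.isDiophantineSet ?_⟩
  obtain ⟨G, hG, hG0, hrep⟩ := exists_finite_localSquares_reps v
  refine (IsExistentialPoly.finite_or (hG.subset (Set.sep_subset G (· ∉ localSquares v)))
    (fun g _ => h.comap (fun _ => MvPolynomial.X 0 * MvPolynomial.C g⁻¹))).congr' fun a => ?_
  simp only [map_mul, MvPolynomial.eval_X, MvPolynomial.eval_C, Set.mem_ofPred_eq]
  constructor
  · rintro ⟨h0, hn⟩
    obtain ⟨g, hg, hS⟩ := hrep _ h0
    refine ⟨g, ⟨hg, fun hgS => hn ?_⟩, hS⟩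
    have := mul_mem_localSquares hS hgS
    rwa [inv_mul_cancel_right₀ (hG0 g hg)] at this
  · rintro ⟨g, ⟨hg, hgS⟩, hS⟩
    refine ⟨fun h0 => hS.1 (by rw [h0, zero_mul]), fun hn => hgS ?_⟩
    have := mul_mem_localSquares hn (inv_mem_localSquares hS)
    rwa [mul_inv_rev, inv_inv, mul_comm g, mul_inv_cancel_left₀ hn.1] at this

end Reduction

section PrimeResidueField

variable {K : Type*} [Field K] [NumberField K] {W : HeightOneSpectrum (𝓞 K)}

lemma intCast_mem_iff_dvd {l : ℕ} (hl : l.Prime) (h : (l : 𝓞 K) ∈ W.asIdeal) {a : ℤ} :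
    (a : 𝓞 K) ∈ W.asIdeal ↔ (l : ℤ) ∣ a := by
  rw [Int.cast_mem_ideal_iff]
  rw [← Int.cast_natCast, Int.cast_mem_ideal_iff, Int.natCast_dvd_natCast,
    Nat.dvd_prime hl] at h
  rcases h with h | h
  · exfalso
    have : ((1 : ℤ) : 𝓞 K) ∈ W.asIdeal := by
      rw [Int.cast_mem_ideal_iff, h]; simp
    exact W.isPrime.one_notMem (by simpa using this)
  · rw [h]

lemma exists_prime_natCast_mem (W : HeightOneSpectrum (𝓞 K)) :
    ∃ l : ℕ, l.Prime ∧ (l : 𝓞 K) ∈ W.asIdeal := by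
  have : NeZero W.asIdeal := ⟨W.ne_bot⟩
  exact ⟨_, Nat.absNorm_under_prime W.asIdeal, Int.absNorm_under_mem W.asIdeal⟩

lemma exists_heightOneSpectrum_natCast_mem (K : Type*) [Field K] [NumberField K] {l : ℕ}
    (hl : l.Prime) : ∃ W : HeightOneSpectrum (𝓞 K), (l : 𝓞 K) ∈ W.asIdeal := by
  have h1 : Ideal.span {(l : 𝓞 K)} ≠ ⊤ := by
    intro h
    have : Ideal.absNorm (Ideal.span {(l : 𝓞 K)}) = 1 := by rw [h]; simp
    rw [← Int.cast_natCast, ← eq_intCast (algebraMap ℤ (𝓞 K)), Ideal.absNorm_span_singleton,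
      Algebra.norm_algebraMap, Int.natAbs_pow, Int.natAbs_natCast, Nat.pow_eq_one] at this
    rcases this with h | h
    · exact hl.one_lt.ne' h
    · exact Module.finrank_pos.ne' h
  obtain ⟨m, hm, hle⟩ := Ideal.exists_le_maximal _ h1
  have hlm : (l : 𝓞 K) ∈ m := hle (Ideal.mem_span_singleton_self _)
  exact ⟨⟨m, hm.isPrime, fun h0 => hl.ne_zero (by simpa [h0] using hlm)⟩, hlm⟩

lemma exists_intCast_sub_mem (hW : (Ideal.absNorm W.asIdeal).Prime) (x : 𝓞 K) :
    ∃ m : ℤ, x - m ∈ W.asIdeal := by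
  have := Fact.mk hW
  set q := Ideal.absNorm W.asIdeal with hq
  have hc : CharP (𝓞 K ⧸ W.asIdeal) q := by
    refine (charP_iff _ _).mpr fun n => ?_
    rw [← map_natCast (Ideal.Quotient.mk W.asIdeal), Ideal.Quotient.eq_zero_iff_mem,
      ← Int.cast_natCast, intCast_mem_iff_dvd hW (Ideal.absNorm_mem _), Int.natCast_dvd_natCast]
  have : Finite (𝓞 K ⧸ W.asIdeal) := Ideal.finiteQuotientOfFreeOfNeBot _ W.ne_bot
  have hb : Function.Bijective (ZMod.castHom (dvd_refl q) (𝓞 K ⧸ W.asIdeal)) := by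
    have : Nontrivial (𝓞 K ⧸ W.asIdeal) := Ideal.Quotient.nontrivial_iff.mpr W.isPrime.ne_top
    refine (Nat.bijective_iff_injective_and_card _).mpr ⟨RingHom.injective _, ?_⟩
    rw [Nat.card_zmod, hq, Ideal.absNorm_apply, Submodule.cardQuot_apply]
  obtain ⟨z, hz⟩ := hb.2 (Ideal.Quotient.mk _ x)
  obtain ⟨m, rfl⟩ := ZMod.intCast_surjective z
  refine ⟨m, Ideal.Quotient.eq.mp ?_⟩
  rw [← hz, map_intCast, map_intCast]

lemma residueSymbol_intCast (hW : (Ideal.absNorm W.asIdeal).Prime) (a : ℤ) :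
    residueSymbol W (a : 𝓞 K) = jacobiSym a (Ideal.absNorm W.asIdeal) := by
  have := Fact.mk hW
  have hmem : ∀ b : ℤ, (b : 𝓞 K) ∈ W.asIdeal ↔ ((b : ℤ) : ZMod (Ideal.absNorm W.asIdeal)) = 0 := by
    intro b
    rw [intCast_mem_iff_dvd hW (Ideal.absNorm_mem _), ZMod.intCast_zmod_eq_zero_iff_dvd]
  rw [← jacobiSym.legendreSym.to_jacobiSym]
  by_cases h : (a : 𝓞 K) ∈ W.asIdeal
  · rw [residueSymbol_eq_zero_iff.mpr h, (legendreSym.eq_zero_iff _ _).mpr ((hmem a).mp h)]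
  · have h0 := fun h' => h ((hmem a).mpr h')
    have key : residueSymbol W (a : 𝓞 K) = 1 ↔ legendreSym (Ideal.absNorm W.asIdeal) a = 1 := by
      rw [residueSymbol_eq_one_iff h, legendreSym.eq_one_iff _ h0]
      constructor
      · rintro ⟨x, hx⟩
        obtain ⟨m, hm⟩ := exists_intCast_sub_mem hW x
        refine ⟨m, ?_⟩
        rw [← sub_eq_zero, ← Int.cast_mul, ← Int.cast_sub, ← hmem]
        have := W.asIdeal.add_mem hx (W.asIdeal.mul_mem_right (x + m) hm)
        push_cast
        convert this using 1
        ring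
      · rintro ⟨z, hz⟩
        obtain ⟨m, rfl⟩ := ZMod.intCast_surjective z
        refine ⟨m, ?_⟩
        rw [← sub_eq_zero, ← Int.cast_mul, ← Int.cast_sub, ← hmem] at hz
        push_cast at hz
        rwa [pow_two]
    rcases residueSymbol_eq_one_or_neg_one h with h1 | h1 <;>
      rcases legendreSym.eq_one_or_neg_one _ h0 with h2 | h2 <;>
      simp_all

end PrimeResidueField

section Conjugates

open scoped Pointwise

variable {K : Type*} [Field K] [NumberField K]

/-- The prime ideal `σ W`. -/
noncomputable def galPrime (σ : Gal(K/ℚ)) (W : HeightOneSpectrum (𝓞 K)) :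
    HeightOneSpectrum (𝓞 K) where
  asIdeal := σ • W.asIdeal
  isPrime := by
    have := W.isPrime
    infer_instance
  ne_bot := fun h => W.ne_bot (by
    rw [← inv_smul_smul σ W.asIdeal, h]
    exact Ideal.smul_bot _)

lemma smul_mem_galPrime_iff {σ : Gal(K/ℚ)} {W : HeightOneSpectrum (𝓞 K)} {x : 𝓞 K} :
    σ • x ∈ (galPrime σ W).asIdeal ↔ x ∈ W.asIdeal :=
  Ideal.smul_mem_pointwise_smul_iff

lemma gal_smul_intCast (σ : Gal(K/ℚ)) (n : ℤ) : σ • (n : 𝓞 K) = n :=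
  map_intCast (MulSemiringAction.toRingHom Gal(K/ℚ) (𝓞 K) σ) n

lemma gal_smul_natCast (σ : Gal(K/ℚ)) (n : ℕ) : σ • (n : 𝓞 K) = n :=
  map_natCast (MulSemiringAction.toRingHom Gal(K/ℚ) (𝓞 K) σ) n

open Classical in
/-- The finite set of conjugates of an algebraic integer. -/
noncomputable def conjugates (γ : 𝓞 K) : Finset (𝓞 K) :=
  Finset.univ.image fun σ : Gal(K/ℚ) => σ • γ

lemma mem_conjugates {γ x : 𝓞 K} : x ∈ conjugates γ ↔ ∃ σ : Gal(K/ℚ), σ • γ = x := by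
  simp [conjugates]

lemma self_mem_conjugates (γ : 𝓞 K) : γ ∈ conjugates γ :=
  mem_conjugates.mpr ⟨1, one_smul _ _⟩

lemma smul_mem_conjugates {γ x : 𝓞 K} (hx : x ∈ conjugates γ) (σ : Gal(K/ℚ)) :
    σ • x ∈ conjugates γ := by
  obtain ⟨τ, rfl⟩ := mem_conjugates.mp hx
  exact mem_conjugates.mpr ⟨σ * τ, mul_smul _ _ _⟩

lemma exists_smul_eq_of_mem_conjugates {γ x y : 𝓞 K} (hx : x ∈ conjugates γ)
    (hy : y ∈ conjugates γ) : ∃ σ : Gal(K/ℚ), σ • x = y := by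
  obtain ⟨τ, rfl⟩ := mem_conjugates.mp hx
  obtain ⟨τ', rfl⟩ := mem_conjugates.mp hy
  exact ⟨τ' * τ⁻¹, by rw [smul_smul, inv_mul_cancel_right]⟩

lemma exists_intCast_eq_prod_conjugates [IsGalois ℚ K] (γ : 𝓞 K) (T : ℤ) :
    ∃ n : ℤ, (n : 𝓞 K) = ∏ x ∈ conjugates γ, (1 + (T : 𝓞 K) ^ 2 * x) := by
  obtain ⟨n, hn⟩ := Algebra.IsInvariant.isInvariant (A := ℤ) (B := 𝓞 K) (G := Gal(K/ℚ))
    (∏ x ∈ conjugates γ, (1 + (T : 𝓞 K) ^ 2 * x)) (fun σ => by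
      rw [Finset.smul_prod']
      refine Finset.prod_bij (fun x _ => σ • x) (fun x hx => smul_mem_conjugates hx σ)
        (fun x _ y _ h => smul_left_cancel σ h)
        (fun y hy => ⟨σ⁻¹ • y, smul_mem_conjugates hy _, smul_inv_smul _ _⟩) fun x _ => ?_
      rw [smul_add, smul_one, smul_mul', smul_pow', gal_smul_intCast])
  exact ⟨n, by rw [← hn, eq_intCast]⟩

lemma exists_galPrime_eq [IsGalois ℚ K] {l : ℕ} (hl : l.Prime) {P Q : HeightOneSpectrum (𝓞 K)}
    (hP : (l : 𝓞 K) ∈ P.asIdeal) (hQ : (l : 𝓞 K) ∈ Q.asIdeal) :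
    ∃ σ : Gal(K/ℚ), galPrime σ P = Q := by
  have := P.isPrime
  have := Q.isPrime
  obtain ⟨σ, hσ⟩ := Algebra.IsInvariant.exists_smul_of_under_eq ℤ (𝓞 K) Gal(K/ℚ) P.asIdeal
    Q.asIdeal (by
      ext a
      rw [Ideal.under_def, Ideal.under_def, Ideal.mem_comap, Ideal.mem_comap, eq_intCast,
        intCast_mem_iff_dvd hl hP, intCast_mem_iff_dvd hl hQ])
  exact ⟨σ, HeightOneSpectrum.ext hσ.symm⟩

end Conjugates

section ConjugateParity

open WithZero

variable {K : Type*} [Field K] [NumberField K]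

/-- Away from `M`, the integer `γ` is a unit with pairwise incongruent conjugates, and `K` is
unramified over `ℚ`. -/
def IsGoodModulus (γ : 𝓞 K) (M : ℕ) : Prop :=
  ∀ W : HeightOneSpectrum (𝓞 K), (M : 𝓞 K) ∉ W.asIdeal →
    (∀ l : ℕ, l.Prime → (l : 𝓞 K) ∉ W.asIdeal ^ 2) ∧ (∀ x ∈ conjugates γ, x ∉ W.asIdeal) ∧
    ∀ x ∈ conjugates γ, ∀ y ∈ conjugates γ, x ≠ y → x - y ∉ W.asIdeal

variable {γ : 𝓞 K} {M : ℕ} {T n : ℤ} {W : HeightOneSpectrum (𝓞 K)} {l : ℕ} {x : 𝓞 K}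

lemma intCast_notMem_of_one_add_mem (hu : 1 + (T : 𝓞 K) ^ 2 * x ∈ W.asIdeal) :
    (T : 𝓞 K) ∉ W.asIdeal := by
  intro h
  have h2 : (T : 𝓞 K) ^ 2 * x ∈ W.asIdeal :=
    W.asIdeal.mul_mem_right _ (by rw [pow_two]; exact W.asIdeal.mul_mem_left _ h)
  exact W.isPrime.one_notMem (by simpa using W.asIdeal.sub_mem hu h2)

lemma natCast_notMem_of_one_add_mem (hT : (M : ℤ) ∣ T)
    (hu : 1 + (T : 𝓞 K) ^ 2 * x ∈ W.asIdeal) : (M : 𝓞 K) ∉ W.asIdeal := by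
  intro h
  refine intCast_notMem_of_one_add_mem hu ?_
  obtain ⟨c, rfl⟩ := hT
  push_cast
  exact W.asIdeal.mul_mem_right _ h

lemma IsGoodModulus.valuation_one_add_eq_one (h : IsGoodModulus γ M) (hT : (M : ℤ) ∣ T)
    (hx : x ∈ conjugates γ) (hu : 1 + (T : 𝓞 K) ^ 2 * x ∈ W.asIdeal) {y : 𝓞 K}
    (hy : y ∈ conjugates γ) (hyx : y ≠ x) :
    W.valuation K (algebraMap (𝓞 K) K (1 + (T : 𝓞 K) ^ 2 * y)) = 1 := by
  rw [HeightOneSpectrum.valuation_eq_one_iff_notMem]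
  intro hy'
  have h1 := W.asIdeal.sub_mem hy' hu
  have h2 : (1 + (T : 𝓞 K) ^ 2 * y) - (1 + (T : 𝓞 K) ^ 2 * x) = (T : 𝓞 K) * (T * (y - x)) := by
    ring
  rw [h2] at h1
  have hT' := intCast_notMem_of_one_add_mem hu
  exact (h W (natCast_notMem_of_one_add_mem hT hu)).2.2 y hy x hx hyx
    (((W.isPrime.mem_or_mem h1).resolve_left hT' |> W.isPrime.mem_or_mem).resolve_left hT')

lemma IsGoodModulus.valuation_conj (h : IsGoodModulus γ M) (hT : (M : ℤ) ∣ T)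
    (hu : 1 + (T : 𝓞 K) ^ 2 * x ∈ W.asIdeal) {y : 𝓞 K} (hy : y ∈ conjugates γ) :
    W.valuation K (algebraMap (𝓞 K) K y) = 1 := by
  rw [HeightOneSpectrum.valuation_eq_one_iff_notMem]
  exact (h W (natCast_notMem_of_one_add_mem hT hu)).2.1 y hy

lemma IsGoodModulus.valuation_prime (h : IsGoodModulus γ M) (hT : (M : ℤ) ∣ T)
    (hu : 1 + (T : 𝓞 K) ^ 2 * x ∈ W.asIdeal) (hl : l.Prime) (hlW : (l : 𝓞 K) ∈ W.asIdeal) :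
    W.valuation K (l : K) = exp (-1 : ℤ) := by
  have h1 : (l : K) = algebraMap (𝓞 K) K (l : 𝓞 K) := by simp
  rw [h1, HeightOneSpectrum.valuation_of_algebraMap]
  refine le_antisymm ?_ ?_
  · have := (W.intValuation_le_pow_iff_mem (l : 𝓞 K) 1).mpr (by simpa using hlW)
    simpa using this
  · by_contra! hlt
    refine (h W (natCast_notMem_of_one_add_mem hT hu)).1 l hl ?_
    rw [← W.intValuation_le_pow_iff_mem]
    have hl0 : W.intValuation (l : 𝓞 K) ≠ 0 :=
      W.intValuation_ne_zero _ (by exact_mod_cast hl.ne_zero)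
    rw [← exp_log hl0, exp_lt_exp] at hlt
    rw [← exp_log hl0, exp_le_exp]
    push_cast
    omega

lemma valuation_natCast_eq_one (hl : l.Prime) (hlW : (l : 𝓞 K) ∈ W.asIdeal) {a : ℤ}
    (ha : ¬ (l : ℤ) ∣ a) : W.valuation K (a : K) = 1 := by
  have h1 : (a : K) = algebraMap (𝓞 K) K (a : 𝓞 K) := by simp
  rwa [h1, HeightOneSpectrum.valuation_eq_one_iff_notMem, intCast_mem_iff_dvd hl hlW]

lemma IsGoodModulus.valuation_one_add (h : IsGoodModulus γ M) (hT : (M : ℤ) ∣ T)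
    (hn : (n : 𝓞 K) = ∏ x ∈ conjugates γ, (1 + (T : 𝓞 K) ^ 2 * x)) (hn0 : n ≠ 0)
    (hx : x ∈ conjugates γ)
    (hu : 1 + (T : 𝓞 K) ^ 2 * x ∈ W.asIdeal) (hl : l.Prime) (hlW : (l : 𝓞 K) ∈ W.asIdeal) :
    W.valuation K (algebraMap (𝓞 K) K (1 + (T : 𝓞 K) ^ 2 * x)) =
      exp (-(n.natAbs.factorization l : ℤ)) := by
  have h1 : W.valuation K (n : K) =
      W.valuation K (algebraMap (𝓞 K) K (1 + (T : 𝓞 K) ^ 2 * x)) := by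
    have : (n : K) = algebraMap (𝓞 K) K (n : 𝓞 K) := by simp
    rw [this, hn, map_prod, map_prod]
    exact Finset.prod_eq_single_of_mem x hx fun y hy hyx =>
      h.valuation_one_add_eq_one hT hx hu hy hyx
  rw [← h1]
  have hdec : (n.natAbs : K) = (l : K) ^ (n.natAbs.factorization l) *
      ((n.natAbs / l ^ (n.natAbs.factorization l) : ℕ) : K) := by
    exact_mod_cast (Nat.ordProj_mul_ordCompl_eq_self n.natAbs l).symm
  have h2 : W.valuation K (n : K) = W.valuation K (n.natAbs : K) := by
    rcases Int.natAbs_eq n with h | h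
    · conv_lhs => rw [h]
      simp
    · conv_lhs => rw [h]
      rw [Int.cast_neg, Valuation.map_neg]; simp
  have h3 : W.valuation K ((n.natAbs / l ^ (n.natAbs.factorization l) : ℕ) : K) = 1 := by
    have := valuation_natCast_eq_one (K := K) hl hlW
      (a := ((n.natAbs / l ^ (n.natAbs.factorization l) : ℕ) : ℤ))
      (by
        rw [Int.natCast_dvd_natCast]
        exact Nat.not_dvd_ordCompl hl (Int.natAbs_ne_zero.mpr hn0))
    simpa only [Int.cast_natCast] using this
  rw [h2, hdec, map_mul, h3, mul_one, map_pow, h.valuation_prime hT hu hl hlW, ← exp_nsmul]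
  simp

lemma exists_mem_one_add_mem 
    (hn : (n : 𝓞 K) = ∏ x ∈ conjugates γ, (1 + (T : 𝓞 K) ^ 2 * x))
    (hl : l.Prime) (hln : (l : ℤ) ∣ n) (hx : x ∈ conjugates γ) :
    ∃ W : HeightOneSpectrum (𝓞 K), (l : 𝓞 K) ∈ W.asIdeal ∧
      1 + (T : 𝓞 K) ^ 2 * x ∈ W.asIdeal := by
  obtain ⟨W, hW⟩ := exists_heightOneSpectrum_natCast_mem K hl
  have h1 := (intCast_mem_iff_dvd hl hW).mpr hln
  rw [hn, W.isPrime.prod_mem_iff] at h1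
  obtain ⟨y, hy, hyW⟩ := h1
  obtain ⟨σ, rfl⟩ := exists_smul_eq_of_mem_conjugates hy hx
  refine ⟨galPrime σ W, ?_, ?_⟩
  · rw [← gal_smul_natCast σ, smul_mem_galPrime_iff]
    exact hW
  · have : 1 + (T : 𝓞 K) ^ 2 * σ • y = σ • (1 + (T : 𝓞 K) ^ 2 * y) := by
      rw [smul_add, smul_one, smul_mul', smul_pow', gal_smul_intCast]
    rwa [this, smul_mem_galPrime_iff]

end ConjugateParity

section ReciprocityPrime

open WithZero

variable {K : Type*} [Field K] [NumberField K]
variable {γ : 𝓞 K} {M : ℕ} {T n : ℤ} {W : HeightOneSpectrum (𝓞 K)} {l : ℕ} {x : 𝓞 K}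

open Classical in
lemma IsGoodModulus.even_of_isSquare (h : IsGoodModulus γ M) (hT : (M : ℤ) ∣ T)
    (hn : (n : 𝓞 K) = ∏ x ∈ conjugates γ, (1 + (T : 𝓞 K) ^ 2 * x)) (hn0 : n ≠ 0)
    (h2M : 2 ∣ M) {p : ℕ} (hpM : p ∣ M)
    (A₁ : Finset {x // x ∈ conjugates γ}) (A₂ : Finset {l // l ∈ n.natAbs.primeFactors})
    (A₃ : Finset (Fin 3))
    (hA : IsSquare (algebraMap (𝓞 K) K ((∏ x ∈ A₁, x.1 * (1 + (T : 𝓞 K) ^ 2 * x.1)) *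
      ((∏ l ∈ A₂, ((l.1 : ℕ) : 𝓞 K)) * ∏ i ∈ A₃, (((![-1, 2, (p : ℤ)] i : ℤ) : 𝓞 K))))))
    (x : {x // x ∈ conjugates γ}) (l : {l // l ∈ n.natAbs.primeFactors}) :
    Even ((if x ∈ A₁ then (n.natAbs.factorization l : ℤ) else 0) + if l ∈ A₂ then 1 else 0) := by
  have hl := Nat.prime_of_mem_primeFactors l.2
  have hln : ((l.1 : ℕ) : ℤ) ∣ n := Int.natCast_dvd.mpr (Nat.dvd_of_mem_primeFactors l.2)
  obtain ⟨W, hlW, hu⟩ := exists_mem_one_add_mem hn hl hln x.2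
  have hMW := natCast_notMem_of_one_add_mem hT hu
  have hv1 : ∏ y ∈ A₁, W.valuation K (algebraMap (𝓞 K) K (y.1 * (1 + (T : 𝓞 K) ^ 2 * y.1))) =
      if x ∈ A₁ then exp (-(n.natAbs.factorization l : ℤ)) else 1 := by
    rw [← Finset.prod_ite_eq' A₁ x fun _ => exp (-(n.natAbs.factorization l : ℤ))]
    refine Finset.prod_congr rfl fun y _ => ?_
    rw [map_mul, map_mul, h.valuation_conj hT hu y.2, one_mul]
    split_ifs with hyx
    · rw [hyx, h.valuation_one_add hT hn hn0 x.2 hu hl hlW]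
    · exact h.valuation_one_add_eq_one hT x.2 hu y.2 fun h' => hyx (Subtype.ext h')
  have hv2 : ∏ y ∈ A₂, W.valuation K (algebraMap (𝓞 K) K ((y.1 : ℕ) : 𝓞 K)) =
      if l ∈ A₂ then exp (-1 : ℤ) else 1 := by
    rw [← Finset.prod_ite_eq' A₂ l fun _ => exp (-1 : ℤ)]
    refine Finset.prod_congr rfl fun y _ => ?_
    rw [map_natCast]
    split_ifs with hyx
    · rw [hyx, h.valuation_prime hT hu hl hlW]
    · have := valuation_natCast_eq_one (K := K) hl hlW (a := ((y.1 : ℕ) : ℤ)) (by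
        rw [Int.natCast_dvd_natCast,
          Nat.prime_dvd_prime_iff_eq hl (Nat.prime_of_mem_primeFactors y.2)]
        exact fun h' => hyx (Subtype.ext h'.symm))
      simpa only [Int.cast_natCast] using this
  have hdvd : ∀ a : ℤ, a ∣ (M : ℤ) → W.valuation K (algebraMap (𝓞 K) K (a : 𝓞 K)) = 1 := by
    intro a ha
    rw [HeightOneSpectrum.valuation_eq_one_iff_notMem]
    intro haW
    obtain ⟨c, hc⟩ := ha
    apply hMW
    rw [← Int.cast_natCast, hc]
    push_cast
    exact W.asIdeal.mul_mem_right _ haW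
  have hv3 : ∏ i ∈ A₃, W.valuation K (algebraMap (𝓞 K) K ((![-1, 2, (p : ℤ)] i : ℤ) : 𝓞 K)) =
      1 := by
    refine Finset.prod_eq_one fun i _ => hdvd _ ?_
    fin_cases i
    · simp
    · exact Int.natCast_dvd_natCast.mpr h2M
    · exact Int.natCast_dvd_natCast.mpr hpM
  obtain ⟨y, hy⟩ := hA
  have hval := congrArg (W.valuation K) hy
  simp only [map_mul (algebraMap (𝓞 K) K) (Finset.prod _ _), map_mul (W.valuation K),
    map_prod, hv1, hv2, hv3, mul_one] at hval
  have hlog := congrArg log hval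
  have hy0 : W.valuation K y ≠ 0 := by
    intro h0
    rw [h0, mul_zero] at hval
    split_ifs at hval <;> simp at hval
  rw [log_mul (by split_ifs <;> simp) (by split_ifs <;> simp), log_mul hy0 hy0] at hlog
  refine ⟨-log (W.valuation K y), ?_⟩
  have e1 : log (if x ∈ A₁ then exp (-(n.natAbs.factorization l : ℤ)) else 1) =
      -(if x ∈ A₁ then (n.natAbs.factorization l : ℤ) else 0) := by
    split_ifs <;> simp
  have e2 : log (if l ∈ A₂ then exp (-1 : ℤ) else 1) = -(if l ∈ A₂ then 1 else 0) := by
    split_ifs <;> simp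
  rw [e1, e2] at hlog
  linarith

/-- A prime with prescribed quadratic symbols at the primes dividing the norm of
`1 + T ^ 2 * γ`, and modulo which `γ * (1 + T ^ 2 * γ)` is a square. -/
theorem exists_prime_jacobiSym_eq [IsGalois ℚ K] (h : IsGoodModulus γ M) (hT : (M : ℤ) ∣ T)
    (hn : (n : 𝓞 K) = ∏ x ∈ conjugates γ, (1 + (T : 𝓞 K) ^ 2 * x)) (hn0 : n ≠ 0)
    (hγ : γ ≠ 0)
    (h2M : 2 ∣ M) {p : ℕ} (hp : p.Prime) (hpM : p ∣ M) (s : ℕ → ℤ)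
    (hs : ∀ l ∈ n.natAbs.primeFactors, s l = 1 ∨ s l = -1)
    (hprod : ∏ l ∈ n.natAbs.primeFactors, s l ^ n.natAbs.factorization l = 1) (B : ℕ) :
    ∃ q : ℕ, q.Prime ∧ B < q ∧ jacobiSym (-1) q = 1 ∧ jacobiSym 2 q = 1 ∧ jacobiSym p q = 1 ∧
      (∀ l ∈ n.natAbs.primeFactors, jacobiSym l q = s l) ∧
      ∀ W : HeightOneSpectrum (𝓞 K), (q : 𝓞 K) ∈ W.asIdeal →
        ∃ m : ℤ, γ * (1 + (T : 𝓞 K) ^ 2 * γ) - (m : 𝓞 K) ^ 2 ∈ W.asIdeal := by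
  classical
  let c : {x // x ∈ conjugates γ} ⊕ ({l // l ∈ n.natAbs.primeFactors} ⊕ Fin 3) → 𝓞 K :=
    Sum.elim (fun x => x.1 * (1 + (T : 𝓞 K) ^ 2 * x.1))
      (Sum.elim (fun l => ((l.1 : ℕ) : 𝓞 K)) fun i => ((![-1, 2, (p : ℤ)] i : ℤ) : 𝓞 K))
  let ε : {x // x ∈ conjugates γ} ⊕ ({l // l ∈ n.natAbs.primeFactors} ⊕ Fin 3) → ℤ :=
    Sum.elim (fun _ => 1) (Sum.elim (fun l => s l.1) fun _ => 1)
  have hnK : (n : 𝓞 K) ≠ 0 := by exact_mod_cast hn0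
  have hc : ∀ i, c i ≠ 0 := by
    rintro (x | l | i)
    · refine mul_ne_zero ?_ fun h0 => hnK ?_
      · obtain ⟨σ, hσ⟩ := mem_conjugates.mp x.2
        rw [← hσ]
        exact (smul_ne_zero_iff_ne σ).mpr hγ
      · rw [hn]
        exact Finset.prod_eq_zero x.2 h0
    · exact Nat.cast_ne_zero.mpr (Nat.prime_of_mem_primeFactors l.2).ne_zero
    · refine Int.cast_ne_zero.mpr ?_
      fin_cases i
      · simp
      · simp
      · exact Int.natCast_ne_zero.mpr hp.ne_zero
  have hε : ∀ i, ε i = 1 ∨ ε i = -1 := by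
    rintro (x | l | i)
    · exact Or.inl rfl
    · exact hs _ l.2
    · exact Or.inl rfl
  have hcons : ∀ A : Finset _, IsSquare (algebraMap (𝓞 K) K (∏ i ∈ A, c i)) →
      ∏ i ∈ A, ε i = 1 := by
    intro A hA
    rw [← A.toLeft_disjSum_toRight, ← A.toRight.toLeft_disjSum_toRight, Finset.prod_disjSum,
      Finset.prod_disjSum] at hA ⊢
    have hpar := h.even_of_isSquare hT hn hn0 h2M hpM _ _ _ hA
    set A₁ := A.toLeft
    set A₂ := A.toRight.toLeft
    change (∏ x ∈ A₁, (1 : ℤ)) * ((∏ l ∈ A₂, s l.1) * ∏ i ∈ _, (1 : ℤ)) = 1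
    rw [Finset.prod_const_one, Finset.prod_const_one, one_mul, mul_one]
    rcases A₂.eq_empty_or_nonempty with hA₂ | ⟨l₀, hl₀⟩
    · simp [hA₂]
    have hγA : (⟨γ, self_mem_conjugates γ⟩ : {x // x ∈ conjugates γ}) ∈ A₁ := by
      by_contra hγA
      have := hpar ⟨γ, self_mem_conjugates γ⟩ l₀
      rw [if_neg hγA, if_pos hl₀] at this
      exact absurd this (by decide)
    rw [← hprod, ← Finset.prod_attach n.natAbs.primeFactors]
    rw [← Finset.univ_eq_attach, ← Finset.univ_inter A₂, ← Finset.prod_ite_mem]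
    refine Finset.prod_congr rfl fun l _ => ?_
    have hl := hpar ⟨γ, self_mem_conjugates γ⟩ l
    rw [if_pos hγA] at hl
    split_ifs at hl ⊢ with hlA
    · have ho : Odd (n.natAbs.factorization l) := by
        rw [← Int.odd_coe_nat]
        exact (Int.even_add_one.mp hl |> Int.not_even_iff_odd.mp)
      rcases hs _ l.2 with h1 | h1 <;> rw [h1]
      · simp
      · rw [ho.neg_one_pow]
    · have he : Even (n.natAbs.factorization l) := by
        rw [← Int.even_coe_nat]
        simpa using hl
      rcases hs _ l.2 with h1 | h1 <;> rw [h1]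
      · simp
      · rw [he.neg_one_pow]
  obtain ⟨P, hPq, hBP, hres⟩ := exists_prime_absNorm_residueSymbol_eq c hc ε hε hcons B
  have hres' : ∀ a : ℤ, residueSymbol P (a : 𝓞 K) = jacobiSym a (Ideal.absNorm P.asIdeal) :=
    residueSymbol_intCast hPq
  refine ⟨_, hPq, hBP, ?_, ?_, ?_, ?_, ?_⟩
  · rw [← hres']
    exact hres (Sum.inr (Sum.inr 0))
  · rw [← hres']
    exact hres (Sum.inr (Sum.inr 1))
  · rw [← hres']
    exact hres (Sum.inr (Sum.inr 2))
  · intro l hl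
    rw [← hres', Int.cast_natCast]
    exact hres (Sum.inr (Sum.inl ⟨l, hl⟩))
  · intro W hW
    obtain ⟨σ, rfl⟩ := exists_galPrime_eq hPq (Ideal.absNorm_mem P.asIdeal) hW
    have hx : σ⁻¹ • γ ∈ conjugates γ := mem_conjugates.mpr ⟨σ⁻¹, rfl⟩
    have h1 : residueSymbol P (σ⁻¹ • γ * (1 + (T : 𝓞 K) ^ 2 * σ⁻¹ • γ)) = 1 :=
      hres (Sum.inl ⟨_, hx⟩)
    have h2 : σ⁻¹ • γ * (1 + (T : 𝓞 K) ^ 2 * σ⁻¹ • γ) ∉ P.asIdeal := by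
      intro h'
      rw [residueSymbol_eq_zero_iff.mpr h'] at h1
      exact absurd h1 (by decide)
    obtain ⟨a, ha⟩ := (residueSymbol_eq_one_iff h2).mp h1
    obtain ⟨m, hm⟩ := exists_intCast_sub_mem hPq a
    refine ⟨m, ?_⟩
    have h3 : γ * (1 + (T : 𝓞 K) ^ 2 * γ) - (m : 𝓞 K) ^ 2 =
        σ • (σ⁻¹ • γ * (1 + (T : 𝓞 K) ^ 2 * σ⁻¹ • γ) - (m : 𝓞 K) ^ 2) := by
      simp only [smul_sub, smul_add, smul_one, smul_mul', smul_pow', gal_smul_intCast,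
        smul_inv_smul]
    rw [h3, smul_mem_galPrime_iff]
    have := P.asIdeal.add_mem ha (P.asIdeal.mul_mem_right (a + m) hm)
    convert this using 1
    ring

end ReciprocityPrime

section IntegerSymbols

lemma prod_jacobiSym_pow (a : ℤ) {n : ℕ} (hn : n ≠ 0) :
    ∏ l ∈ n.primeFactors, jacobiSym a l ^ n.factorization l = jacobiSym a n := by
  have key : ∀ s : Finset ℕ, (∀ l ∈ s, l.Prime) →
      ∏ l ∈ s, jacobiSym a l ^ n.factorization l =
        jacobiSym a (∏ l ∈ s, l ^ n.factorization l) := by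
    classical
    intro s
    induction s using Finset.induction_on with
    | empty => intro _; simp
    | insert l s hl ih =>
      intro h
      rw [Finset.prod_insert hl, Finset.prod_insert hl, jacobiSym.mul_right',
        jacobiSym.pow_right, ih fun x hx => h x (Finset.mem_insert_of_mem hx)]
      · exact pow_ne_zero _ (h l (Finset.mem_insert_self _ _)).ne_zero
      · exact Finset.prod_ne_zero_iff.mpr fun x hx =>
          pow_ne_zero _ (h x (Finset.mem_insert_of_mem hx)).ne_zero
  rw [key _ fun l hl => Nat.prime_of_mem_primeFactors hl]
  congr 1
  exact Nat.prod_factorization_pow_eq_self hn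

lemma jacobiSym_eq_one_or_neg_one_of_mem_primeFactors {a : ℤ} {n l : ℕ}
    (h : jacobiSym a n = 1) (hl : l ∈ n.primeFactors) :
    jacobiSym a l = 1 ∨ jacobiSym a l = -1 := by
  have hlp := Nat.prime_of_mem_primeFactors hl
  obtain ⟨c, hc⟩ := Nat.dvd_of_mem_primeFactors hl
  have hn0 : n ≠ 0 := fun h0 => by simp [h0] at hl
  have hc0 : c ≠ 0 := by rintro rfl; simp at hc; exact hn0 hc
  rw [hc, jacobiSym.mul_right' _ hlp.ne_zero hc0] at h
  rcases jacobiSym.trichotomy a l with h' | h' | h'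
  · rw [h', zero_mul] at h
    exact absurd h (by decide)
  · exact Or.inl h'
  · exact Or.inr h'

lemma mod_eight_eq_one_of_jacobiSym {q : ℕ} (hq : q.Prime) (hq2 : 2 < q)
    (h1 : jacobiSym (-1) q = 1) (h2 : jacobiSym 2 q = 1) : q % 8 = 1 := by
  have ho : Odd q := hq.odd_of_ne_two hq2.ne'
  rw [jacobiSym.at_neg_one ho, ZMod.χ₄_nat_eq_if_mod_four] at h1
  rw [jacobiSym.at_two ho, ZMod.χ₈_nat_eq_if_mod_eight] at h2
  have : q % 2 = 1 := Nat.odd_iff.mp ho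
  split_ifs at h1 h2 <;> omega

lemma exists_intCast_dvd_sub_sq {a : ℤ} {l : ℕ} (hl : l.Prime) (h : jacobiSym a l = 1) :
    ∃ m : ℤ, (l : ℤ) ∣ a - m ^ 2 := by
  have := Fact.mk hl
  obtain ⟨z, hz⟩ := ZMod.isSquare_of_jacobiSym_eq_one h
  obtain ⟨m, rfl⟩ := ZMod.intCast_surjective z
  refine ⟨m, ?_⟩
  rw [← ZMod.intCast_zmod_eq_zero_iff_dvd]
  push_cast
  rw [hz]
  ring

variable {K : Type*} [Field K] [NumberField K]
variable {γ : 𝓞 K} {M : ℕ} {T n : ℤ} {W : HeightOneSpectrum (𝓞 K)} {l : ℕ} {x : 𝓞 K}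

lemma not_dvd_modulus_of_dvd (hT : (M : ℤ) ∣ T)
    (hn : (n : 𝓞 K) = ∏ x ∈ conjugates γ, (1 + (T : 𝓞 K) ^ 2 * x)) (hl : l.Prime)
    (hln : (l : ℤ) ∣ n) : ¬ l ∣ M := by
  obtain ⟨W, hlW, hu⟩ := exists_mem_one_add_mem hn hl hln (self_mem_conjugates γ)
  rintro ⟨c, rfl⟩
  apply natCast_notMem_of_one_add_mem hT hu
  push_cast
  exact W.asIdeal.mul_mem_right _ hlW

lemma ne_zero_of_eq_prod (hT : (M : ℤ) ∣ T)
    (hn : (n : 𝓞 K) = ∏ x ∈ conjugates γ, (1 + (T : 𝓞 K) ^ 2 * x)) (h2M : 2 ∣ M) : n ≠ 0 := by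
  rintro rfl
  exact not_dvd_modulus_of_dvd hT hn Nat.prime_two (dvd_zero _) h2M

theorem exists_prime_square_conditions [IsGalois ℚ K] (h : IsGoodModulus γ M) (hT : (M : ℤ) ∣ T)
    (hn : (n : 𝓞 K) = ∏ x ∈ conjugates γ, (1 + (T : 𝓞 K) ^ 2 * x))
    (hγ : γ ≠ 0) (h2M : 2 ∣ M) {p : ℕ} (hp : p.Prime) (hpM : p ∣ M) {a : ℤ}
    (ha : jacobiSym a n.natAbs = 1) (B : ℕ) :
    ∃ q : ℕ, q.Prime ∧ B < q ∧ q % 8 = 1 ∧ jacobiSym p q = 1 ∧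
      (∀ l : ℕ, l.Prime → (l : ℤ) ∣ n → ∃ m : ℤ, (l : ℤ) ∣ a * q - m ^ 2) ∧
      ∀ W : HeightOneSpectrum (𝓞 K), (q : 𝓞 K) ∈ W.asIdeal →
        ∃ m : ℤ, γ * (1 + (T : 𝓞 K) ^ 2 * γ) - (m : 𝓞 K) ^ 2 ∈ W.asIdeal := by
  have hn0 := ne_zero_of_eq_prod hT hn h2M
  have hs : ∀ l ∈ n.natAbs.primeFactors, jacobiSym a l = 1 ∨ jacobiSym a l = -1 := fun l hl =>
    jacobiSym_eq_one_or_neg_one_of_mem_primeFactors ha hl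
  obtain ⟨q, hq, hqB, h1, h2, h3, h4, h5⟩ := exists_prime_jacobiSym_eq h hT hn hn0 hγ h2M hp hpM
    (fun l => jacobiSym a l) hs
    ((prod_jacobiSym_pow a (Int.natAbs_ne_zero.mpr hn0)).trans ha) (max 2 B)
  have hq8 := mod_eight_eq_one_of_jacobiSym hq ((le_max_left 2 B).trans_lt hqB) h1 h2
  refine ⟨q, hq, (le_max_right 2 B).trans_lt hqB, hq8, h3, fun l hl hln => ?_, h5⟩
  have hmem : l ∈ n.natAbs.primeFactors :=
    Nat.mem_primeFactors.mpr ⟨hl, Int.natCast_dvd.mp hln, Int.natAbs_ne_zero.mpr hn0⟩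
  have hl2 : l ≠ 2 := by
    rintro rfl
    exact not_dvd_modulus_of_dvd hT hn hl hln h2M
  refine exists_intCast_dvd_sub_sq hl ?_
  rw [jacobiSym.mul_left,
    jacobiSym.quadratic_reciprocity_one_mod_four (by omega) (hl.odd_of_ne_two hl2), h4 l hmem]
  rcases hs l hmem with h' | h' <;> rw [h'] <;> rfl

end IntegerSymbols

section AuxiliaryPrime

lemma exists_odd_factorization {m : ℕ} (hm0 : m ≠ 0) (hm : ¬ IsSquare m) :
    ∃ l, l.Prime ∧ l ∣ m ∧ Odd (m.factorization l) := by
  by_contra! hc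
  apply hm
  rw [← Nat.prod_factorization_pow_eq_self hm0]
  refine Finset.isSquare_prod _ fun l hl => ?_
  have hl' : l ∈ m.primeFactors := hl
  have := hc l (Nat.prime_of_mem_primeFactors hl') (Nat.dvd_of_mem_primeFactors hl')
  exact (Nat.not_odd_iff_even.mp this).isSquare_pow _

lemma jacobiSym_eq_one_of_modEq_one {a b : ℕ} (h : a ≡ 1 [MOD b]) : jacobiSym a b = 1 := by
  rw [← jacobiSym.one_left b]
  apply jacobiSym.mod_left'
  exact_mod_cast h

/-- An odd non-square has a prime non-residue congruent to `1` modulo any given coprime modulus. -/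
lemma exists_prime_jacobiSym_eq_neg_one {m c : ℕ} (hm0 : m ≠ 0) (hm : ¬ IsSquare m)
    (hodd : Odd m) (hc0 : c ≠ 0) (hc : ∀ l : ℕ, l.Prime → l ∣ m → ¬ l ∣ c) :
    ∃ r : ℕ, r.Prime ∧ r ≡ 1 [MOD c] ∧ jacobiSym r m = -1 := by
  obtain ⟨l, hl, hlm, ho⟩ := exists_odd_factorization hm0 hm
  have := Fact.mk hl
  have hl2 : l ≠ 2 := by
    rintro rfl
    exact (Nat.not_even_iff_odd.mpr hodd) (even_iff_two_dvd.mpr hlm)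
  set e := m.factorization l
  set m' := m / l ^ e with hm'
  have hmm : m = l ^ e * m' := (Nat.ordProj_mul_ordCompl_eq_self m l).symm
  have hlm' : ¬ l ∣ m' := Nat.not_dvd_ordCompl hl hm0
  have hm'0 : m' ≠ 0 := by
    rintro h0
    rw [h0, mul_zero] at hmm
    exact hm0 hmm
  obtain ⟨g, hg⟩ := FiniteField.exists_nonsquare (F := ZMod l) (by rw [ZMod.ringChar_zmod_n]; exact hl2)
  have hcop : Nat.Coprime (c * m') l := by
    rw [Nat.coprime_comm, hl.coprime_iff_not_dvd, hl.dvd_mul]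
    exact not_or.mpr ⟨hc l hl hlm, hlm'⟩
  obtain ⟨a, ha1, ha2⟩ := Nat.chineseRemainder hcop 1 g.val
  have hga : (a : ZMod l) = g := by
    rw [(ZMod.natCast_eq_natCast_iff _ _ _).mpr ha2, ZMod.natCast_zmod_val]
  have hal : Nat.Coprime a l := by
    rw [Nat.coprime_comm, hl.coprime_iff_not_dvd, ← ZMod.natCast_eq_zero_iff, hga]
    rintro rfl
    exact hg (IsSquare.zero)
  have hac : Nat.Coprime a (c * m') := by
    rw [Nat.Coprime, ha1.gcd_eq]
    simp
  obtain ⟨r, _, hr, hra⟩ := Nat.forall_exists_prime_gt_and_modEq 0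
    (q := c * m' * l) (a := a) (mul_ne_zero (mul_ne_zero hc0 hm'0) hl.ne_zero)
    (hac.mul_right hal)
  have hr1 : r ≡ 1 [MOD c * m'] := (hra.of_mul_right l).trans ha1
  refine ⟨r, hr, hr1.of_mul_right m', ?_⟩
  have hrl : jacobiSym r l = -1 := by
    rw [ZMod.nonsquare_iff_jacobiSym_eq_neg_one, Int.cast_natCast,
      (ZMod.natCast_eq_natCast_iff _ _ _).mpr (hra.of_mul_left (c * m')), hga]
    exact hg
  rw [hmm, jacobiSym.mul_right' _ (pow_ne_zero _ hl.ne_zero) hm'0, jacobiSym.pow_right, hrl,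
    jacobiSym_eq_one_of_modEq_one (hr1.of_mul_left c), ho.neg_one_pow, mul_one]

variable {K : Type*} [Field K] [NumberField K] {γ : 𝓞 K} {M : ℕ}

lemma natCast_dvd_sub_of_eq_prod {n : ℤ → ℤ}
    (hn : ∀ T, (n T : 𝓞 K) = ∏ x ∈ conjugates γ, (1 + (T : 𝓞 K) ^ 2 * x)) {r : ℕ} (hr : r.Prime)
    {T T' : ℤ} (h : (r : ℤ) ∣ T - T') : (r : ℤ) ∣ n T - n T' := by
  obtain ⟨W, hW⟩ := exists_heightOneSpectrum_natCast_mem K hr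
  rw [← intCast_mem_iff_dvd hr hW] at h ⊢
  push_cast at h ⊢
  rw [← Ideal.Quotient.eq] at h ⊢
  rw [hn, hn, map_prod, map_prod]
  simp only [map_add, map_mul, map_pow, h]

/-- There are an integer `r` and a residue class modulo `r` on which any symbol can be corrected
by a power of `r`. -/
theorem exists_correcting_prime {n : ℤ → ℤ}
    (hn : ∀ T, (n T : 𝓞 K) = ∏ x ∈ conjugates γ, (1 + (T : 𝓞 K) ^ 2 * x)) {p : ℕ} (hp : p.Prime)
    (hM : 8 * p ∣ M) :
    ∃ (r : ℕ) (t : ℤ), r ≠ 0 ∧ r ≡ 1 [MOD 8 * p] ∧ ∀ j b : ℤ,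
      Int.gcd b (n (M * (t + r * j))).natAbs = 1 →
        ∃ e : ℕ, jacobiSym (r ^ e * b) (n (M * (t + r * j))).natAbs = 1 := by
  have h2M : 2 ∣ M := (Dvd.intro (4 * p) (by ring)).trans hM
  by_cases hsq : ∀ t : ℤ, IsSquare (n (M * t)).natAbs
  · refine ⟨1, 0, one_ne_zero, rfl, fun j b hb => ⟨0, ?_⟩⟩
    obtain ⟨m, hm⟩ := hsq (0 + (1 : ℕ) * j)
    have hm0 : m ≠ 0 := by
      rintro rfl
      exact ne_zero_of_eq_prod (dvd_mul_right _ _) (hn _) h2M (Int.natAbs_eq_zero.mp hm)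
    rw [hm] at hb ⊢
    have hbm : Int.gcd b m = 1 := by
      have : (Int.gcd b m : ℕ) ∣ Int.gcd b ((m * m : ℕ) : ℤ) :=
        Int.gcd_dvd_gcd_of_dvd_right _ (by exact_mod_cast Dvd.intro _ rfl)
      rwa [hb, Nat.dvd_one] at this
    rw [pow_zero, one_mul, jacobiSym.mul_right' _ hm0 hm0, ← pow_two]
    exact jacobiSym.sq_one hbm
  push Not at hsq
  obtain ⟨t, ht⟩ := hsq
  have hnd : ∀ t : ℤ, ∀ l : ℕ, l.Prime → l ∣ (n (M * t)).natAbs → ¬ l ∣ M := fun t l hl hlm =>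
    not_dvd_modulus_of_dvd (dvd_mul_right _ _) (hn (M * t)) hl (Int.natCast_dvd.mpr hlm)
  have hodd : ∀ t : ℤ, Odd (n (M * t)).natAbs := by
    intro t
    rw [← Nat.not_even_iff_odd, even_iff_two_dvd]
    exact fun h => hnd t 2 Nat.prime_two h h2M
  obtain ⟨r, hr, hr1, hrm⟩ := exists_prime_jacobiSym_eq_neg_one (hodd t).pos.ne' ht (hodd t)
    (c := 8 * p) (mul_ne_zero (by norm_num) hp.ne_zero)
    fun l hl hlm hlc => hnd t l hl hlm (hlc.trans hM)
  have hr8 : r % 8 = 1 := by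
    have := hr1.of_mul_right p
    exact this
  refine ⟨r, t, hr.ne_zero, hr1, fun j b hb => ?_⟩
  set T := (M : ℤ) * (t + r * j)
  have hsym : jacobiSym r (n T).natAbs = -1 := by
    have hro : Odd r := hr.odd_of_ne_two (by rintro rfl; omega)
    have habs : ∀ a : ℤ, jacobiSym (a.natAbs : ℤ) r = jacobiSym a r := by
      intro a
      rcases Int.natAbs_eq a with h | h
      · rw [← h]
      · conv_rhs => rw [h]
        rw [jacobiSym.neg _ hro, ZMod.χ₄_nat_one_mod_four (by omega), one_mul]
    rw [jacobiSym.quadratic_reciprocity_one_mod_four (by omega) (hodd _), habs]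
    rw [jacobiSym.quadratic_reciprocity_one_mod_four (by omega) (hodd _), habs] at hrm
    rw [← hrm]
    apply jacobiSym.mod_left'
    exact (Int.modEq_iff_dvd.mpr
      (natCast_dvd_sub_of_eq_prod hn hr (T := M * (t + r * j)) (T' := M * t) ⟨M * j, by ring⟩)).symm
  rcases jacobiSym.eq_one_or_neg_one hb with h | h
  · exact ⟨0, by rw [pow_zero, one_mul, h]⟩
  · exact ⟨1, by rw [pow_one, jacobiSym.mul_left, hsym, h]; rfl⟩

end AuxiliaryPrime

section GoodModulus

variable {K : Type*} [Field K] [NumberField K]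

lemma natCast_absNorm_mem_of_le {W : HeightOneSpectrum (𝓞 K)} {I : Ideal (𝓞 K)}
    (h : I ≤ W.asIdeal) : (Ideal.absNorm I : 𝓞 K) ∈ W.asIdeal :=
  h (Ideal.absNorm_mem I)

lemma absNorm_ne_zero_of_ne_bot {I : Ideal (𝓞 K)} (h : I ≠ ⊥) : Ideal.absNorm I ≠ 0 :=
  fun h0 => h (Ideal.absNorm_eq_zero_iff.mp h0)

lemma differentIdeal_le_of_natCast_mem_sq {W : HeightOneSpectrum (𝓞 K)} {l : ℕ} (hl : l.Prime)
    (h : (l : 𝓞 K) ∈ W.asIdeal ^ 2) : differentIdeal ℤ (𝓞 K) ≤ W.asIdeal := by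
  have : (Ideal.span {(l : ℤ)}).IsMaximal :=
    PrincipalIdealRing.isMaximal_of_irreducible (Nat.prime_iff_prime_int.mp hl).irreducible
  have h1 := pow_sub_one_dvd_differentIdeal ℤ (p := Ideal.span {(l : ℤ)}) W.asIdeal 2
    (by simpa using hl.ne_zero) (by
      rw [Ideal.map_span, Set.image_singleton, Ideal.dvd_span_singleton]
      simpa using h)
  exact Ideal.le_of_dvd (by simpa using h1)

theorem exists_isGoodModulus {γ β : 𝓞 K} (hγ : γ ≠ 0) (hβ : β ≠ 0) {c : ℕ} (hc : c ≠ 0) :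
    ∃ M : ℕ, M ≠ 0 ∧ c ∣ M ∧ IsGoodModulus γ M ∧
      ∀ W : HeightOneSpectrum (𝓞 K), (M : 𝓞 K) ∉ W.asIdeal → β ∉ W.asIdeal := by
  classical
  set z : 𝓞 K := (∏ x ∈ conjugates γ, x) *
    (∏ x ∈ conjugates γ, ∏ y ∈ conjugates γ, if x = y then 1 else x - y) * β with hz
  have hz0 : z ≠ 0 := by
    refine mul_ne_zero (mul_ne_zero (Finset.prod_ne_zero_iff.mpr fun x hx => ?_)
      (Finset.prod_ne_zero_iff.mpr fun x _ => Finset.prod_ne_zero_iff.mpr fun y _ => ?_)) hβ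
    · obtain ⟨σ, rfl⟩ := mem_conjugates.mp hx
      exact (smul_ne_zero_iff_ne σ).mpr hγ
    · split_ifs with h
      · exact one_ne_zero
      · exact sub_ne_zero.mpr h
  have hd0 : differentIdeal ℤ (𝓞 K) ≠ ⊥ := differentIdeal_ne_bot
  set a := Ideal.absNorm (Ideal.span {z})
  set d := Ideal.absNorm (differentIdeal ℤ (𝓞 K))
  have hzW : ∀ W : HeightOneSpectrum (𝓞 K), ((c * a * d : ℕ) : 𝓞 K) ∉ W.asIdeal →
      z ∉ W.asIdeal := by
    intro W hW hzW
    apply hW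
    push_cast
    refine W.asIdeal.mul_mem_right _ (W.asIdeal.mul_mem_left _ (natCast_absNorm_mem_of_le ?_))
    rwa [Ideal.span_singleton_le_iff_mem]
  refine ⟨c * a * d, mul_ne_zero (mul_ne_zero hc (absNorm_ne_zero_of_ne_bot (by simpa using hz0)))
    (absNorm_ne_zero_of_ne_bot hd0), Dvd.intro (a * d) (mul_assoc _ _ _).symm,
    fun W hW => ⟨fun l hl hlW => hW ?_, fun x hx hxW => hzW W hW ?_,
      fun x hx y hy hxy hxyW => hzW W hW ?_⟩, fun W hW hβW => hzW W hW ?_⟩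
  · push_cast
    exact W.asIdeal.mul_mem_left _
      (natCast_absNorm_mem_of_le (differentIdeal_le_of_natCast_mem_sq hl hlW))
  · refine W.asIdeal.mul_mem_right _ (W.asIdeal.mul_mem_right _ ?_)
    exact Ideal.mem_of_dvd _ (Finset.dvd_prod_of_mem _ hx) hxW
  · refine W.asIdeal.mul_mem_right _ (W.asIdeal.mul_mem_left _ ?_)
    refine Ideal.mem_of_dvd _ (Finset.dvd_prod_of_mem _ hx) ?_
    refine Ideal.mem_of_dvd _ (Finset.dvd_prod_of_mem _ hy) ?_
    rwa [if_neg hxy]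
  · exact W.asIdeal.mul_mem_left _ hβW

end GoodModulus

section Reduction

open Polynomial

/-- The integer to which `T ^ (2 * P.natDegree) * P(γ)` reduces modulo `1 + T ^ 2 * γ`. -/
noncomputable def reducedValue (P : ℤ[X]) (T : ℤ) : ℤ :=
  ∑ i ∈ Finset.range (P.natDegree + 1), P.coeff i * (-1) ^ i * T ^ (2 * (P.natDegree - i))

lemma sub_reducedValue_mem {R : Type*} [CommRing R] {I : Ideal R} {γ : R} {T : ℤ}
    (h : 1 + (T : R) ^ 2 * γ ∈ I) (P : ℤ[X]) :
    (T : R) ^ (2 * P.natDegree) * aeval γ P - (reducedValue P T : R) ∈ I := by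
  rw [← Ideal.Quotient.eq]
  have h1 : (Ideal.Quotient.mk I T) ^ 2 * Ideal.Quotient.mk I γ = -1 := by
    rw [← Ideal.Quotient.eq_zero_iff_mem] at h
    rw [← map_pow, ← map_mul, eq_neg_iff_add_eq_zero, add_comm, ← map_one (Ideal.Quotient.mk I),
      ← map_add, h]
  rw [reducedValue, aeval_eq_sum_range, Finset.mul_sum, Int.cast_sum, map_sum, map_sum]
  refine Finset.sum_congr rfl fun i hi => ?_
  have hi' : i ≤ P.natDegree := Nat.lt_succ_iff.mp (Finset.mem_range.mp hi)
  obtain ⟨d, hd⟩ := Nat.exists_eq_add_of_le hi'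
  rw [hd, Nat.add_sub_cancel_left, zsmul_eq_mul]
  push_cast
  simp only [map_mul, map_pow, map_neg, map_one]
  rw [← h1]
  ring

variable {K : Type*} [Field K] [NumberField K] {γ : 𝓞 K} {M : ℕ} {T n : ℤ}

lemma gcd_reducedValue_eq_one (P : ℤ[X]) (hT : (M : ℤ) ∣ T)
    (hβ : ∀ W : HeightOneSpectrum (𝓞 K), (M : 𝓞 K) ∉ W.asIdeal → aeval γ P ∉ W.asIdeal)
    (hn : (n : 𝓞 K) = ∏ x ∈ conjugates γ, (1 + (T : 𝓞 K) ^ 2 * x)) :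
    Int.gcd (reducedValue P T) n.natAbs = 1 := by
  by_contra hne
  obtain ⟨l, hl, hlg⟩ := Nat.exists_prime_and_dvd hne
  have h1 : (l : ℤ) ∣ reducedValue P T := (Int.natCast_dvd_natCast.mpr hlg).trans (Int.gcd_dvd_left _ _)
  have h2 : (l : ℤ) ∣ n := by
    have := (Int.natCast_dvd_natCast.mpr hlg).trans (Int.gcd_dvd_right (reducedValue P T) _)
    exact Int.natCast_dvd.mpr (Int.natCast_dvd_natCast.mp this)
  obtain ⟨W, hlW, hu⟩ := exists_mem_one_add_mem hn hl h2 (self_mem_conjugates γ)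
  have h3 := (intCast_mem_iff_dvd hl hlW).mpr h1
  have h4 := (Ideal.add_mem_iff_left _ h3).mpr (sub_reducedValue_mem hu P)
  rw [sub_add_cancel] at h4
  have hM := natCast_notMem_of_one_add_mem hT hu
  rcases W.isPrime.mem_or_mem h4 with h | h
  · exact intCast_notMem_of_one_add_mem hu (W.isPrime.mem_of_pow_mem _ h)
  · exact hβ W hM h

end Reduction

section TamePair

open Polynomial

lemma nearSquare_of_sub_mem {K : Type*} [Field K] [NumberField K]
    {w : HeightOneSpectrum (𝓞 K)} {x s m : 𝓞 K} (hx : x ∉ w.asIdeal) (hs : s ∉ w.asIdeal)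
    (h : s ^ 2 * x - m ^ 2 ∈ w.asIdeal) : (w.valuation K).NearSquare (algebraMap (𝓞 K) K x) := by
  have hs0 : algebraMap (𝓞 K) K s ≠ 0 := by
    intro h0
    rw [map_eq_zero_iff _ (FaithfulSMul.algebraMap_injective (𝓞 K) K)] at h0
    exact hs (h0 ▸ w.asIdeal.zero_mem)
  refine Valuation.NearSquare.of_mul_sq hs0 ⟨algebraMap (𝓞 K) K m, ?_⟩
  have h1 : w.valuation K (algebraMap (𝓞 K) K x * algebraMap (𝓞 K) K s ^ 2) = 1 := by
    rw [map_mul, map_pow, w.valuation_eq_one_iff_notMem.mpr hx,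
      w.valuation_eq_one_iff_notMem.mpr hs, one_pow, mul_one]
  rw [h1, ← map_pow, ← map_pow, ← map_mul, ← map_sub, HeightOneSpectrum.valuation_lt_one_iff_mem,
    mul_comm]
  exact h

lemma squareValue_of_notMem {K : Type*} [Field K] [NumberField K]
    {w : HeightOneSpectrum (𝓞 K)} {x : 𝓞 K} (hx : x ∉ w.asIdeal) :
    (w.valuation K).SquareValue (algebraMap (𝓞 K) K x) :=
  ⟨1, one_ne_zero, by rw [w.valuation_eq_one_iff_notMem.mpr hx, one_pow, map_one]⟩

variable {k : Type*} [Field k] [NumberField k]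

omit [NumberField k] in
lemma exists_mem_iff_algebraMap_mem (N : Type*) [Field N] [NumberField N] [Algebra k N]
    (w : HeightOneSpectrum (𝓞 k)) :
    ∃ W : HeightOneSpectrum (𝓞 N), ∀ x : 𝓞 k, algebraMap (𝓞 k) (𝓞 N) x ∈ W.asIdeal ↔
      x ∈ w.asIdeal := by
  have := w.isPrime
  obtain ⟨Q, hQ, hQw⟩ := Ideal.exists_ideal_over_prime_of_isIntegral_of_isDomain w.asIdeal
    (S := 𝓞 N) (by
      rw [(RingHom.injective_iff_ker_eq_bot _).mp
        (FaithfulSMul.algebraMap_injective (𝓞 k) (𝓞 N))]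
      exact bot_le)
  refine ⟨⟨Q, hQ, ?_⟩, fun x => ?_⟩
  · rintro rfl
    refine w.ne_bot (hQw.symm.trans ?_)
    exact (RingHom.injective_iff_ker_eq_bot _).mp
        (FaithfulSMul.algebraMap_injective (𝓞 k) (𝓞 N))
  · change algebraMap (𝓞 k) (𝓞 N) x ∈ Q ↔ _
    rw [← Ideal.mem_comap, hQw]

theorem exists_tameSymbolSquare {γ : 𝓞 k} (hγ : γ ≠ 0) {P : ℤ[X]} (hP : aeval γ P ≠ 0)
    {p : ℕ} (hp : p.Prime) :
    ∃ (M r : ℕ) (t : ℤ), M ≠ 0 ∧ 8 * p ∣ M ∧ r ≠ 0 ∧ r ≡ 1 [MOD 8 * p] ∧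
      ∀ T : ℤ, (∃ j : ℤ, T = M * (t + r * j)) →
        1 + (T : 𝓞 k) ^ 2 * γ ≠ 0 ∧ ∃ e q : ℕ, q.Prime ∧ q % 8 = 1 ∧ jacobiSym p q = 1 ∧
        ∀ w : HeightOneSpectrum (𝓞 k), ((M * r : ℕ) : 𝓞 k) ∉ w.asIdeal →
          (w.valuation k).TameSymbolSquare
            (algebraMap (𝓞 k) k (γ * (1 + (T : 𝓞 k) ^ 2 * γ)))
            (algebraMap (𝓞 k) k (r ^ e * aeval γ P * q)) := by
  have : Algebra.IsAlgebraic ℚ (AlgebraicClosure k) := Algebra.IsAlgebraic.trans ℚ k _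
  have : IsAlgClosure ℚ (AlgebraicClosure k) := ⟨inferInstance, inferInstance⟩
  have : Normal ℚ (AlgebraicClosure k) := IsAlgClosure.normal ℚ _
  let N := IntermediateField.normalClosure ℚ k (AlgebraicClosure k)
  have : NumberField N := { }
  have : Normal ℚ N := normalClosure.normal ℚ k (AlgebraicClosure k)
  have : IsGalois ℚ N := ⟨⟩
  have hinj := FaithfulSMul.algebraMap_injective (𝓞 k) (𝓞 N)
  set g := algebraMap (𝓞 k) (𝓞 N) γ with hg
  have hgP : aeval g P = algebraMap (𝓞 k) (𝓞 N) (aeval γ P) := by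
    rw [hg]
    exact aeval_algHom_apply (algebraMap (𝓞 k) (𝓞 N)).toIntAlgHom γ P
  have hg0 : g ≠ 0 := (map_ne_zero_iff _ hinj).mpr hγ
  have hgP0 : aeval g P ≠ 0 := by
    rw [hgP]
    exact (map_ne_zero_iff _ hinj).mpr hP
  obtain ⟨M, hM0, hpM, hgood, hβ⟩ := exists_isGoodModulus hg0 hgP0
    (mul_ne_zero (by norm_num : 8 ≠ 0) hp.ne_zero)
  choose n hn using exists_intCast_eq_prod_conjugates g
  obtain ⟨r, t, hr0, hr1, hrt⟩ := exists_correcting_prime hn hp hpM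
  have h2M : 2 ∣ M := (Dvd.intro (4 * p) (by ring)).trans hpM
  refine ⟨M, r, t, hM0, hpM, hr0, hr1, ?_⟩
  rintro T ⟨j, hTj⟩
  have hT : (M : ℤ) ∣ T := ⟨_, hTj⟩
  have hn0 : n T ≠ 0 := ne_zero_of_eq_prod hT (hn T) h2M
  obtain ⟨e, he⟩ := hrt j (reducedValue P T)
    (hTj ▸ gcd_reducedValue_eq_one P hT hβ (hn T))
  rw [← hTj] at he
  obtain ⟨q, hq, hqn, hq8, hpq, hl, hW⟩ := exists_prime_square_conditions hgood hT (hn T) hg0 h2M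
    hp ((Dvd.intro_left 8 rfl).trans hpM) he (n T).natAbs
  have hu : ∀ W : HeightOneSpectrum (𝓞 N), 1 + (T : 𝓞 N) ^ 2 * g ∈ W.asIdeal →
      (n T : 𝓞 N) ∈ W.asIdeal := by
    intro W hW
    rw [hn]
    exact Ideal.mem_of_dvd _ (Finset.dvd_prod_of_mem _ (self_mem_conjugates g)) hW
  have hmap : algebraMap (𝓞 k) (𝓞 N) (1 + (T : 𝓞 k) ^ 2 * γ) = 1 + (T : 𝓞 N) ^ 2 * g := by
    simp [hg]
  refine ⟨fun h0 => ?_, e, q, hq, hq8, hpq, fun w hw => ?_⟩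
  · rw [h0, map_zero] at hmap
    have : (n T : 𝓞 N) = 0 := by
      rw [hn]
      exact Finset.prod_eq_zero (self_mem_conjugates g) hmap.symm
    exact hn0 (by exact_mod_cast this)
  obtain ⟨W, hWw⟩ := exists_mem_iff_algebraMap_mem N w
  have hMw : (M : 𝓞 k) ∉ w.asIdeal := fun h => hw (by
    push_cast
    exact w.asIdeal.mul_mem_right _ h)
  have hrw : (r : 𝓞 k) ∉ w.asIdeal := fun h => hw (by
    push_cast
    exact w.asIdeal.mul_mem_left _ h)
  have hMW : (M : 𝓞 N) ∉ W.asIdeal := by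
    rwa [← map_natCast (algebraMap (𝓞 k) (𝓞 N)), hWw]
  have hγw : γ ∉ w.asIdeal := by
    rw [← hWw]
    exact (hgood W hMW).2.1 _ (self_mem_conjugates g)
  have hβw : aeval γ P ∉ w.asIdeal := by
    rw [← hWw, ← hgP]
    exact hβ W hMW
  have hrβw : (r : 𝓞 k) ^ e * aeval γ P ∉ w.asIdeal := fun h =>
    (w.isPrime.mem_or_mem h).elim (fun h => hrw (w.isPrime.mem_of_pow_mem _ h)) hβw
  have hiff : (1 + (T : 𝓞 k) ^ 2 * γ) ∈ w.asIdeal ↔ 1 + (T : 𝓞 N) ^ 2 * g ∈ W.asIdeal := by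
    rw [← hWw, hmap]
  by_cases huw : (1 + (T : 𝓞 k) ^ 2 * γ) ∈ w.asIdeal
  · obtain ⟨l, hlp, hlW⟩ := exists_prime_natCast_mem W
    have hln : (l : ℤ) ∣ n T := (intCast_mem_iff_dvd hlp hlW).mp (hu W (hiff.mp huw))
    have hlw : (l : 𝓞 k) ∈ w.asIdeal := by
      rwa [← hWw, map_natCast]
    obtain ⟨m, hm⟩ := hl l hlp hln
    have hqw : (q : 𝓞 k) ∉ w.asIdeal := by
      intro hqw
      rw [← Int.cast_natCast, intCast_mem_iff_dvd hlp hlw, Int.natCast_dvd_natCast,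
        Nat.prime_dvd_prime_iff_eq hlp hq] at hqw
      rw [← hqw] at hqn
      exact absurd (Nat.le_of_dvd (Int.natAbs_pos.mpr hn0) (Int.natCast_dvd.mp hln)) hqn.not_ge
    have hTw := intCast_notMem_of_one_add_mem huw
    refine Or.inr (Or.inr (Or.inl (nearSquare_of_sub_mem
      (s := (T : 𝓞 k) ^ P.natDegree) (m := (m : 𝓞 k)) ?_ ?_ ?_)))
    · exact fun h => (w.isPrime.mem_or_mem h).elim hrβw hqw
    · exact fun h => hTw (w.isPrime.mem_of_pow_mem _ h)
    · have h1 := w.asIdeal.mul_mem_left ((r : 𝓞 k) ^ e * q) (sub_reducedValue_mem huw P)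
      have h2 := (intCast_mem_iff_dvd hlp hlw).mpr hm
      push_cast at h2
      have h3 := w.asIdeal.add_mem h1 h2
      convert h3 using 1
      ring
  have hcw : γ * (1 + (T : 𝓞 k) ^ 2 * γ) ∉ w.asIdeal := fun h =>
    (w.isPrime.mem_or_mem h).elim hγw huw
  by_cases hqw : (q : 𝓞 k) ∈ w.asIdeal
  · obtain ⟨m, hm⟩ := hW W (by rwa [← map_natCast (algebraMap (𝓞 k) (𝓞 N)), hWw])
    refine Or.inr (Or.inl (nearSquare_of_sub_mem (s := 1) (m := (m : 𝓞 k)) hcw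
      w.isPrime.one_notMem ?_))
    rw [one_pow, one_mul, ← hWw, map_sub, map_mul, hmap, map_pow, map_intCast]
    exact hm
  · exact Or.inl ⟨squareValue_of_notMem hcw, squareValue_of_notMem fun h =>
      (w.isPrime.mem_or_mem h).elim hrβw hqw⟩

end TamePair
end NumberField

section Ramified

open WithZero

lemma not_squareValue_of_valuation_eq_exp_neg_one {K : Type*} [Field K] {w : Valuation K ℤᵐ⁰}
    {b c : K} (hb : b ≠ 0) (hc : w c = exp (-1 : ℤ)) : ¬ w.SquareValue (b ^ 2 * c) := by
  intro h
  obtain ⟨y, hy, h⟩ := Valuation.squareValue_of_mul_left (Valuation.squareValue_sq hb) h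
  have hwy : w y ≠ 0 := (Valuation.ne_zero_iff w).mpr hy
  rw [hc, map_pow, ← exp_log hwy, ← exp_nsmul, exp_inj, nsmul_eq_mul] at h
  push_cast at h
  omega

lemma sq_notMem_ternaryValues {K Γ₀ : Type*} [Field K] [CharZero K]
    [LinearOrderedCommGroupWithZero Γ₀] {w : Valuation K Γ₀} {d b : K}
    (hd : ∀ t, w t ≤ 1 → w (t ^ 2 + t - d) = 1) (hb : ¬ w.SquareValue b) {e : K} (he : e ≠ 0) :
    e ^ 2 ∉ ternaryValues K (1 + 4 * d) b := by
  have hd1 : w d = 1 := by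
    have := hd 0 (by simp)
    simpa using this
  have hnorm : ∀ t, w.SquareValue (t ^ 2 + t - d) := by
    intro t
    by_cases ht : w t ≤ 1
    · exact ⟨1, one_ne_zero, by rw [hd t ht, one_pow, map_one]⟩
    · rw [not_le] at ht
      have ht0 : t ≠ 0 := by
        rintro rfl
        rw [map_zero] at ht
        exact not_lt_zero ht
      refine ⟨t, ht0, ?_⟩
      rw [add_sub_assoc]
      refine Valuation.map_add_eq_of_lt_left w ?_
      refine (w.map_sub _ _).trans_lt ?_
      have h2 : w t < w (t ^ 2) := by
        rw [map_pow, pow_two]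
        exact lt_mul_of_one_lt_left (zero_lt_one.trans ht) ht
      exact max_lt h2 (hd1 ▸ ht.trans h2)
  have hN : ∀ e x : K, (e ≠ 0 ∨ x ≠ 0) → w.SquareValue (e ^ 2 - (1 + 4 * d) * x ^ 2) := by
    intro e x hex
    by_cases hx : x = 0
    · rw [hx, zero_pow two_ne_zero, mul_zero, sub_zero]
      exact Valuation.squareValue_sq (hex.resolve_right (not_not.mpr hx))
    · have h2x : 2 * x ≠ 0 := mul_ne_zero two_ne_zero hx
      have h := (Valuation.squareValue_sq (w := w) h2x).mul (hnorm ((e - x) / (2 * x)))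
      convert h using 1
      field_simp
      ring
  rintro ⟨x, y, z, h⟩
  have h' : e ^ 2 - (1 + 4 * d) * x ^ 2 = (y ^ 2 - (1 + 4 * d) * z ^ 2) * b := by
    rw [h]
    ring
  have h1 := hN e x (Or.inl he)
  rw [h'] at h1
  by_cases hyz : y ≠ 0 ∨ z ≠ 0
  · exact hb (Valuation.squareValue_of_mul_left (hN y z hyz) h1)
  · push Not at hyz
    exact h1.ne_zero (by simp [hyz.1, hyz.2])

end Ramified

namespace NumberField

section Setup

open HeightOneSpectrum WithZero Polynomial Topology
open scoped IntermediateField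

variable {k : Type*} [Field k] [NumberField k] {v : HeightOneSpectrum (𝓞 k)}

lemma valued_sq_add_sub_eq_one {d : 𝓞 k} (hd : ∀ x : 𝓞 k, x ^ 2 + x - d ∉ v.asIdeal)
    {t : v.adicCompletion k} (ht : Valued.v t ≤ 1) :
    Valued.v (t ^ 2 + t - algebraMap k (v.adicCompletion k) (algebraMap (𝓞 k) k d)) = 1 := by
  set f := algebraMap k (v.adicCompletion k) with hf
  have hvf : ∀ x : k, Valued.v (f x) = v.valuation k x := valuedAdicCompletion_eq_valuation' v
  obtain ⟨y, hy⟩ : ∃ y : k, Valued.v (f y - t) < 1 := by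
    have hnhd : {x : v.adicCompletion k | Valued.v (x - t) < 1} ∈ 𝓝 t := by
      rw [Valued.mem_nhds]
      refine ⟨1, fun x hx => ?_⟩
      rw [Set.mem_ofPred_eq, Units.val_one, Valuation.restrict_lt_one_iff] at hx
      exact hx
    obtain ⟨_, ⟨y, rfl⟩, hy⟩ :=
      (denseRange_algebraMap (v := v) (K := k)).inter_nhds_nonempty hnhd
    exact ⟨y, hy⟩
  have hy1 : v.valuation k y ≤ 1 := by
    rw [← hvf, ← sub_add_cancel (f y) t]
    exact (Valuation.map_add _ _ _).trans (max_le hy.le ht)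
  obtain ⟨x, hx⟩ := v.exists_valuation_sub_lt_of_integer hy1 1
  set a := f (algebraMap (𝓞 k) k x) with ha
  have hxt : Valued.v (t - a) < 1 := by
    have h1 : Valued.v (a - f y) < 1 := by
      rw [ha, ← map_sub, hvf]
      exact hx
    rw [show t - a = -((a - f y) + (f y - t)) by ring, Valuation.map_neg]
    exact (Valuation.map_add _ _ _).trans_lt (max_lt h1 hy)
  have ha1 : Valued.v a ≤ 1 := by
    rw [ha, hvf]
    exact v.valuation_le_one x
  have hx1 : Valued.v (a ^ 2 + a - f (algebraMap (𝓞 k) k d)) = 1 := by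
    rw [ha, ← map_pow, ← map_add, ← map_sub, hvf, ← map_pow, ← map_add, ← map_sub]
    exact v.valuation_eq_one_iff_notMem.mpr (hd x)
  rw [← hx1, show t ^ 2 + t - f (algebraMap (𝓞 k) k d) =
    (t - a) * (t + a + 1) + (a ^ 2 + a - f (algebraMap (𝓞 k) k d)) by ring]
  refine Valuation.map_add_eq_of_lt_right _ ?_
  rw [hx1, map_mul]
  refine (mul_le_of_le_one_right' ?_).trans_lt hxt
  exact (Valued.v.map_add _ _).trans (max_le ((Valued.v.map_add _ _).trans
    (max_le ht ha1)) (map_one Valued.v).le)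

lemma exists_forall_sq_add_sub_notMem (v : HeightOneSpectrum (𝓞 k)) :
    ∃ d : 𝓞 k, ∀ x : 𝓞 k, x ^ 2 + x - d ∉ v.asIdeal := by
  have : Finite (𝓞 k ⧸ v.asIdeal) := Ideal.finiteQuotientOfFreeOfNeBot _ v.ne_bot
  have := v.isPrime
  have hns : ¬ Function.Surjective fun x : 𝓞 k ⧸ v.asIdeal => x ^ 2 + x := by
    intro h
    have := Finite.injective_iff_surjective.mpr h
      (show (fun x : 𝓞 k ⧸ v.asIdeal => x ^ 2 + x) 0 = (fun x => x ^ 2 + x) (-1) by simp)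
    exact one_ne_zero (neg_eq_zero.mp this.symm)
  rw [Function.Surjective] at hns
  push Not at hns
  obtain ⟨b, hb⟩ := hns
  obtain ⟨d, rfl⟩ := Ideal.Quotient.mk_surjective b
  refine ⟨d, fun x hx => hb (Ideal.Quotient.mk _ x) ?_⟩
  rw [← map_pow, ← map_add]
  exact (Ideal.Quotient.mk_eq_mk_iff_sub_mem _ _).mpr hx

lemma exists_primitive_sq_add_sub_notMem (v : HeightOneSpectrum (𝓞 k)) :
    ∃ d : 𝓞 k, ℚ⟮algebraMap (𝓞 k) k d⟯ = ⊤ ∧ ∀ x : 𝓞 k, x ^ 2 + x - d ∉ v.asIdeal := by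
  obtain ⟨d, hd⟩ := exists_forall_sq_add_sub_notMem v
  obtain ⟨p, hp, hpv⟩ := exists_prime_natCast_mem v
  obtain ⟨α, hα⟩ := Field.exists_primitive_element ℚ k
  obtain ⟨y, hy0, hy⟩ := ((IsFractionRing.isAlgebraic_iff ℤ ℚ k).mpr
    (Algebra.IsAlgebraic.isAlgebraic (R := ℚ) α)).exists_integral_multiple
  obtain ⟨a, ha⟩ : ∃ a : 𝓞 k, algebraMap (𝓞 k) k a = y • α := ⟨⟨_, hy⟩, rfl⟩
  have : Finite (IntermediateField ℚ k) :=
    (Field.exists_primitive_element_iff_finite_intermediateField ℚ k).mp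
      ⟨inferInstance, α, hα⟩
  obtain ⟨i, j, hij, h⟩ := Finite.exists_ne_map_eq_of_infinite
    fun j : ℕ => ℚ⟮algebraMap (𝓞 k) k (d + j * p * a)⟯
  refine ⟨d + i * p * a, ?_, fun x hx => hd x ?_⟩
  · rw [eq_top_iff, ← hα, IntermediateField.adjoin_simple_le_iff]
    have hi := IntermediateField.mem_adjoin_simple_self ℚ (algebraMap (𝓞 k) k (d + i * p * a))
    have hj := IntermediateField.mem_adjoin_simple_self ℚ (algebraMap (𝓞 k) k (d + j * p * a))
    rw [← h] at hj
    have hsub := sub_mem hi hj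
    have hc : (((i : ℚ) - j) * p * y : ℚ) ≠ 0 := by
      refine mul_ne_zero (mul_ne_zero (sub_ne_zero.mpr ?_) ?_) ?_
      · exact_mod_cast hij
      · exact_mod_cast hp.ne_zero
      · exact_mod_cast hy0
    have heq : algebraMap (𝓞 k) k (d + i * p * a) - algebraMap (𝓞 k) k (d + j * p * a) =
        (((i : ℚ) - j) * p * y : ℚ) • α := by
      rw [Algebra.smul_def]
      simp only [map_add, map_mul, map_natCast, ha, map_sub, map_intCast, zsmul_eq_mul]
      ring
    rw [heq] at hsub
    have := IntermediateField.smul_mem _ hsub (x := (((i : ℚ) - j) * p * y)⁻¹)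
    rwa [inv_smul_smul₀ hc] at this
  · have := v.asIdeal.add_mem hx (v.asIdeal.mul_mem_left (i * a) hpv)
    convert this using 1
    ring

lemma exists_aeval_eq_sq_mul {γ : 𝓞 k} (hγ : ℚ⟮algebraMap (𝓞 k) k γ⟯ = ⊤) (c : k) :
    ∃ (P : ℤ[X]) (m : ℤ), m ≠ 0 ∧ algebraMap (𝓞 k) k (aeval γ P) = (m : k) ^ 2 * c := by
  obtain ⟨Q, hQ⟩ : ∃ Q : ℚ[X], aeval (algebraMap (𝓞 k) k γ) Q = c := by
    have hc : c ∈ ℚ⟮algebraMap (𝓞 k) k γ⟯.toSubalgebra := by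
      rw [hγ]
      trivial
    rwa [IntermediateField.adjoin_simple_toSubalgebra_of_isAlgebraic
      (Algebra.IsAlgebraic.isAlgebraic _), Algebra.adjoin_singleton_eq_range_aeval] at hc
  obtain ⟨m, hm, h⟩ := IsLocalization.integerNormalization_spec (nonZeroDivisors ℤ) Q
  refine ⟨C m * IsLocalization.integerNormalization (nonZeroDivisors ℤ) Q, m,
    nonZeroDivisors.ne_zero hm, ?_⟩
  rw [← aeval_algebraMap_apply, map_mul, aeval_C,
    ← aeval_map_algebraMap ℚ _ (IsLocalization.integerNormalization _ Q), h, map_zsmul, hQ,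
    zsmul_eq_mul, eq_intCast]
  ring

end Setup

section LocalSquareCriteria

open HeightOneSpectrum

variable {k : Type*} [Field k] [NumberField k] {v : HeightOneSpectrum (𝓞 k)}

lemma mem_localSquares_of_eq_one_add {x y : 𝓞 k} (hy : y ∈ v.asIdeal) (h : x = 1 + 4 * y) :
    algebraMap (𝓞 k) k x ∈ localSquares v := by
  refine mem_localSquares_of_valuation_lt ?_
  rw [h, map_add, map_one, map_mul, map_ofNat, add_sub_cancel_left, map_mul]
  have h4 : v.valuation k 4 ≠ 0 := (Valuation.ne_zero_iff _).mpr (by norm_num)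
  exact mul_lt_of_lt_one_right (zero_lt_iff.mpr h4) (v.valuation_lt_one_iff_mem y |>.mpr hy)

lemma mem_localSquares_of_dvd_sub_one {p : ℕ} (hpv : (p : 𝓞 k) ∈ v.asIdeal) {n : ℤ}
    (h : (8 * p : ℤ) ∣ n - 1) : (n : k) ∈ localSquares v := by
  obtain ⟨s, hs⟩ := h
  rw [← map_intCast (algebraMap (𝓞 k) k)]
  refine mem_localSquares_of_eq_one_add (y := 2 * s * p) (v.asIdeal.mul_mem_left _ hpv) ?_
  rw [eq_add_of_sub_eq hs]
  push_cast
  ring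

lemma natCast_mem_localSquares_of_jacobiSym_eq_one {p q : ℕ} (hp : p.Prime)
    (hpv : (p : 𝓞 k) ∈ v.asIdeal) (hq : q % 8 = 1) (h : jacobiSym p q = 1) :
    (q : k) ∈ localSquares v := by
  rw [← Int.cast_natCast]
  rcases hp.eq_two_or_odd' with rfl | hodd
  · rw [← map_intCast (algebraMap (𝓞 k) k)]
    refine mem_localSquares_of_eq_one_add (y := ((q / 8 : ℕ) : 𝓞 k) * (2 : ℕ))
      (v.asIdeal.mul_mem_left _ hpv) ?_
    have hq' : q = 8 * (q / 8) + 1 := by omega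
    generalize q / 8 = s at hq'
    rw [hq']
    push_cast
    ring
  · rw [jacobiSym.quadratic_reciprocity_one_mod_four' hodd (by omega)] at h
    obtain ⟨m, hm⟩ := exists_intCast_dvd_sub_sq hp h
    have hpm : ¬ (p : ℤ) ∣ m := by
      intro hpm
      have hpq : (p : ℤ) ∣ q := by
        have := dvd_add hm (hpm.mul_left m)
        rwa [← pow_two, sub_add_cancel] at this
      rw [jacobiSym.mod_left, Int.emod_eq_zero_of_dvd hpq,
        jacobiSym.zero_left hp.one_lt] at h
      exact zero_ne_one h
    have hm0 : (m : k) ≠ 0 := by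
      rintro h0
      rw [Int.cast_eq_zero] at h0
      exact hpm (h0 ▸ dvd_zero _)
    have hval : ∀ a : ℤ, ¬ (p : ℤ) ∣ a → v.valuation k (a : k) = 1 := by
      intro a ha
      rw [← map_intCast (algebraMap (𝓞 k) k), v.valuation_eq_one_iff_notMem]
      exact fun h => ha ((intCast_mem_iff_dvd hp hpv).mp h)
    have h4 : v.valuation k 4 = 1 := by
      have := hval 4 fun h => by
        have h2 : p ∣ 2 ^ 2 := by exact_mod_cast h
        have := (Nat.prime_dvd_prime_iff_eq hp Nat.prime_two).mp (hp.dvd_of_dvd_pow h2)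
        rw [this] at hodd
        exact absurd hodd (by decide)
      exact_mod_cast this
    rw [show (((q : ℤ)) : k) = (m : k) ^ 2 * ((q : ℤ) / (m : k) ^ 2) by field_simp]
    refine mul_mem_localSquares (sq_mem_localSquares hm0) (mem_localSquares_of_valuation_lt ?_)
    rw [h4, show ((q : ℤ) : k) / (m : k) ^ 2 - 1 = (((q - m ^ 2 : ℤ)) : k) / (m : k) ^ 2 by
      push_cast
      field_simp, map_div₀, map_pow, hval m hpm, one_pow, div_one,
      ← map_intCast (algebraMap (𝓞 k) k), v.valuation_lt_one_iff_mem]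
    exact (intCast_mem_iff_dvd hp hpv).mpr hm

lemma ternaryValues_mul_localSquare {a b s : k} (hs : s ∈ localSquares v) :
    ternaryValues (v.adicCompletion k) (algebraMap k _ a) (algebraMap k _ (b * s)) =
      ternaryValues (v.adicCompletion k) (algebraMap k _ a) (algebraMap k _ b) := by
  obtain ⟨-, e, he, h⟩ := hs
  rw [map_mul, ← h, ternaryValues_mul_sq _ _ he]

lemma ternaryValues_mul_localSquare_mul_localSquare {a b s t : k} (hs : s ∈ localSquares v)
    (ht : t ∈ localSquares v) :
    ternaryValues (v.adicCompletion k) (algebraMap k _ (a * s)) (algebraMap k _ (b * t)) =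
      ternaryValues (v.adicCompletion k) (algebraMap k _ a) (algebraMap k _ b) := by
  rw [ternaryValues_mul_localSquare ht, ternaryValues_comm, ternaryValues_mul_localSquare hs,
    ternaryValues_comm]

end LocalSquareCriteria

section Main

open HeightOneSpectrum MvPolynomial

universe u

variable {k : Type u} [Field k] [NumberField k] (v : HeightOneSpectrum (𝓞 k))

/-- No nonzero square of the completion at `v` is represented by the ternary form attached to
`a` and `b`. -/
def IsRamifiedPair (a b : k) : Prop :=
  ∀ e : v.adicCompletion k, e ≠ 0 →
    e ^ 2 ∉ ternaryValues (v.adicCompletion k) (algebraMap k _ a) (algebraMap k _ b)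

/-- The union of the value sets of the ternary forms attached to the pairs in `F` ramified at
`v`. -/
def ramifiedValues (F : Set (k × k)) : Set k :=
  {c | ∃ p ∈ {p ∈ F | IsRamifiedPair v p.1 p.2}, c ∈ ternaryValues k p.1 p.2}

variable {v}

lemma algebraMap_mem_ternaryValues {K L : Type*} [Field K] [Field L] [Algebra K L] {a b c : K}
    (h : c ∈ ternaryValues K a b) :
    algebraMap K L c ∈ ternaryValues L (algebraMap K L a) (algebraMap K L b) := by
  obtain ⟨x, y, z, rfl⟩ := h
  exact ⟨algebraMap K L x, algebraMap K L y, algebraMap K L z, by simp⟩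

lemma notMem_localSquares_of_mem_ramifiedValues {F : Set (k × k)} {c : k}
    (h : c ∈ ramifiedValues v F) : c ∉ localSquares v := by
  obtain ⟨p, ⟨-, hp⟩, hc⟩ := h
  rintro ⟨-, e, he, hec⟩
  exact hp e he (hec ▸ algebraMap_mem_ternaryValues hc)

lemma isExistentialPoly_ramifiedValues {F : Set (k × k)} (hF : F.Finite) {σ : Type}
    (f : MvPolynomial σ k) :
    IsExistentialPoly (fun a : σ → k => eval a f ∈ ramifiedValues v F) := by
  refine (IsExistentialPoly.finite_or (s := {p ∈ F | IsRamifiedPair v p.1 p.2})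
    (hF.subset (Set.sep_subset F _)) fun p _ =>
    IsExistentialPoly.exists' (τ := Fin 3) (IsExistentialPoly.eq_zero
      (rename Sum.inl f - (C p.1 * X (Sum.inr 0) ^ 2 + C p.2 * X (Sum.inr 1) ^ 2 -
        C (p.1 * p.2) * X (Sum.inr 2) ^ 2)))).congr' fun a => ?_
  refine exists_congr fun p => and_congr_right fun _ => ?_
  have hcomp : ∀ b : Fin 3 → k, (Sum.elim a b) ∘ Sum.inl = a := fun _ => rfl
  simp only [map_sub, map_add, map_mul, map_pow, eval_rename, hcomp, eval_C, eval_X,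
    Sum.elim_inr, sub_eq_zero]
  constructor
  · rintro ⟨x, y, z, h⟩
    exact ⟨![x, y, z], h⟩
  · rintro ⟨b, h⟩
    exact ⟨b 0, b 1, b 2, h⟩

lemma exists_isRamifiedPair (v : HeightOneSpectrum (𝓞 k)) :
    ∃ (γ : 𝓞 k) (P : Polynomial ℤ), γ ≠ 0 ∧ Polynomial.aeval γ P ≠ 0 ∧
      IsRamifiedPair v (algebraMap (𝓞 k) k γ) (algebraMap (𝓞 k) k (Polynomial.aeval γ P)) := by
  obtain ⟨d, hd, hdv⟩ := exists_primitive_sq_add_sub_notMem v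
  obtain ⟨π, hπ⟩ := v.valuation_exists_uniformizer k
  have hprim : IntermediateField.adjoin ℚ {algebraMap (𝓞 k) k (1 + 4 * d)} = ⊤ := by
    rw [eq_top_iff, ← hd, IntermediateField.adjoin_simple_le_iff]
    have h := IntermediateField.mem_adjoin_simple_self ℚ (algebraMap (𝓞 k) k (1 + 4 * d))
    have h' := IntermediateField.smul_mem _ (sub_mem h (one_mem _)) (x := (4 : ℚ)⁻¹)
    rw [show algebraMap (𝓞 k) k (1 + 4 * d) - 1 = (4 : ℚ) • algebraMap (𝓞 k) k d by
      rw [Algebra.smul_def, map_add, map_one, map_mul, map_ofNat, map_ofNat]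
      ring, inv_smul_smul₀ (by norm_num)] at h'
    exact h'
  obtain ⟨P, m, hm, hP⟩ := exists_aeval_eq_sq_mul hprim π
  have hm' : (m : v.adicCompletion k) ≠ 0 := by
    rw [← map_intCast (algebraMap k (v.adicCompletion k)), map_ne_zero]
    exact_mod_cast hm
  have hπ0 : π ≠ 0 := by
    rintro rfl
    rw [map_zero] at hπ
    exact WithZero.exp_ne_zero hπ.symm
  have : CharZero (v.adicCompletion k) :=
    charZero_of_injective_algebraMap (algebraMap k (v.adicCompletion k)).injective
  have hram : IsRamifiedPair v (algebraMap (𝓞 k) k (1 + 4 * d))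
      (algebraMap (𝓞 k) k (Polynomial.aeval (1 + 4 * d) P)) := by
    intro e he
    rw [hP, map_add, map_mul, map_one, map_ofNat, map_add, map_mul, map_one, map_ofNat, map_mul,
      map_pow, map_intCast]
    refine sq_notMem_ternaryValues (w := Valued.v) (fun t ht => valued_sq_add_sub_eq_one hdv ht)
      (not_squareValue_of_valuation_eq_exp_neg_one hm' ?_) he
    rw [← hπ]
    exact valuedAdicCompletion_eq_valuation' v π
  refine ⟨1 + 4 * d, P, fun h => ?_, fun h => ?_, hram⟩
  · refine hdv (2 * d) ?_
    rw [show (2 * d) ^ 2 + 2 * d - d = d * (1 + 4 * d) by ring, h, mul_zero]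
    exact v.asIdeal.zero_mem
  · rw [h, map_zero, eq_comm, mul_eq_zero] at hP
    exact hP.elim (pow_ne_zero 2 (by exact_mod_cast hm)) hπ0

theorem exists_bounded_existential (v : HeightOneSpectrum (𝓞 k)) :
    ∃ D : Set k, IsExistentialPoly (fun a : Fin 1 → k => a 0 ∈ D) ∧ (∀ n : ℤ, (n : k) ∈ D) ∧
      ∃ c : k, ∀ j ∈ D, v.valuation k j ≤ v.valuation k c := by
  obtain ⟨γ, P, hγ, hβ, hram⟩ := exists_isRamifiedPair v
  obtain ⟨p, hp, hpv⟩ := exists_prime_natCast_mem v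
  obtain ⟨M, r, t, hM, hpM, hr, hrp, hT⟩ := exists_tameSymbolSquare hγ hβ hp
  have hMr : ((M * r : ℕ) : 𝓞 k) ≠ 0 := Nat.cast_ne_zero.mpr (mul_ne_zero hM hr)
  obtain ⟨F, hF, hFS⟩ := exists_finite_ternaryValues k
    {w | ((M * r : ℕ) : 𝓞 k) ∈ w.asIdeal} (finite_setOf_mem hMr)
  have hinj := FaithfulSMul.algebraMap_injective (𝓞 k) k
  set g := algebraMap (𝓞 k) k γ with hg
  have hg0 : g ≠ 0 := (map_ne_zero_iff _ hinj).mpr hγ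
  have hrk : (r : k) ≠ 0 := Nat.cast_ne_zero.mpr hr
  have hMk : (M : k) ≠ 0 := Nat.cast_ne_zero.mpr hM
  refine ⟨{j | g * (1 + (M * (t + r * j)) ^ 2 * g) ∈ ramifiedValues v F}, ?_, fun n => ?_,
    1 / (4 * g * M * r), fun j hj => ?_⟩
  · refine (isExistentialPoly_ramifiedValues (v := v) hF (C g * (1 + (C (M : k) * (C (t : k) + C (r : k) *
      X 0)) ^ 2 * C g))).congr' fun a => ?_
    simp only [map_add, map_mul, map_pow, eval_C, eval_X, map_one, Set.mem_ofPred_eq]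
  · obtain ⟨hu0, e, q, hq, hq8, hpq, htame⟩ := hT (M * (t + r * n)) ⟨n, rfl⟩
    set T : ℤ := M * (t + r * n) with hTdef
    have hqk : (q : k) ≠ 0 := Nat.cast_ne_zero.mpr hq.ne_zero
    have hrS : (r : k) ∈ localSquares v := by
      have := mem_localSquares_of_dvd_sub_one hpv (n := r) (by
        have := (Nat.modEq_iff_dvd.mp hrp.symm)
        push_cast at this
        exact this)
      exact_mod_cast this
    have hqS := natCast_mem_localSquares_of_jacobiSym_eq_one hp hpv hq8 hpq
    have hrqS : ∀ e : ℕ, (r : k) ^ e * q ∈ localSquares v := by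
      intro e
      induction e with
      | zero => simpa using hqS
      | succ e ih =>
        rw [pow_succ', mul_assoc]
        exact mul_mem_localSquares hrS ih
    have huS : algebraMap (𝓞 k) k (1 + (T : 𝓞 k) ^ 2 * γ) ∈ localSquares v := by
      obtain ⟨s, hs⟩ := hpM
      refine mem_localSquares_of_eq_one_add (y := 2 * s * M * (t + r * n) ^ 2 * γ * p)
        (v.asIdeal.mul_mem_left _ hpv) ?_
      have hs' : (M : 𝓞 k) = 8 * p * s := by
        rw [hs]
        push_cast
        rfl
      rw [hTdef]
      push_cast
      linear_combination (M * (t + r * n) ^ 2 * γ : 𝓞 k) * hs'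
    set a := algebraMap (𝓞 k) k (γ * (1 + (T : 𝓞 k) ^ 2 * γ)) with ha
    set b := algebraMap (𝓞 k) k (r ^ e * Polynomial.aeval γ P * q) with hb
    have hab : ternaryValues (v.adicCompletion k) (algebraMap k _ a) (algebraMap k _ b) =
        ternaryValues (v.adicCompletion k) (algebraMap k _ g)
          (algebraMap k _ (algebraMap (𝓞 k) k (Polynomial.aeval γ P))) := by
      rw [← ternaryValues_mul_localSquare_mul_localSquare (a := g) (b := algebraMap (𝓞 k) k _) huS
        (hrqS e), ha, hb, map_mul _ γ]
      congr 2
      simp only [map_mul, map_pow, map_natCast]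
      ring
    obtain ⟨p', hp', hF'⟩ := hFS a b ((map_ne_zero_iff _ hinj).mpr (mul_ne_zero hγ hu0))
      ((map_ne_zero_iff _ hinj).mpr (mul_ne_zero (mul_ne_zero (pow_ne_zero _
        (Nat.cast_ne_zero.mpr hr)) hβ) (Nat.cast_ne_zero.mpr hq.ne_zero))) htame
    refine ⟨p', ⟨hp', fun e' he' => ?_⟩, ?_⟩
    · rw [← hF', hab]
      exact hram e' he'
    · have := hF' k
      simp only [Algebra.algebraMap_self, RingHom.id_apply] at this
      rw [← this]
      convert left_mem_ternaryValues a b using 1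
      rw [ha, hg, hTdef]
      simp
  · have hnot := notMem_localSquares_of_mem_ramifiedValues hj
    set T : k := M * (t + r * j) with hTdef
    have hintegral : ∀ x : 𝓞 k, v.valuation k (algebraMap (𝓞 k) k x) ≤ 1 := v.valuation_le_one
    have hg1 : v.valuation k (4 * g) ≤ 1 := by
      rw [hg, ← map_ofNat (algebraMap (𝓞 k) k) 4, ← map_mul]
      exact hintegral _
    have h4 : (4 : k) ≠ 0 := by norm_num
    have h4g : v.valuation k (4 * g) ≠ 0 := (Valuation.ne_zero_iff _).mpr (mul_ne_zero h4 hg0)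
    have hT1 : v.valuation k (4 * g * T ^ 2) ≤ 1 := by
      by_contra! h
      have hT0 : T ≠ 0 := by
        rintro h0
        rw [h0, zero_pow two_ne_zero, mul_zero, map_zero] at h
        exact not_lt_zero h
      refine hnot ?_
      rw [show g * (1 + T ^ 2 * g) = (T * g) ^ 2 * (1 + (T ^ 2 * g)⁻¹) by
        field_simp
        ring]
      refine mul_mem_localSquares (sq_mem_localSquares (mul_ne_zero hT0 hg0))
        (mem_localSquares_of_valuation_lt ?_)
      have hTg : 0 < v.valuation k (T ^ 2 * g) :=
        zero_lt_iff.mpr ((Valuation.ne_zero_iff _).mpr (mul_ne_zero (pow_ne_zero 2 hT0) hg0))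
      rw [add_sub_cancel_left, map_inv₀, inv_lt_iff_one_lt_mul₀ hTg, ← map_mul]
      rwa [show 4 * (T ^ 2 * g) = 4 * g * T ^ 2 by ring]
    have hV : 1 ≤ (v.valuation k (4 * g))⁻¹ := (one_le_inv₀ (zero_lt_iff.mpr h4g)).mpr hg1
    have hT2 : v.valuation k T ≤ (v.valuation k (4 * g))⁻¹ := by
      rcases le_total (v.valuation k T) 1 with h | h
      · exact h.trans hV
      · rw [map_mul, mul_comm, ← le_mul_inv_iff₀ (zero_lt_iff.mpr h4g), one_mul, map_pow] at hT1
        exact (le_self_pow₀ h two_ne_zero).trans hT1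
    have hMt : v.valuation k (M * t) ≤ 1 := by
      have := hintegral (M * t)
      rwa [map_mul, map_natCast, map_intCast] at this
    have hj' : v.valuation k (M * r * j) ≤ (v.valuation k (4 * g))⁻¹ := by
      rw [show M * r * j = T - M * t by rw [hTdef]; ring]
      exact (Valuation.map_sub _ _ _).trans (max_le hT2 (hMt.trans hV))
    rw [show (1 : k) / (4 * g * M * r) = (4 * g)⁻¹ * (M * r : k)⁻¹ by field_simp,
      show j = M * r * j * (M * r : k)⁻¹ by field_simp, map_mul _ (M * r * j), map_mul _ (4 * g)⁻¹,
      map_inv₀ _ (4 * g)]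
    exact mul_le_mul_left hj' _

end Main

end NumberField

/-- For a number field `k` and a nonarchimedean place `v` with completion `k_v`, both
`S_v := k^× ∩ k_v^{×2}` and `N_v := k^× − S_v` are diophantine over `k`. -/
theorem Sv_and_Nv_isDiophantine (k : Type*) [Field k] [NumberField k]
    (v : HeightOneSpectrum (NumberField.RingOfIntegers k)) :
    IsDiophantineSet k {t : k | t ≠ 0 ∧
        ∃ a : v.adicCompletion k, a ≠ 0 ∧ a ^ 2 = algebraMap k (v.adicCompletion k) t} ∧
    IsDiophantineSet k {t : k | t ≠ 0 ∧
        ¬ ∃ a : v.adicCompletion k, a ≠ 0 ∧ a ^ 2 = algebraMap k (v.adicCompletion k) t} := by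
  obtain ⟨D, hD, hZ, c, hc⟩ := NumberField.exists_bounded_existential v
  obtain ⟨h1, h2⟩ := NumberField.isDiophantineSet_of_bounded hD hZ hc
  refine ⟨h1, ?_⟩
  convert h2 using 2
  ext t
  exact and_congr_right fun ht => not_congr ⟨fun h => ⟨ht, h⟩, fun h => h.2⟩
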